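/- There exist universal constants c₁, C > 0 such that the following holds. Let X be an isotropic random vector in ℝⁿ with log-concave density which is ψ_α (α ∈ [1,2]) with constant b_α, and let A be an n×n real matrix with ‖A‖_HS² = n. Set ñ := n/(‖A‖_op²·b_α²). Then for every real p ≠ 0 with 1 ≤ |p−2| ≤ c₁·ñ^{α/(2(α+2))}: 1 − C·|p−2|/ñ^{α/(α+2)} ≤ (E|AX|^p)^{1/p} / (E|AX|²)^{1/2} ≤ 1 + C·|p−2|/ñ^{α/(α+2)}. -/

import Mathlib

open MeasureTheory ProbabilityTheory Real
open scoped ENNReal RealInnerProductSpace Pointwise NNReal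

noncomputable section

/-- A nonnegative function is log-concave if `f(λx+(1-λ)y) ≥ f(x)^λ f(y)^{1-λ}`. -/
def IsLogConcaveFn {E : Type*} [AddCommGroup E] [Module ℝ E] (f : E → ℝ) : Prop :=
  (∀ x, 0 ≤ f x) ∧
  ∀ x y : E, ∀ l : ℝ, 0 ≤ l → l ≤ 1 →
    f x ^ l * f y ^ (1 - l) ≤ f (l • x + (1 - l) • y)

/-- Hilbert-Schmidt (Frobenius) norm of a matrix. -/
def hsNorm {n : ℕ} (A : Matrix (Fin n) (Fin n) ℝ) : ℝ :=
  Real.sqrt (∑ i, ∑ j, (A i j) ^ 2)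

/-- Operator norm of a matrix acting on Euclidean space. -/
def opNorm {n : ℕ} (A : Matrix (Fin n) (Fin n) ℝ) : ℝ :=
  ‖LinearMap.toContinuousLinearMap (Matrix.toEuclideanLin A)‖

/-- Application of a matrix to a Euclidean vector. -/
def mApp {n : ℕ} (A : Matrix (Fin n) (Fin n) ℝ) (x : EuclideanSpace ℝ (Fin n)) :
    EuclideanSpace ℝ (Fin n) := Matrix.toEuclideanLin A x

/-- The random vector `X` has density `f` with respect to Lebesgue measure. -/
def HasDensityFn {Ω : Type*} [MeasurableSpace Ω] (P : Measure Ω) {n : ℕ}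
    (X : Ω → EuclideanSpace ℝ (Fin n)) (f : EuclideanSpace ℝ (Fin n) → ℝ) : Prop :=
  Measurable X ∧ Measure.map X P = volume.withDensity fun x => ENNReal.ofReal (f x)

/-- `X` is isotropic: centered with identity covariance. -/
def Isotropic {Ω : Type*} [MeasurableSpace Ω] (P : Measure Ω) {n : ℕ}
    (X : Ω → EuclideanSpace ℝ (Fin n)) : Prop :=
  (∫ ω, X ω ∂P) = 0 ∧
  ∀ θ η : EuclideanSpace ℝ (Fin n), (∫ ω, ⟪X ω, θ⟫ * ⟪X ω, η⟫ ∂P) = ⟪θ, η⟫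

/-- `X` is ψ_α with constant `b`. -/
def IsPsiAlpha {Ω : Type*} [MeasurableSpace Ω] (P : Measure Ω) {n : ℕ}
    (X : Ω → EuclideanSpace ℝ (Fin n)) (α b : ℝ) : Prop :=
  ∀ p : ℝ, 2 ≤ p → ∀ y : EuclideanSpace ℝ (Fin n),
    (∫ ω, |⟪X ω, y⟫| ^ p ∂P) ^ (1/p) ≤ b * p ^ (1/α) * (∫ ω, ⟪X ω, y⟫ ^ 2 ∂P) ^ ((1:ℝ)/2)

/-- `G` is a standard Gaussian random vector in `ℝⁿ`. -/
def IsStdGaussian {Ω : Type*} [MeasurableSpace Ω] (P : Measure Ω) {n : ℕ}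
    (G : Ω → EuclideanSpace ℝ (Fin n)) : Prop :=
  Measurable G ∧
  Measure.map G P = volume.withDensity fun x =>
    ENNReal.ofReal ((2 * π) ^ (-(n:ℝ)/2) * Real.exp (-‖x‖ ^ 2 / 2))

/-- Surface area of the unit sphere `S^{k-1}` in `ℝᵏ`. -/
def sphereVol (k : ℕ) : ℝ := 2 * π ^ ((k : ℝ)/2) / Real.Gamma ((k : ℝ)/2)

/-- The marginal density `π_F g(x) = ∫_{F^⊥} g(x+y) dy`. -/
def marginalDensity {n : ℕ} (g : EuclideanSpace ℝ (Fin n) → ℝ)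
    (F : Submodule ℝ (EuclideanSpace ℝ (Fin n))) (x : EuclideanSpace ℝ (Fin n)) : ℝ :=
  ∫ y : Fᗮ, g (x + y)

/-- `h_{k,p}(u) = vol(S^{k-1}) ∫₀^∞ t^{p+k-1} π_{u(E₀)} g(t u(θ₀)) dt`. -/
def hkp {n : ℕ} (g : EuclideanSpace ℝ (Fin n) → ℝ)
    (E₀ : Submodule ℝ (EuclideanSpace ℝ (Fin n))) (θ₀ : EuclideanSpace ℝ (Fin n))
    (k : ℕ) (p : ℝ) (u : Matrix (Fin n) (Fin n) ℝ) : ℝ :=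
  sphereVol k * ∫ t in Set.Ioi (0:ℝ), t ^ (p + (k:ℝ) - 1) *
    marginalDensity g (Submodule.map (Matrix.toEuclideanLin u) E₀) (t • mApp u θ₀)

/-- Support functional of the one-sided L_q-centroid body `Z⁺_q(w)`. -/
def suppZplus {m : ℕ} (w : EuclideanSpace ℝ (Fin m) → ℝ) (q : ℝ)
    (y : EuclideanSpace ℝ (Fin m)) : ℝ :=
  (2 * ∫ x, (max ⟪x, y⟫ 0) ^ q * w x) ^ (1/q)

/-- Ball's body `K_q(w) = {x : q ∫₀^∞ t^{q-1} w(tx) dt ≥ 1}`. -/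
def ballBody {m : ℕ} (w : EuclideanSpace ℝ (Fin m) → ℝ) (q : ℝ) :
    Set (EuclideanSpace ℝ (Fin m)) :=
  {x | 1 ≤ q * ∫ t in Set.Ioi (0:ℝ), t ^ (q-1) * w (t • x)}

/-- The one-sided L_q-centroid body `Z⁺_q(w)`, as the convex set with support
functional `suppZplus w q`. -/
def ZplusBody {m : ℕ} (w : EuclideanSpace ℝ (Fin m) → ℝ) (q : ℝ) :
    Set (EuclideanSpace ℝ (Fin m)) :=
  {x | ∀ y, ⟪x, y⟫ ≤ suppZplus w q y}

set_option linter.all false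

/-- Prekopa-Leindler property with a cost. -/
def PL {V : Type} [AddCommGroup V] [Module ℝ V] [MeasurableSpace V] (μ : Measure V)
    (c : V → ℝ) : Prop :=
  ∀ u v w : V → ℝ≥0∞, Measurable u → Measurable v → Measurable w →
    (∀ x y, u x * v y ≤ ENNReal.ofReal (Real.exp (c (x - y))) * (w ((1/2:ℝ) • (x+y)))^2) →
    (∫⁻ x, u x ∂μ) * (∫⁻ x, v x ∂μ) ≤ (∫⁻ x, w x ∂μ)^2

lemma bm_half (A S : Set ℝ) (b : ℝ) (h : ∀ a ∈ A, (1/2:ℝ) * (a + b) ∈ S) :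
    volume A ≤ 2 * volume S := by
  have h1 : A ⊆ (fun x => x + b) ⁻¹' ((fun x => (1/2:ℝ) * x) ⁻¹' S) := fun a ha => h a ha
  refine (measure_mono h1).trans ?_
  rw [measure_preimage_add_right, Real.volume_preimage_mul_left (by norm_num)]
  gcongr
  norm_num

lemma bm_compact (A B S : Set ℝ) (hA : IsCompact A) (hB : IsCompact B) (hA' : A.Nonempty)
    (hB' : B.Nonempty) (hS : MeasurableSet S)
    (h : ∀ a ∈ A, ∀ b ∈ B, (1/2:ℝ) * (a + b) ∈ S) :
    volume A + volume B ≤ 2 * volume S := by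
  obtain ⟨a, ha, ha2⟩ := hA.exists_isMaxOn hA' continuousOn_id
  obtain ⟨b, hb, hb2⟩ := hB.exists_isMinOn hB' continuousOn_id
  set c := (1/2:ℝ) * (a + b) with hc
  have h1 : volume A ≤ 2 * volume (S ∩ Set.Iic c) := by
    apply bm_half A _ b
    intro x hx
    refine ⟨h x hx b hb, ?_⟩
    have := ha2 hx
    simp at this ⊢
    rw [hc]; linarith
  have h2 : volume B ≤ 2 * volume (S ∩ Set.Ici c) := by
    apply bm_half B _ a
    intro x hx
    refine ⟨by rw [add_comm]; exact h a ha x hx, ?_⟩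
    have := hb2 hx
    simp at this ⊢
    rw [hc]; linarith
  have h3 : volume (S ∩ Set.Ici c) ≤ volume (S \ Set.Iic c) := by
    have : S ∩ Set.Ici c ⊆ (S \ Set.Iic c) ∪ {c} := by
      intro x hx
      rcases eq_or_lt_of_le (Set.mem_Ici.1 hx.2) with h' | h'
      · right; simp [← h']
      · left; exact ⟨hx.1, by simpa using h'⟩
    refine (measure_mono this).trans ((measure_union_le _ _).trans ?_)
    simp
  calc volume A + volume B ≤ 2 * volume (S ∩ Set.Iic c) + 2 * volume (S \ Set.Iic c) := by
        gcongr; exact h2.trans (by gcongr)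
    _ = 2 * volume S := by
        rw [← mul_add, measure_inter_add_sdiff _ measurableSet_Iic]

lemma bm_one (A B S : Set ℝ) (hA : MeasurableSet A) (hB : MeasurableSet B) (hA' : A.Nonempty)
    (hB' : B.Nonempty) (hS : MeasurableSet S)
    (h : ∀ a ∈ A, ∀ b ∈ B, (1/2:ℝ) * (a + b) ∈ S) :
    volume A + volume B ≤ 2 * volume S := by
  obtain ⟨a0, ha0⟩ := hA'
  obtain ⟨b0, hb0⟩ := hB'
  rw [hA.measure_eq_iSup_isCompact, hB.measure_eq_iSup_isCompact]
  simp_rw [iSup_and']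
  refine ENNReal.biSup_add_biSup_le' ⟨∅, by simp⟩ ⟨∅, by simp⟩ ?_
  rintro K ⟨hK1, hK2⟩ K' ⟨hK1', hK2'⟩
  refine le_trans ?_ (bm_compact (insert a0 K) (insert b0 K') S (hK2.insert _) (hK2'.insert _)
    ⟨a0, by simp⟩ ⟨b0, by simp⟩ hS ?_)
  · gcongr <;> exact Set.subset_insert _ _
  · intro a ha b hb
    apply h
    · rcases ha with rfl | ha; exacts [ha0, hK1 ha]
    · rcases hb with rfl | hb; exacts [hb0, hK1' hb]

lemma pl_norm (u v w : ℝ → ℝ) (hu : Measurable u) (hv : Measurable v) (hw : Measurable w)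
    (hu0 : ∀ x, 0 ≤ u x) (hv0 : ∀ x, 0 ≤ v x) (hw0 : ∀ x, 0 ≤ w x)
    (hu1 : ∀ x, u x ≤ 1) (hv1 : ∀ x, v x ≤ 1)
    (hu2 : ∀ t < 1, ∃ x, t < u x) (hv2 : ∀ t < 1, ∃ x, t < v x)
    (h : ∀ x y, u x * v y ≤ (w ((1/2:ℝ) * (x + y)))^2) :
    (∫⁻ x, ENNReal.ofReal (u x)) + (∫⁻ x, ENNReal.ofReal (v x)) ≤
      2 * ∫⁻ x, ENNReal.ofReal (w x) := by
  rw [lintegral_eq_lintegral_meas_lt _ (.of_forall hu0) hu.aemeasurable,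
    lintegral_eq_lintegral_meas_lt _ (.of_forall hv0) hv.aemeasurable,
    lintegral_eq_lintegral_meas_lt _ (.of_forall hw0) hw.aemeasurable,
    ← lintegral_const_mul' _ _ (by norm_num)]
  have hanti : Antitone fun t : ℝ => volume {a | t < u a} := by
    intro s t hst
    exact measure_mono fun x hx => lt_of_le_of_lt hst hx
  rw [← lintegral_add_left hanti.measurable]
  refine setLIntegral_mono' measurableSet_Ioi ?_
  intro t ht
  simp only [Set.mem_Ioi] at ht
  by_cases ht1 : t < 1
  · refine bm_one _ _ _ (measurableSet_lt measurable_const hu) (measurableSet_lt measurable_const hv)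
      (hu2 t ht1) (hv2 t ht1) (measurableSet_lt measurable_const hw) ?_
    intro a ha b hb
    simp only [Set.mem_ofPred_eq] at ha hb ⊢
    have h1 : t^2 < (w ((1/2:ℝ) * (a + b)))^2 := by
      refine lt_of_lt_of_le ?_ (h a b)
      nlinarith
    exact lt_of_pow_lt_pow_left₀ 2 (hw0 _) h1
  · have e1 : {a | t < u a} = ∅ := by
      ext x; simp; exact (hu1 x).trans (not_lt.mp ht1)
    have e2 : {a | t < v a} = ∅ := by
      ext x; simp; exact (hv1 x).trans (not_lt.mp ht1)
    rw [e1, e2]; simp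

lemma ennreal_amgm (x y z : ℝ≥0∞) (h : x + y ≤ 2 * z) : x * y ≤ z ^ 2 := by
  by_cases hz : z = ∞
  · simp [hz]
  have hx : x ≠ ∞ := by
    rintro rfl; simp at h
    exact ENNReal.mul_ne_top (by norm_num) hz h
  have hy : y ≠ ∞ := by
    rintro rfl; simp at h
    exact ENNReal.mul_ne_top (by norm_num) hz h
  lift x to ℝ≥0 using hx
  lift y to ℝ≥0 using hy
  lift z to ℝ≥0 using hz
  norm_cast at h ⊢
  have h' : (x:ℝ) + y ≤ 2 * z := by exact_mod_cast h
  have : (x:ℝ) * y ≤ z^2 := by nlinarith [sq_nonneg ((x:ℝ) - y), x.2, y.2, z.2]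
  exact_mod_cast this

lemma pl_bdd (u v w : ℝ → ℝ≥0∞) (hu : Measurable u) (hv : Measurable v) (hw : Measurable w)
    (N : ℝ≥0) (huN : ∀ x, u x ≤ N) (hvN : ∀ x, v x ≤ N)
    (h : ∀ x y, u x * v y ≤ (w ((1/2:ℝ) * (x + y)))^2) :
    (∫⁻ x, u x) * (∫⁻ x, v x) ≤ (∫⁻ x, w x)^2 := by
  set a := ⨆ x, u x with ha
  set b := ⨆ x, v x with hb
  have haN : a ≤ N := iSup_le huN
  have hbN : b ≤ N := iSup_le hvN
  have hua : ∀ x, u x ≤ a := fun x => le_iSup u x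
  have hvb : ∀ x, v x ≤ b := fun x => le_iSup v x
  have hat : a ≠ ∞ := ne_top_of_le_ne_top ENNReal.coe_ne_top haN
  have hbt : b ≠ ∞ := ne_top_of_le_ne_top ENNReal.coe_ne_top hbN
  by_cases ha0 : a = 0
  · have : ∀ x, u x = 0 := fun x => le_antisymm (ha0 ▸ hua x) bot_le
    simp [this]
  by_cases hb0 : b = 0
  · have : ∀ x, v x = 0 := fun x => le_antisymm (hb0 ▸ hvb x) bot_le
    simp [this]
  set a' := a.toReal with ha'
  set b' := b.toReal with hb'
  have hap : 0 < a' := ENNReal.toReal_pos ha0 hat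
  have hbp : 0 < b' := ENNReal.toReal_pos hb0 hbt
  set r := Real.sqrt (a' * b') with hr
  have hrp : 0 < r := Real.sqrt_pos.mpr (by positivity)
  have hr2 : r^2 = a' * b' := Real.sq_sqrt (by positivity)
  have hu' : ∀ x, u x = ENNReal.ofReal a' * ENNReal.ofReal ((u x).toReal / a') := by
    intro x
    rw [← ENNReal.ofReal_mul hap.le, mul_div_cancel₀ _ hap.ne',
      ENNReal.ofReal_toReal (ne_top_of_le_ne_top hat (hua x))]
  have hv' : ∀ x, v x = ENNReal.ofReal b' * ENNReal.ofReal ((v x).toReal / b') := by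
    intro x
    rw [← ENNReal.ofReal_mul hbp.le, mul_div_cancel₀ _ hbp.ne',
      ENNReal.ofReal_toReal (ne_top_of_le_ne_top hbt (hvb x))]
  set w2 : ℝ → ℝ := fun x => (min (w x) (ENNReal.ofReal r)).toReal / r with hw2
  have hmt : ∀ x, min (w x) (ENNReal.ofReal r) ≠ ∞ := fun x =>
    ne_top_of_le_ne_top ENNReal.ofReal_ne_top (min_le_right _ _)
  have key := pl_norm (fun x => (u x).toReal / a') (fun x => (v x).toReal / b') w2
    (hu.ennreal_toReal.div_const _) (hv.ennreal_toReal.div_const _)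
    ((hw.min measurable_const).ennreal_toReal.div_const _)
    (fun x => by positivity) (fun x => by positivity) (fun x => by positivity)
    (fun x => by rw [div_le_one hap]; exact ENNReal.toReal_mono hat (hua x))
    (fun x => by rw [div_le_one hbp]; exact ENNReal.toReal_mono hbt (hvb x))
    (fun t ht => by
      by_contra! hcon
      have : a ≤ ENNReal.ofReal (t * a') := by
        refine iSup_le fun x => ?_
        rw [ENNReal.le_ofReal_iff_toReal_le (ne_top_of_le_ne_top hat (hua x))]
        · have := hcon x
          rwa [div_le_iff₀ hap] at this
        · exact le_trans (by positivity) ((div_le_iff₀ hap).1 (hcon x))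
      have h2 := ENNReal.toReal_le_of_le_ofReal (le_trans (by positivity) ((div_le_iff₀ hap).1 (hcon 0))) this
      rw [← ha'] at h2
      nlinarith)
    (fun t ht => by
      by_contra! hcon
      have : b ≤ ENNReal.ofReal (t * b') := by
        refine iSup_le fun x => ?_
        rw [ENNReal.le_ofReal_iff_toReal_le (ne_top_of_le_ne_top hbt (hvb x))]
        · have := hcon x
          rwa [div_le_iff₀ hbp] at this
        · exact le_trans (by positivity) ((div_le_iff₀ hbp).1 (hcon 0 |>.trans' (by positivity) |> fun _ => hcon x))
      have h2 := ENNReal.toReal_le_of_le_ofReal (le_trans (by positivity) ((div_le_iff₀ hbp).1 (hcon 0))) this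
      rw [← hb'] at h2
      nlinarith)
    (fun x y => by
      have h1 : u x * v y ≤ (min (w ((1/2:ℝ) * (x + y))) (ENNReal.ofReal r))^2 := by
        rcases min_cases (w ((1/2:ℝ) * (x + y))) (ENNReal.ofReal r) with hh | hh
        · rw [hh.1]; exact h x y
        · rw [hh.1, ← ENNReal.ofReal_pow hrp.le, hr2, ENNReal.ofReal_mul hap.le, ha', hb',
            ENNReal.ofReal_toReal hat, ENNReal.ofReal_toReal hbt]
          exact mul_le_mul' (hua x) (hvb y)
      have h2 := ENNReal.toReal_mono (ENNReal.pow_ne_top (hmt _)) h1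
      rw [ENNReal.toReal_mul, ENNReal.toReal_pow] at h2
      simp only [hw2]
      rw [div_mul_div_comm, div_pow, hr2]
      gcongr)
  have key2 := ennreal_amgm _ _ _ key
  have e1 : ∫⁻ x, u x = ENNReal.ofReal a' * ∫⁻ x, ENNReal.ofReal ((u x).toReal / a') := by
    rw [← lintegral_const_mul' _ _ ENNReal.ofReal_ne_top]
    exact lintegral_congr hu'
  have e2 : ∫⁻ x, v x = ENNReal.ofReal b' * ∫⁻ x, ENNReal.ofReal ((v x).toReal / b') := by
    rw [← lintegral_const_mul' _ _ ENNReal.ofReal_ne_top]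
    exact lintegral_congr hv'
  have e3 : ENNReal.ofReal r * ∫⁻ x, ENNReal.ofReal (w2 x) ≤ ∫⁻ x, w x := by
    rw [← lintegral_const_mul' _ _ ENNReal.ofReal_ne_top]
    refine lintegral_mono fun x => ?_
    simp only [hw2]
    rw [← ENNReal.ofReal_mul hrp.le, mul_div_cancel₀ _ hrp.ne', ENNReal.ofReal_toReal (hmt x)]
    exact min_le_left _ _
  rw [e1, e2]
  calc _ = ENNReal.ofReal (r^2) * ((∫⁻ x, ENNReal.ofReal ((u x).toReal / a')) *
        ∫⁻ x, ENNReal.ofReal ((v x).toReal / b')) := by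
        rw [hr2, ENNReal.ofReal_mul hap.le]; ring
    _ ≤ ENNReal.ofReal (r^2) * (∫⁻ x, ENNReal.ofReal (w2 x))^2 := by gcongr
    _ = (ENNReal.ofReal r * ∫⁻ x, ENNReal.ofReal (w2 x))^2 := by
        rw [ENNReal.ofReal_pow hrp.le, mul_pow]
    _ ≤ _ := by gcongr

lemma trunc_tendsto {V : Type} [MeasurableSpace V] (μ : Measure V) (u : V → ℝ≥0∞)
    (hu : Measurable u) :
    Filter.Tendsto (fun N : ℕ => ∫⁻ x, min (u x) N ∂μ) Filter.atTop (nhds (∫⁻ x, u x ∂μ)) := by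
  apply lintegral_tendsto_of_tendsto_of_monotone
  · intro N; exact (hu.min measurable_const).aemeasurable
  · refine .of_forall fun x => ?_
    intro m n hmn
    simp only
    gcongr
  · refine .of_forall fun x => ?_
    have : Filter.Tendsto (fun N : ℕ => min (u x) (N:ℝ≥0∞)) Filter.atTop (nhds (min (u x) ∞)) :=
      tendsto_const_nhds.min ENNReal.tendsto_nat_nhds_top
    simpa using this

lemma pl_volume : PL (volume : Measure ℝ) (fun _ => 0) := by
  intro u v w hu hv hw h
  by_cases hu0 : ∫⁻ x, u x = 0
  · simp [hu0]
  by_cases hv0 : ∫⁻ x, v x = 0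
  · simp [hv0]
  have ht := ENNReal.Tendsto.mul (trunc_tendsto volume u hu) (.inl hu0)
    (trunc_tendsto volume v hv) (.inl hv0)
  refine le_of_tendsto' ht fun N => ?_
  refine pl_bdd _ _ w (hu.min measurable_const) (hv.min measurable_const) hw N
    (fun x => by simp) (fun x => by simp) ?_
  intro x y
  refine le_trans (mul_le_mul' (min_le_left _ _) (min_le_left _ _)) ((h x y).trans ?_)
  simp



lemma exp_half_sq (a : ℝ) : ENNReal.ofReal (Real.exp a) = (ENNReal.ofReal (Real.exp (a/2)))^2 := by
  rw [← ENNReal.ofReal_pow (Real.exp_nonneg _), ← Real.exp_nat_mul]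
  congr 2; push_cast; ring

lemma PL.prod {V W : Type} [AddCommGroup V] [Module ℝ V] [MeasurableSpace V]
    [AddCommGroup W] [Module ℝ W] [MeasurableSpace W] {μ : Measure V} {ν : Measure W}
    [SFinite ν] {c : V → ℝ} {d : W → ℝ} (hμ : PL μ c) (hν : PL ν d) :
    PL (μ.prod ν) (fun z => c z.1 + d z.2) := by
  intro u v w hu hv hw h
  rw [lintegral_prod _ hu.aemeasurable, lintegral_prod _ hv.aemeasurable,
    lintegral_prod _ hw.aemeasurable]
  refine hμ _ _ _ hu.lintegral_prod_right' hv.lintegral_prod_right' hw.lintegral_prod_right' ?_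
  intro x x'
  have := hν (fun y => u (x, y)) (fun y => v (x', y))
    (fun y => ENNReal.ofReal (Real.exp (c (x - x') / 2)) * w ((1/2:ℝ) • (x + x'), y))
    (hu.comp measurable_prodMk_left) (hv.comp measurable_prodMk_left)
    ((hw.comp measurable_prodMk_left).const_mul _) ?_
  · refine this.trans (le_of_eq ?_)
    rw [lintegral_const_mul' _ _ ENNReal.ofReal_ne_top, mul_pow, ← exp_half_sq]
  · intro y y'
    refine (h (x, y) (x', y')).trans (le_of_eq ?_)
    simp only [Prod.mk_sub_mk, Prod.mk_add_mk, Prod.smul_mk]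
    rw [mul_pow, ← exp_half_sq, Real.exp_add, ENNReal.ofReal_mul (Real.exp_nonneg _)]
    ring

lemma PL.map {V W : Type} [AddCommGroup V] [Module ℝ V] [MeasurableSpace V]
    [AddCommGroup W] [Module ℝ W] [MeasurableSpace W] {μ : Measure V} {c : V → ℝ} {d : W → ℝ}
    (hμ : PL μ c) (L : V → W) (hL : Measurable L)
    (hmid : ∀ x y, L ((1/2:ℝ) • (x + y)) = (1/2:ℝ) • (L x + L y))
    (hd : ∀ x y, d (L x - L y) ≤ c (x - y)) : PL (μ.map L) d := by
  intro u v w hu hv hw h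
  rw [lintegral_map hu hL, lintegral_map hv hL, lintegral_map hw hL]
  refine hμ _ _ _ (hu.comp hL) (hv.comp hL) (hw.comp hL) ?_
  intro x y
  refine (h (L x) (L y)).trans ?_
  simp only [Function.comp, hmid]
  gcongr
  exact hd x y

lemma PL.withDensity {V : Type} [AddCommGroup V] [Module ℝ V] [MeasurableSpace V]
    {μ : Measure V} {c c' d : V → ℝ}
    (hμ : PL μ c) (g : V → ℝ≥0∞) (hg : Measurable g)
    (hgg : ∀ x y, g x * g y ≤ ENNReal.ofReal (Real.exp (d (x - y))) * (g ((1/2:ℝ) • (x+y)))^2)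
    (hd : ∀ x, c' x + d x ≤ c x) : PL (μ.withDensity g) c' := by
  intro u v w hu hv hw h
  rw [lintegral_withDensity_eq_lintegral_mul _ hg hu,
    lintegral_withDensity_eq_lintegral_mul _ hg hv, lintegral_withDensity_eq_lintegral_mul _ hg hw]
  refine hμ _ _ _ (hg.mul hu) (hg.mul hv) (hg.mul hw) ?_
  intro x y
  simp only [Pi.mul_apply]
  calc g x * u x * (g y * v y) = (g x * g y) * (u x * v y) := by ring
    _ ≤ (ENNReal.ofReal (Real.exp (d (x - y))) * (g ((1/2:ℝ) • (x+y)))^2) *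
        (ENNReal.ofReal (Real.exp (c' (x - y))) * (w ((1/2:ℝ) • (x+y)))^2) :=
        mul_le_mul' (hgg x y) (h x y)
    _ = ENNReal.ofReal (Real.exp (c' (x - y) + d (x - y))) *
        (g ((1/2:ℝ) • (x+y)) * w ((1/2:ℝ) • (x+y)))^2 := by
        rw [Real.exp_add, ENNReal.ofReal_mul (Real.exp_nonneg _)]; ring
    _ ≤ _ := by gcongr; exact hd _

lemma PL.pi {V : Type} [AddCommGroup V] [Module ℝ V] [MeasurableSpace V] {μ : Measure V}
    [SigmaFinite μ] {c : V → ℝ} (hμ : PL μ c) (k : ℕ) :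
    PL (Measure.pi (fun _ : Fin k => μ)) (fun x => ∑ i, c (x i)) := by
  induction k with
  | zero =>
    intro u v w hu hv hw h
    rw [Measure.pi_of_empty, lintegral_dirac', lintegral_dirac', lintegral_dirac']
    · refine (h _ _).trans (le_of_eq ?_)
      simp only [Finset.univ_eq_empty, Finset.sum_empty, Real.exp_zero, ENNReal.ofReal_one, one_mul]
      congr 2
      exact Subsingleton.elim _ _
    all_goals assumption
  | succ k ih =>
    have e := (measurePreserving_piFinSuccAbove (fun _ : Fin (k+1) => μ) 0).symm
    rw [← e.map_eq]
    refine (hμ.prod ih).map _ (MeasurableEquiv.measurable _) ?_ ?_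
    · intro x y
      ext i
      refine Fin.cases ?_ (fun j => ?_) i <;> simp [MeasurableEquiv.piFinSuccAbove]
    · intro x y
      simp [Fin.sum_univ_succ, MeasurableEquiv.piFinSuccAbove]

lemma pl_gaussian : PL (gaussianReal 0 1) (fun x => x^2/4) := by
  rw [gaussianReal_of_var_ne_zero _ (by norm_num)]
  refine pl_volume.withDensity (d := fun x => -(x^2/4)) _ (measurable_gaussianPDF 0 1) ?_ ?_
  · intro x y
    simp only [gaussianPDF]
    rw [← ENNReal.ofReal_pow (gaussianPDFReal_nonneg _ _ _), ← ENNReal.ofReal_mul (gaussianPDFReal_nonneg _ _ _),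
      ← ENNReal.ofReal_mul (Real.exp_nonneg _)]
    apply le_of_eq
    congr 1
    simp only [gaussianPDFReal, mul_pow, ← Real.exp_nat_mul, smul_eq_mul]
    rw [mul_mul_mul_comm, ← Real.exp_add, mul_left_comm, ← Real.exp_add]
    congr 1
    · ring
    · congr 1
      push_cast
      ring
  · intro x; simp

/-- Gaussian measure on `Fin n → ℝ`. -/
def gv (n : ℕ) : Measure (Fin n → ℝ) := Measure.pi (fun _ => gaussianReal 0 1)

instance (n : ℕ) : IsProbabilityMeasure (gv n) := by unfold gv; infer_instance

/-- Gaussian measure on matrices. -/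
def gm (k n : ℕ) : Measure (Fin k → Fin n → ℝ) := Measure.pi (fun _ => gv n)

instance (k n : ℕ) : IsProbabilityMeasure (gm k n) := by unfold gm; infer_instance

lemma pl_gm (k n : ℕ) : PL (gm k n) (fun H => ∑ i, ∑ j, (H i j)^2/4) :=
  (pl_gaussian.pi n).pi k



lemma pl_euclid (n : ℕ) : PL (volume : Measure (EuclideanSpace ℝ (Fin n))) (fun _ => 0) := by
  have e := PiLp.volume_preserving_toLp (Fin n)
  rw [← e.map_eq]
  have h := pl_volume.pi n
  rw [← volume_pi] at h
  refine h.map _ (WithLp.measurable_toLp 2 _) ?_ ?_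
  · intro x y; rfl
  · intro x y; simp

lemma law_PL {Ω : Type} [MeasurableSpace Ω] (P : Measure Ω) {n : ℕ}
    (X : Ω → EuclideanSpace ℝ (Fin n)) (f : EuclideanSpace ℝ (Fin n) → ℝ)
    (hd : HasDensityFn P X f) (hlc : IsLogConcaveFn f) : PL (P.map X) (fun _ => 0) := by
  obtain ⟨hf0, hf⟩ := hlc
  set S : Set (EuclideanSpace ℝ (Fin n)) := {x | 0 < f x} with hS
  have hSc : Convex ℝ S := by
    intro x hx y hy a b ha hb hab
    have hb' : b = 1 - a := by linarith
    subst hb'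
    refine lt_of_lt_of_le ?_ (hf x y a ha (by linarith))
    have h1 : 0 < f x := hx
    have h2 : 0 < f y := hy
    positivity
  set U := interior S with hU
  have hUc : Convex ℝ U := hSc.interior
  have hUo : IsOpen U := isOpen_interior
  have hUS : U ⊆ S := interior_subset
  have hconc : ConcaveOn ℝ U (fun x => Real.log (f x)) := by
    refine ⟨hUc, ?_⟩
    intro x hx y hy a b ha hb hab
    have hb' : b = 1 - a := by linarith
    subst hb'
    have h1 : 0 < f x := hUS hx
    have h2 : 0 < f y := hUS hy
    have h3 := Real.log_le_log (by positivity) (hf x y a ha (by linarith))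
    rw [Real.log_mul (by positivity) (by positivity), Real.log_rpow h1, Real.log_rpow h2] at h3
    simpa using h3
  have hcont : ContinuousOn f U := by
    have h1 := (hconc.continuousOn hUo).rexp
    refine h1.congr ?_
    intro x hx
    exact (Real.exp_log (hUS hx)).symm
  set g := U.indicator f with hg
  have hgm : Measurable g := by
    classical
    have : g = U.piecewise f (fun _ => 0) := by
      ext x; simp [hg, Set.indicator, Set.piecewise]
    rw [this]
    exact hcont.measurable_piecewise continuousOn_const hUo.measurableSet
  have hae : (fun x => ENNReal.ofReal (f x)) =ᵐ[volume] fun x => ENNReal.ofReal (g x) := by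
    have h0 : volume (frontier S) = 0 := hSc.addHaar_frontier volume
    have := measure_eq_zero_iff_ae_notMem.1 h0
    filter_upwards [this] with x hx
    by_cases hxU : x ∈ U
    · simp [hg, hxU]
    · have hxS : x ∉ S := fun hxS => hx ⟨subset_closure hxS, hxU⟩
      have : f x = 0 := le_antisymm (not_lt.1 hxS) (hf0 x)
      simp [hg, hxU, this]
  rw [hd.2, withDensity_congr_ae hae]
  refine (pl_euclid n).withDensity (d := fun _ => 0) _ hgm.ennreal_ofReal ?_ (by simp)
  intro x y
  have hg0 : ∀ x, 0 ≤ g x := fun x => Set.indicator_nonneg (fun x _ => hf0 x) x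
  rw [Real.exp_zero, ENNReal.ofReal_one, one_mul, ← ENNReal.ofReal_mul (hg0 _),
    ← ENNReal.ofReal_pow (hg0 _)]
  apply ENNReal.ofReal_le_ofReal
  by_cases hx : x ∈ U
  · by_cases hy : y ∈ U
    · have hm : (1/2:ℝ) • (x + y) ∈ U := by
        rw [smul_add]; exact hUc hx hy (by norm_num) (by norm_num) (by norm_num)
      simp only [hg, hx, hy, hm, Set.indicator_of_mem]
      have h1 := hf x y (1/2) (by norm_num) (by norm_num)
      rw [show (1 - 1/2 : ℝ) = 1/2 by norm_num, ← smul_add, ← Real.sqrt_eq_rpow,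
        ← Real.sqrt_eq_rpow, ← Real.sqrt_mul (hf0 x)] at h1
      rw [← Real.sq_sqrt (mul_nonneg (hf0 x) (hf0 y))]
      gcongr
    · simp [hg, hy]; positivity
  · simp [hg, hx]; positivity



lemma mom_step (ρ : Measure ℝ) [IsProbabilityMeasure ρ] (h : PL ρ (fun _ => 0))
    (h2 : ∫⁻ s, ENNReal.ofReal (s^2) ∂ρ ≤ 1) (a : ℕ) :
    ∫⁻ s, (ENNReal.ofReal s)^(2*a) ∂ρ ≤
      16^a * (1 + (4/3) * (∫⁻ s, (ENNReal.ofReal s)^a ∂ρ)^2) := by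
  have hm : ρ (Set.Ici (-2:ℝ)) ≥ 3/4 := by
    have h3 : ρ (Set.Iio (-2:ℝ)) ≤ 1/4 := by
      have h4 := mul_meas_ge_le_lintegral (μ := ρ) (f := fun s : ℝ => ENNReal.ofReal (s^2))
        (by fun_prop) 4
      have h5 : ρ (Set.Iio (-2:ℝ)) ≤ ρ {x | 4 ≤ ENNReal.ofReal (x^2)} := by
        apply measure_mono
        intro x hx
        simp only [Set.mem_Iio, Set.mem_ofPred_eq] at hx ⊢
        rw [show (4:ℝ≥0∞) = ENNReal.ofReal 4 by norm_num]
        apply ENNReal.ofReal_le_ofReal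
        nlinarith
      have h6 : 4 * ρ (Set.Iio (-2:ℝ)) ≤ 1 := le_trans (by gcongr) (h4.trans h2)
      rw [ENNReal.le_div_iff_mul_le (by norm_num) (by norm_num), mul_comm]
      exact h6
    have h7 : ρ (Set.Ici (-2:ℝ)) = 1 - ρ (Set.Iio (-2:ℝ)) := by
      rw [← prob_compl_eq_one_sub measurableSet_Iio, Set.compl_Iio]
    rw [h7]
    calc (3/4 : ℝ≥0∞) = 1 - 1/4 := by
          rw [show (3/4 : ℝ≥0∞) = ENNReal.ofReal (3/4) by rw [ENNReal.ofReal_div_of_pos] <;> norm_num,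
            show (1/4 : ℝ≥0∞) = ENNReal.ofReal (1/4) by rw [ENNReal.ofReal_div_of_pos] <;> norm_num,
            show (1 : ℝ≥0∞) = ENNReal.ofReal 1 by norm_num, ← ENNReal.ofReal_sub]
          norm_num
          norm_num
      _ ≤ _ := tsub_le_tsub_left h3 _
  have key := h (fun s => (ENNReal.ofReal (s-2))^(2*a)) ((Set.Ici (-2:ℝ)).indicator 1)
    (fun s => 2^a * (ENNReal.ofReal s)^a) (by fun_prop)
    (measurable_one.indicator measurableSet_Ici) (by fun_prop) ?_
  · rw [lintegral_indicator_one measurableSet_Ici,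
      lintegral_const_mul' _ _ (ENNReal.pow_ne_top (by norm_num))] at key
    set I := ∫⁻ s, (ENNReal.ofReal (s-2))^(2*a) ∂ρ with hI
    set M := ∫⁻ s, (ENNReal.ofReal s)^a ∂ρ with hM
    have k1 : I ≤ (4/3) * (4^a * M^2) := by
      have k2 : I * (3/4) ≤ 4^a * M^2 := by
        calc I * (3/4) ≤ I * ρ (Set.Ici (-2:ℝ)) := by gcongr
          _ ≤ _ := key
          _ = _ := by rw [mul_pow, ← pow_mul, mul_comm a 2, pow_mul]; norm_num
      calc I = (4/3) * (I * (3/4)) := by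
            rw [mul_comm I, ← mul_assoc]
            have : (4/3 : ℝ≥0∞) * (3/4) = 1 := by
              rw [ENNReal.div_eq_inv_mul, ENNReal.div_eq_inv_mul]
              rw [mul_mul_mul_comm, mul_comm 4 (3:ℝ≥0∞), mul_mul_mul_comm,
                ENNReal.inv_mul_cancel (by norm_num) (by norm_num),
                ENNReal.inv_mul_cancel (by norm_num) (by norm_num), one_mul]
            rw [this, one_mul]
        _ ≤ _ := by gcongr
    have k3 : ∫⁻ s, (ENNReal.ofReal s)^(2*a) ∂ρ ≤ 4^a * (4^a + I) := by
      calc _ ≤ ∫⁻ s, (4^a * (4^a + (ENNReal.ofReal (s-2))^(2*a))) ∂ρ := by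
            refine lintegral_mono fun s => ?_
            have e1 : ENNReal.ofReal s ≤ 2 * max 2 (ENNReal.ofReal (s-2)) := by
              calc ENNReal.ofReal s ≤ ENNReal.ofReal (2 + max (s-2) 0) := by
                    apply ENNReal.ofReal_le_ofReal
                    linarith [le_max_left (s-2) 0]
                _ = 2 + ENNReal.ofReal (s-2) := by
                    rw [ENNReal.ofReal_add (by norm_num) (le_max_right _ _), ENNReal.ofReal_max]
                    simp
                _ ≤ _ := by
                    rw [two_mul]
                    gcongr
                    · exact le_max_left _ _
                    · exact le_max_right _ _
            calc (ENNReal.ofReal s)^(2*a) ≤ (2 * max 2 (ENNReal.ofReal (s-2)))^(2*a) := by gcongr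
              _ = 4^a * (max 2 (ENNReal.ofReal (s-2)))^(2*a) := by
                  rw [mul_pow, pow_mul]; norm_num
              _ ≤ _ := by
                  gcongr
                  rcases max_cases (2:ℝ≥0∞) (ENNReal.ofReal (s-2)) with hh | hh
                  · rw [hh.1, pow_mul]; norm_num
                  · rw [hh.1]; exact le_add_self
        _ = _ := by
            rw [lintegral_const_mul' _ _ (ENNReal.pow_ne_top (by norm_num)),
              lintegral_add_left measurable_const, ← hI]
            simp
    refine k3.trans ?_
    calc (4:ℝ≥0∞)^a * (4^a + I) ≤ 4^a * (4^a + (4/3) * (4^a * M^2)) := by gcongr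
      _ = (4*4)^a * (1 + (4/3) * M^2) := by rw [mul_pow]; ring
      _ = _ := by norm_num
  · intro x y
    by_cases hy : y ∈ Set.Ici (-2:ℝ)
    · simp only [hy, Set.indicator_of_mem, Pi.one_apply, mul_one, Real.exp_zero, ENNReal.ofReal_one,
        one_mul, smul_eq_mul]
      rw [← mul_pow, ← pow_mul, mul_comm a 2]
      gcongr
      calc ENNReal.ofReal (x-2) ≤ ENNReal.ofReal (2 * (1/2 * (x+y))) := by
            apply ENNReal.ofReal_le_ofReal
            simp at hy; linarith
        _ = _ := by rw [ENNReal.ofReal_mul (by norm_num)]; norm_num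
    · simp [hy]

lemma PL.neg_real {ρ : Measure ℝ} (h : PL ρ (fun _ => 0)) (c : ℝ) :
    PL (ρ.map (fun s => c * s)) (fun _ => 0) :=
  h.map _ (by fun_prop) (by intro x y; simp; ring) (by simp)

lemma pow_abs_split (s : ℝ) (a : ℕ) :
    ENNReal.ofReal (|s|^a) ≤ (ENNReal.ofReal s)^a + (ENNReal.ofReal ((-1) * s))^a := by
  rw [ENNReal.ofReal_pow (abs_nonneg _)]
  rcases le_total 0 s with hs | hs
  · rw [abs_of_nonneg hs]; exact le_self_add
  · rw [abs_of_nonpos hs]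
    have : -s = (-1) * s := by ring
    rw [this]; exact le_add_self

lemma mom4_half (ρ : Measure ℝ) [IsProbabilityMeasure ρ] (h : PL ρ (fun _ => 0))
    (h2 : ∫⁻ s, ENNReal.ofReal (s^2) ∂ρ ≤ 1) :
    ∫⁻ s, (ENNReal.ofReal s)^4 ∂ρ ≤ 600 := by
  have := mom_step ρ h h2 2
  have h3 : ∫⁻ s, (ENNReal.ofReal s)^2 ∂ρ ≤ 1 := by
    refine le_trans (lintegral_mono fun s => ?_) h2
    simp only
    rw [← sq_abs, ENNReal.ofReal_pow (abs_nonneg _)]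
    gcongr
    exact le_abs_self s
  refine this.trans ?_
  calc (16:ℝ≥0∞)^2 * (1 + (4/3) * (∫⁻ s, (ENNReal.ofReal s)^2 ∂ρ)^2) ≤ 16^2 * (1 + (4/3) * 1^2) := by
        gcongr
    _ ≤ 600 := by
        rw [show (4/3 : ℝ≥0∞) = ENNReal.ofReal (4/3) by rw [ENNReal.ofReal_div_of_pos] <;> norm_num,
          show (16 : ℝ≥0∞) = ENNReal.ofReal 16 by norm_num,
          show (1 : ℝ≥0∞) = ENNReal.ofReal 1 by norm_num, show (600 : ℝ≥0∞) = ENNReal.ofReal 600 by norm_num,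
          ← ENNReal.ofReal_pow (by norm_num), ← ENNReal.ofReal_pow (by norm_num),
          ← ENNReal.ofReal_mul (by norm_num), ← ENNReal.ofReal_add (by norm_num) (by norm_num),
          ← ENNReal.ofReal_mul (by norm_num)]
        apply ENNReal.ofReal_le_ofReal
        norm_num

lemma sq_map_neg (ρ : Measure ℝ) (c : ℝ) :
    ∫⁻ s, ENNReal.ofReal (s^2) ∂(ρ.map (fun s => c * s)) =
      ENNReal.ofReal (c^2) * ∫⁻ s, ENNReal.ofReal (s^2) ∂ρ := by
  rw [lintegral_map (by fun_prop) (by fun_prop), ← lintegral_const_mul' _ _ ENNReal.ofReal_ne_top]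
  refine lintegral_congr fun s => ?_
  rw [mul_pow, ENNReal.ofReal_mul (by positivity)]

lemma mom4 (ρ : Measure ℝ) [IsProbabilityMeasure ρ] (h : PL ρ (fun _ => 0))
    (h2 : ∫⁻ s, ENNReal.ofReal (s^2) ∂ρ ≤ 1) :
    ∫⁻ s, ENNReal.ofReal (s^4) ∂ρ ≤ 1200 := by
  have i2 : IsProbabilityMeasure (ρ.map (fun s => (-1:ℝ) * s)) :=
    Measure.isProbabilityMeasure_map (by fun_prop)
  have h1 := mom4_half ρ h h2
  have h3 := mom4_half (ρ.map (fun s => (-1:ℝ) * s)) (h.neg_real _) (by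
    rw [sq_map_neg]; simpa using h2)
  rw [lintegral_map (by fun_prop) (by fun_prop)] at h3
  calc _ ≤ ∫⁻ s, ((ENNReal.ofReal s)^4 + (ENNReal.ofReal ((-1) * s))^4) ∂ρ := by
        refine lintegral_mono fun s => ?_
        have := pow_abs_split s 4
        rwa [show |s|^4 = s^4 by rw [show 4 = 2 * 2 by rfl, pow_mul, pow_mul, sq_abs]] at this
    _ ≤ 600 + 600 := by
        rw [lintegral_add_left (by fun_prop)]; gcongr
    _ = _ := by norm_num

lemma momfin_half (ρ : Measure ℝ) [IsProbabilityMeasure ρ] (h : PL ρ (fun _ => 0))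
    (h2 : ∫⁻ s, ENNReal.ofReal (s^2) ∂ρ ≤ 1) (j : ℕ) :
    ∫⁻ s, (ENNReal.ofReal s)^(2^(j+1)) ∂ρ ≠ ∞ := by
  induction j with
  | zero =>
    refine ne_top_of_le_ne_top ENNReal.one_ne_top (le_trans (lintegral_mono fun s => ?_) h2)
    simp only [zero_add, pow_one]
    rw [← sq_abs, ENNReal.ofReal_pow (abs_nonneg _)]
    gcongr
    exact le_abs_self s
  | succ j ih =>
    have := mom_step ρ h h2 (2^(j+1))
    rw [← pow_succ'] at this
    refine ne_top_of_le_ne_top ?_ this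
    refine ENNReal.mul_ne_top (ENNReal.pow_ne_top (by norm_num)) ?_
    refine ENNReal.add_ne_top.2 ⟨by norm_num, ENNReal.mul_ne_top ?_ (ENNReal.pow_ne_top ih)⟩
    exact ENNReal.div_ne_top (by norm_num) (by norm_num)

lemma momfin_one (ρ : Measure ℝ) [IsProbabilityMeasure ρ] (h : PL ρ (fun _ => 0))
    (h2 : ∫⁻ s, ENNReal.ofReal (s^2) ∂ρ ≤ 1) (a : ℕ) :
    ∫⁻ s, ENNReal.ofReal (|s|^a) ∂ρ ≠ ∞ := by
  have i2 : IsProbabilityMeasure (ρ.map (fun s => (-1:ℝ) * s)) :=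
    Measure.isProbabilityMeasure_map (by fun_prop)
  have h1 := momfin_half ρ h h2 a
  have h3 := momfin_half (ρ.map (fun s => (-1:ℝ) * s)) (h.neg_real _) (by
    rw [sq_map_neg]; simpa using h2) a
  rw [lintegral_map (by fun_prop) (by fun_prop)] at h3
  have ha : a ≤ 2^(a+1) := (Nat.lt_two_pow_self (n := a)).le.trans (Nat.pow_le_pow_right (by norm_num) (by omega))
  refine ne_top_of_le_ne_top (b := ∫⁻ s, (1 + ((ENNReal.ofReal s)^(2^(a+1)) + (ENNReal.ofReal ((-1) * s))^(2^(a+1)))) ∂ρ) ?_ ?_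
  · rw [lintegral_add_left measurable_const, lintegral_add_left (by fun_prop)]
    simp only [lintegral_const, measure_univ, mul_one]
    exact ENNReal.add_ne_top.2 ⟨by norm_num, ENNReal.add_ne_top.2 ⟨h1, h3⟩⟩
  · refine lintegral_mono fun s => ?_
    have h4 : |s|^a ≤ 1 + |s|^(2^(a+1)) := by
      rcases le_total (|s|) 1 with hs | hs
      · have := pow_le_one₀ (n := a) (abs_nonneg s) hs
        have : 0 ≤ |s|^(2^(a+1)) := by positivity
        linarith
      · have := pow_le_pow_right₀ hs ha
        linarith
    calc ENNReal.ofReal (|s|^a) ≤ ENNReal.ofReal (1 + |s|^(2^(a+1))) := ENNReal.ofReal_le_ofReal h4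
      _ = 1 + ENNReal.ofReal (|s|^(2^(a+1))) := by
          rw [ENNReal.ofReal_add (by norm_num) (by positivity)]; simp
      _ ≤ _ := by gcongr; exact pow_abs_split s _

lemma momfin (ρ : Measure ℝ) [IsProbabilityMeasure ρ] (h : PL ρ (fun _ => 0))
    (h2 : ∫⁻ s, ENNReal.ofReal (s^2) ∂ρ ≠ ∞) (a : ℕ) :
    ∫⁻ s, ENNReal.ofReal (|s|^a) ∂ρ ≠ ∞ := by
  set T := (∫⁻ s, ENNReal.ofReal (s^2) ∂ρ).toReal with hT
  have hT0 : 0 ≤ T := ENNReal.toReal_nonneg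
  set c : ℝ := (1 + T)⁻¹ with hc
  have hc0 : 0 < c := by positivity
  have i2 : IsProbabilityMeasure (ρ.map (fun s => c * s)) :=
    Measure.isProbabilityMeasure_map (by fun_prop)
  have h1 := momfin_one (ρ.map (fun s => c * s)) (h.neg_real _) (by
    rw [sq_map_neg, ← ENNReal.ofReal_toReal h2, ← ENNReal.ofReal_mul (by positivity), ← hT]
    rw [← ENNReal.ofReal_one]
    apply ENNReal.ofReal_le_ofReal
    rw [hc, inv_pow, inv_mul_le_iff₀ (by positivity)]
    nlinarith) a
  rw [lintegral_map (by fun_prop) (by fun_prop)] at h1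
  intro hcon
  apply h1
  have : ∀ s : ℝ, ENNReal.ofReal (|c * s|^a) = ENNReal.ofReal (c^a) * ENNReal.ofReal (|s|^a) := by
    intro s
    rw [← ENNReal.ofReal_mul (by positivity), abs_mul, abs_of_pos hc0, mul_pow]
  simp_rw [this]
  rw [lintegral_const_mul' _ _ ENNReal.ofReal_ne_top, hcon, ENNReal.mul_top]
  simp; positivity



open scoped Matrix

lemma lint_pi_succ {V : Type} [MeasurableSpace V] (μ : Measure V) [SigmaFinite μ] (n : ℕ)
    (F : (Fin (n+1) → V) → ℝ≥0∞) (hF : Measurable F) :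
    ∫⁻ g, F g ∂(Measure.pi (fun _ => μ)) =
      ∫⁻ p : (Fin n → V), ∫⁻ x : V, F (Fin.cons x p) ∂μ ∂(Measure.pi (fun _ => μ)) := by
  have e := (measurePreserving_piFinSuccAbove (fun _ : Fin (n+1) => μ) 0).symm
  rw [← e.map_eq, lintegral_map hF (MeasurableEquiv.measurable _)]
  have := lintegral_prod_symm' (μ := μ) (ν := Measure.pi (fun _ : Fin n => μ)) _
    (hF.comp (MeasurableEquiv.measurable (MeasurableEquiv.piFinSuccAbove (fun _ => V) 0).symm))
  simp only [Function.comp] at this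
  rw [this]
  simp only [MeasurableEquiv.piFinSuccAbove_symm_apply, Fin.insertNthEquiv_zero]
  rfl

lemma lint_pi {V : Type} [MeasurableSpace V] (μ : Measure V) [SigmaFinite μ] (n : ℕ)
    (f : Fin n → V → ℝ≥0∞) (hf : ∀ i, Measurable (f i)) :
    ∫⁻ g, ∏ i, f i (g i) ∂(Measure.pi (fun _ => μ)) = ∏ i, ∫⁻ x, f i x ∂μ := by
  induction n with
  | zero => simp
  | succ n ih =>
    rw [lint_pi_succ _ _ _ (by
      refine Finset.measurable_prod _ fun i _ => (hf i).comp (measurable_pi_apply i))]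
    simp only [Fin.prod_univ_succ, Fin.cons_zero, Fin.cons_succ]
    simp_rw [lintegral_mul_const _ (hf 0)]
    rw [lintegral_const_mul _ (by
      refine Finset.measurable_prod _ fun i _ => (hf _).comp (measurable_pi_apply i))]
    rw [ih _ fun i => hf _]

lemma lint_gauss_shift (b m K : ℝ) (hb : 0 < b) :
    ∫⁻ x : ℝ, ENNReal.ofReal (Real.exp (-b * (x - m)^2 + K)) =
      ENNReal.ofReal (Real.sqrt (π / b) * Real.exp K) := by
  have hi : Integrable (fun x : ℝ => Real.exp (-b * (x - m)^2 + K)) := by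
    simp_rw [Real.exp_add]
    exact ((integrable_exp_neg_mul_sq hb).comp_sub_right m).mul_const _
  rw [← ofReal_integral_eq_lintegral_ofReal hi (.of_forall fun x => (Real.exp_nonneg _))]
  congr 1
  simp_rw [Real.exp_add]
  rw [integral_mul_const, integral_sub_right_eq_self (fun x => Real.exp (-b * x^2)) m, integral_gaussian]

lemma row_one (a z y v : ℝ) (hv : 0 < v) :
    ∫⁻ g, ENNReal.ofReal (Real.exp (a * g - (y - z * g)^2 / (2 * v))) ∂(gaussianReal 0 1) =
      ENNReal.ofReal (Real.sqrt (v / (v + z^2)) *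
        Real.exp (a^2/2 - (y - a * z)^2 / (2 * (v + z^2)))) := by
  rw [gaussianReal_of_var_ne_zero _ (by norm_num),
    lintegral_withDensity_eq_lintegral_mul _ (measurable_gaussianPDF 0 1) (by fun_prop)]
  have hR : 0 < v + z^2 := by positivity
  set b := (v + z^2) / (2 * v) with hb
  have hbp : 0 < b := by positivity
  set m := (a + y * z / v) / (2 * b) with hm
  set K := a^2/2 - (y - a * z)^2 / (2 * (v + z^2)) with hK
  have h1 : ∀ g : ℝ, (gaussianPDF 0 1 * fun g => ENNReal.ofReal
      (Real.exp (a * g - (y - z * g)^2 / (2 * v)))) g =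
      ENNReal.ofReal ((Real.sqrt (2 * π))⁻¹) * ENNReal.ofReal (Real.exp (-b * (g - m)^2 + K)) := by
    intro g
    simp only [Pi.mul_apply, gaussianPDF, gaussianPDFReal]
    rw [← ENNReal.ofReal_mul (by positivity), ← ENNReal.ofReal_mul (by positivity), mul_assoc,
      ← Real.exp_add]
    simp only [NNReal.coe_one, mul_one, sub_zero]
    congr 3
    rw [hK, hm, hb]
    field_simp
    ring
  simp_rw [h1]
  rw [lintegral_const_mul' _ _ ENNReal.ofReal_ne_top, lint_gauss_shift _ _ _ hbp,
    ← ENNReal.ofReal_mul (by positivity), ← mul_assoc]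
  congr 2
  rw [← Real.sqrt_inv, ← Real.sqrt_mul (by positivity)]
  congr 1
  rw [hb]
  field_simp

lemma row_multi (n : ℕ) : ∀ (a z : Fin n → ℝ) (y v : ℝ), 0 < v →
    ∫⁻ g, ENNReal.ofReal (Real.exp (g ⬝ᵥ a - (y - g ⬝ᵥ z)^2 / (2 * v))) ∂(gv n) =
      ENNReal.ofReal (Real.sqrt (v / (v + z ⬝ᵥ z)) *
        Real.exp ((a ⬝ᵥ a)/2 - (y - a ⬝ᵥ z)^2 / (2 * (v + z ⬝ᵥ z)))) := by
  induction n with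
  | zero =>
    intro a z y v hv
    simp [hv.ne']
  | succ n ih =>
    intro a z y v hv
    unfold gv
    rw [lint_pi_succ _ _ _ (by unfold dotProduct; fun_prop)]
    change ∫⁻ p : Fin n → ℝ, _ ∂(gv n) = _
    have h1 : ∀ p : Fin n → ℝ, ∫⁻ x : ℝ, ENNReal.ofReal (Real.exp ((Fin.cons x p : Fin (n+1) → ℝ) ⬝ᵥ a -
        (y - (Fin.cons x p : Fin (n+1) → ℝ) ⬝ᵥ z)^2 / (2 * v))) ∂(gaussianReal 0 1) =
        ENNReal.ofReal (Real.sqrt (v / (v + (z 0)^2)) * Real.exp ((a 0)^2/2)) *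
        ENNReal.ofReal (Real.exp (p ⬝ᵥ (Fin.tail a) - ((y - a 0 * z 0) - p ⬝ᵥ (Fin.tail z))^2 /
          (2 * (v + (z 0)^2)))) := by
      intro p
      have h2 : ∀ x : ℝ, ENNReal.ofReal (Real.exp ((Fin.cons x p : Fin (n+1) → ℝ) ⬝ᵥ a -
        (y - (Fin.cons x p : Fin (n+1) → ℝ) ⬝ᵥ z)^2 / (2 * v))) =
          ENNReal.ofReal (Real.exp (p ⬝ᵥ (Fin.tail a))) *
          ENNReal.ofReal (Real.exp (a 0 * x - ((y - p ⬝ᵥ (Fin.tail z)) - z 0 * x)^2 / (2 * v))) := by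
        intro x
        rw [← ENNReal.ofReal_mul (by positivity), ← Real.exp_add]
        congr 2
        simp only [dotProduct, Fin.sum_univ_succ, Fin.cons_zero, Fin.cons_succ, Fin.tail]
        ring
      simp_rw [h2]
      rw [lintegral_const_mul' _ _ ENNReal.ofReal_ne_top, row_one _ _ _ _ hv,
        ← ENNReal.ofReal_mul (by positivity), ← ENNReal.ofReal_mul (by positivity)]
      congr 1
      rw [mul_left_comm, mul_assoc, ← Real.exp_add, ← Real.exp_add]
      congr 2
      ring
    simp_rw [h1]
    rw [lintegral_const_mul' _ _ ENNReal.ofReal_ne_top, ih _ _ _ _ (by positivity),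
        ← ENNReal.ofReal_mul (by positivity)]
    have hz : z ⬝ᵥ z = (z 0)^2 + (Fin.tail z) ⬝ᵥ (Fin.tail z) := by
      simp [dotProduct, Fin.sum_univ_succ, Fin.tail, pow_two]
    have ha : a ⬝ᵥ a = (a 0)^2 + (Fin.tail a) ⬝ᵥ (Fin.tail a) := by
      simp [dotProduct, Fin.sum_univ_succ, Fin.tail, pow_two]
    have haz : a ⬝ᵥ z = (a 0) * (z 0) + (Fin.tail a) ⬝ᵥ (Fin.tail z) := by
      simp [dotProduct, Fin.sum_univ_succ, Fin.tail]
    have hz0 : 0 ≤ (Fin.tail z) ⬝ᵥ (Fin.tail z) := by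
      unfold dotProduct; exact Finset.sum_nonneg fun i _ => mul_self_nonneg _
    congr 1
    rw [hz, ha, haz, mul_mul_mul_comm, ← Real.sqrt_mul (by positivity), ← Real.exp_add]
    congr 2
    · field_simp
      ring_nf
    · ring

lemma dot_self_nonneg' {n : ℕ} (z : Fin n → ℝ) : 0 ≤ z ⬝ᵥ z := by
  unfold dotProduct; exact Finset.sum_nonneg fun i _ => mul_self_nonneg _

lemma row_zero (n : ℕ) (z : Fin n → ℝ) (y v : ℝ) (hv : 0 < v) :
    ∫⁻ g, ENNReal.ofReal (Real.exp (- (y - g ⬝ᵥ z)^2 / (2 * v))) ∂(gv n) =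
      ENNReal.ofReal (Real.sqrt (v / (v + z ⬝ᵥ z)) *
        Real.exp (- y^2 / (2 * (v + z ⬝ᵥ z)))) := by
  have := row_multi n 0 z y v hv
  simpa [neg_div] using this

lemma sq_add_two_le (x : ℝ) : x^2 + 2 ≤ Real.exp x + Real.exp (-x) := by
  have h0 : ∀ y : ℝ, y^2 ≤ (Real.sinh y)^2 := by
    intro y
    rw [← sq_abs y, ← sq_abs (Real.sinh y), Real.abs_sinh]
    have := Real.self_le_sinh_iff.2 (abs_nonneg y)
    gcongr
  have h1 := Real.cosh_two_mul (x/2)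
  have h2 := Real.cosh_sq (x/2)
  have h3 := h0 (x/2)
  rw [show 2 * (x/2) = x by ring, Real.cosh_eq] at h1
  nlinarith

lemma row_two (n : ℕ) (a z : Fin n → ℝ) (y v : ℝ) (hv : 0 < v) :
    ∫⁻ g, ENNReal.ofReal ((g ⬝ᵥ a)^2 * Real.exp (- (y - g ⬝ᵥ z)^2 / (2 * v))) ∂(gv n) ≤
      ENNReal.ofReal (2 * (a ⬝ᵥ a + y^2 * (a ⬝ᵥ z)^2 / (v + z ⬝ᵥ z)^2)) *
      ∫⁻ g, ENNReal.ofReal (Real.exp (- (y - g ⬝ᵥ z)^2 / (2 * v))) ∂(gv n) := by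
  have hz0 := dot_self_nonneg' z
  have ha0 := dot_self_nonneg' a
  have hR : 0 < v + z ⬝ᵥ z := by positivity
  set R2 := v + z ⬝ᵥ z with hR2
  set s := a ⬝ᵥ z with hs
  set D := a ⬝ᵥ a + y^2 * s^2 / R2^2 with hD
  by_cases hD0 : D = 0
  · have h1 : a ⬝ᵥ a = 0 := by
      have : 0 ≤ y^2 * s^2 / R2^2 := by positivity
      linarith
    have h2 : a = 0 := by simpa using h1
    simp [h2]
  have hDp : 0 < D := lt_of_le_of_ne (by positivity) (Ne.symm hD0)
  set τ := (Real.sqrt D)⁻¹ with hτ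
  have hτp : 0 < τ := by positivity
  have hτ2 : τ^2 * D = 1 := by
    rw [hτ, inv_pow, Real.sq_sqrt hDp.le]; field_simp
  have hJ := row_zero n z y v hv
  have hp := row_multi n (τ • a) z y v hv
  have hm := row_multi n ((-τ) • a) z y v hv
  set J := Real.sqrt (v / R2) * Real.exp (- y^2 / (2 * R2)) with hJd
  have hJp : 0 < J := by positivity
  set I := ∫⁻ g, ENNReal.ofReal ((g ⬝ᵥ a)^2 * Real.exp (- (y - g ⬝ᵥ z)^2 / (2 * v))) ∂(gv n) with hI
  rw [hJ]
  have key : ENNReal.ofReal (τ^2) * I + ENNReal.ofReal (2 * J) ≤ ENNReal.ofReal (4 * J) := by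
    rw [ENNReal.ofReal_mul (p := 2) (by norm_num), ← hJ, hI,
      ← lintegral_const_mul' _ _ ENNReal.ofReal_ne_top, ← lintegral_const_mul' _ _ ENNReal.ofReal_ne_top,
      ← lintegral_add_left (by unfold dotProduct; fun_prop)]
    calc _ ≤ ∫⁻ g, (ENNReal.ofReal (Real.exp (g ⬝ᵥ (τ • a) - (y - g ⬝ᵥ z)^2 / (2 * v))) +
          ENNReal.ofReal (Real.exp (g ⬝ᵥ ((-τ) • a) - (y - g ⬝ᵥ z)^2 / (2 * v)))) ∂(gv n) := by
          refine lintegral_mono fun g => ?_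
          simp only
          rw [← ENNReal.ofReal_mul (by positivity), ← ENNReal.ofReal_mul (by positivity),
            ← ENNReal.ofReal_add (by positivity) (by positivity),
            ← ENNReal.ofReal_add (by positivity) (by positivity)]
          apply ENNReal.ofReal_le_ofReal
          rw [sub_eq_add_neg (g ⬝ᵥ (τ • a)), sub_eq_add_neg (g ⬝ᵥ ((-τ) • a)), Real.exp_add, Real.exp_add, ← neg_div]
          set E := Real.exp (-(y - g ⬝ᵥ z)^2 / (2 * v)) with hE
          have hEp : 0 < E := Real.exp_pos _
          simp only [dotProduct_smul, smul_eq_mul]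
          set x := τ * (g ⬝ᵥ a) with hx
          have h1 : x^2 + 2 ≤ Real.exp x + Real.exp (-x) := by
            exact sq_add_two_le x
          have h2 : τ^2 * ((g ⬝ᵥ a)^2 * E) + 2 * E = (x^2 + 2) * E := by rw [hx]; ring
          rw [h2, ← add_mul, neg_mul]
          gcongr
      _ = _ := by
          rw [lintegral_add_left (by unfold dotProduct; fun_prop), hp, hm]
      _ ≤ _ := by
          rw [← ENNReal.ofReal_add (by positivity) (by positivity)]
          apply ENNReal.ofReal_le_ofReal
          simp only [smul_dotProduct, dotProduct_smul, smul_eq_mul, ← hs]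
          have e1 : τ * (τ * (a ⬝ᵥ a)) / 2 - (y - τ * s)^2 / (2 * R2) ≤
              - y^2 / (2 * R2) + τ^2 * (a ⬝ᵥ a) / 2 + τ * y * s / R2 := by
            have : τ * (τ * (a ⬝ᵥ a)) / 2 - (y - τ * s)^2 / (2 * R2) =
              - y^2 / (2 * R2) + τ^2 * (a ⬝ᵥ a) / 2 + τ * y * s / R2 - τ^2 * s^2/(2*R2) := by
              field_simp; ring
            have h0 : 0 ≤ τ^2 * s^2/(2*R2) := by positivity
            linarith
          have e2 : -τ * (-τ * (a ⬝ᵥ a)) / 2 - (y - -τ * s)^2 / (2 * R2) ≤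
              - y^2 / (2 * R2) + τ^2 * (a ⬝ᵥ a) / 2 + -(τ * y * s / R2) := by
            have : -τ * (-τ * (a ⬝ᵥ a)) / 2 - (y - -τ * s)^2 / (2 * R2) =
              - y^2 / (2 * R2) + τ^2 * (a ⬝ᵥ a) / 2 + -(τ * y * s / R2) - τ^2 * s^2/(2*R2) := by
              field_simp; ring
            have h0 : 0 ≤ τ^2 * s^2/(2*R2) := by positivity
            linarith
          set B := τ * y * s / R2 with hB
          have e3 : τ^2 * (a ⬝ᵥ a) + B^2 = 1 := by
            rw [← hτ2, hD, hB]; ring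
          calc _ ≤ Real.sqrt (v / R2) * Real.exp (- y^2 / (2 * R2) + τ^2 * (a ⬝ᵥ a) / 2 + B) +
                Real.sqrt (v / R2) * Real.exp (- y^2 / (2 * R2) + τ^2 * (a ⬝ᵥ a) / 2 + -B) := by
                gcongr
            _ = 2 * J * (Real.exp (τ^2 * (a ⬝ᵥ a) / 2) * Real.cosh B) := by
                rw [Real.cosh_eq, hJd]; simp only [Real.exp_add]; ring
            _ ≤ 2 * J * (Real.exp (τ^2 * (a ⬝ᵥ a) / 2) * Real.exp (B^2/2)) := by
                gcongr; exact Real.cosh_le_exp_half_sq B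
            _ = 2 * J * Real.exp (1/2) := by
                rw [← Real.exp_add]; congr 2; linarith
            _ ≤ 2 * J * 2 := by
                gcongr
                have h1 := Real.exp_one_lt_d9
                have h2 : Real.exp (1/2) ^ 2 = Real.exp 1 := by
                  rw [← Real.exp_nat_mul]; norm_num
                nlinarith [Real.exp_pos (1/2)]
            _ = 4 * J := by ring
  have hk2 : ENNReal.ofReal (τ^2) * I ≤ ENNReal.ofReal (2 * J) := by
    have : ENNReal.ofReal (4 * J) = ENNReal.ofReal (2 * J) + ENNReal.ofReal (2 * J) := by
      rw [← ENNReal.ofReal_add (by positivity) (by positivity)]; congr 1; ring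
    rw [this] at key
    exact (ENNReal.add_le_add_iff_right ENNReal.ofReal_ne_top).1 key
  calc I = ENNReal.ofReal D * (ENNReal.ofReal (τ^2) * I) := by
        rw [← mul_assoc, ← ENNReal.ofReal_mul (by positivity), mul_comm D, hτ2]; simp
    _ ≤ ENNReal.ofReal D * ENNReal.ofReal (2 * J) := by gcongr
    _ = _ := by
        rw [← ENNReal.ofReal_mul (by positivity), ← ENNReal.ofReal_mul (by positivity)]
        congr 1; ring

/-- Gaussian kernel. -/
def kap {k n : ℕ} (v : ℝ) (y : Fin k → ℝ) (G : Fin k → Fin n → ℝ) (z : Fin n → ℝ) : ℝ :=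
  Real.exp (-(∑ i, (y i - G i ⬝ᵥ z)^2) / (2 * v))

lemma kap_prod {k n : ℕ} (v : ℝ) (y : Fin k → ℝ) (G : Fin k → Fin n → ℝ) (z : Fin n → ℝ) :
    ENNReal.ofReal (kap v y G z) = ∏ i, ENNReal.ofReal (Real.exp (-(y i - G i ⬝ᵥ z)^2 / (2 * v))) := by
  rw [kap, ← ENNReal.ofReal_prod_of_nonneg (fun i _ => Real.exp_nonneg _), ← Real.exp_sum]
  congr 2
  rw [← Finset.sum_div, Finset.sum_neg_distrib]

lemma mat_one (k n : ℕ) (v : ℝ) (hv : 0 < v) (y : Fin k → ℝ) (z : Fin n → ℝ) :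
    ∫⁻ G, ENNReal.ofReal (kap v y G z) ∂(gm k n) =
      ENNReal.ofReal ((Real.sqrt (v / (v + z ⬝ᵥ z)))^k *
        Real.exp (- (∑ i, (y i)^2) / (2 * (v + z ⬝ᵥ z)))) := by
  simp_rw [kap_prod]
  unfold gm
  rw [lint_pi (gv n) k (fun i g => ENNReal.ofReal (Real.exp (-(y i - g ⬝ᵥ z)^2 / (2 * v))))
    (fun i => by unfold dotProduct; fun_prop)]
  simp_rw [row_zero _ _ _ _ hv]
  rw [← ENNReal.ofReal_prod_of_nonneg (fun i _ => by positivity), Finset.prod_mul_distrib,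
    ← Real.exp_sum, ← Finset.sum_div, Finset.sum_neg_distrib]
  simp

lemma mat_two (k n : ℕ) (v : ℝ) (hv : 0 < v) (y : Fin k → ℝ) (a z : Fin n → ℝ) (i : Fin k) :
    ∫⁻ G, ENNReal.ofReal ((G i ⬝ᵥ a)^2 * kap v y G z) ∂(gm k n) ≤
      ENNReal.ofReal (2 * (a ⬝ᵥ a + (y i)^2 * (a ⬝ᵥ z)^2 / (v + z ⬝ᵥ z)^2)) *
      ∫⁻ G, ENNReal.ofReal (kap v y G z) ∂(gm k n) := by
  have h1 : ∀ G : Fin k → Fin n → ℝ, ENNReal.ofReal ((G i ⬝ᵥ a)^2 * kap v y G z) =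
      ∏ j, (if j = i then ENNReal.ofReal ((G j ⬝ᵥ a)^2 * Real.exp (-(y j - G j ⬝ᵥ z)^2 / (2 * v))) else
        ENNReal.ofReal (Real.exp (-(y j - G j ⬝ᵥ z)^2 / (2 * v)))) := by
    intro G
    rw [ENNReal.ofReal_mul (by positivity), kap_prod, ← Finset.mul_prod_erase _ _ (Finset.mem_univ i),
      ← Finset.mul_prod_erase _ _ (Finset.mem_univ i), ← mul_assoc, if_pos rfl,
      ENNReal.ofReal_mul (by positivity)]
    congr 1
    refine Finset.prod_congr rfl fun j hj => ?_
    simp only [if_neg (Finset.ne_of_mem_erase hj)]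
  simp_rw [h1, kap_prod]
  unfold gm
  rw [lint_pi (gv n) k (fun i g => ENNReal.ofReal (Real.exp (-(y i - g ⬝ᵥ z)^2 / (2 * v))))
    (fun i => by unfold dotProduct; fun_prop)]
  rw [lint_pi (gv n) k (fun j g => (if j = i then ENNReal.ofReal ((g ⬝ᵥ a)^2 * Real.exp (-(y j - g ⬝ᵥ z)^2 / (2 * v))) else
        ENNReal.ofReal (Real.exp (-(y j - g ⬝ᵥ z)^2 / (2 * v)))))
    (fun j => by split_ifs <;> (unfold dotProduct; fun_prop))]
  rw [← Finset.mul_prod_erase _ _ (Finset.mem_univ i), ← Finset.mul_prod_erase _ _ (Finset.mem_univ i),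
    ← mul_assoc]
  simp only [if_true]
  refine mul_le_mul' ?_ ?_
  · exact row_two n a z (y i) v hv
  · refine le_of_eq (Finset.prod_congr rfl fun j hj => ?_)
    simp only [if_neg (Finset.ne_of_mem_erase hj)]



/-- the vector `t e₀`. -/
def yv (m : ℕ) (t : ℝ) : Fin (m+1) → ℝ := fun i => if i = 0 then t else 0

/-- Gaussian-smoothed marginal. -/
def psi {m n : ℕ} (ν : Measure (Fin n → ℝ)) (v : ℝ) (G : Fin (m+1) → Fin n → ℝ) (t : ℝ) : ℝ≥0∞ :=
  ∫⁻ z, ENNReal.ofReal (kap v (yv m t) G z) ∂ν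

/-- radial moment. -/
def hq {m n : ℕ} (ν : Measure (Fin n → ℝ)) (v : ℝ) (q : ℕ) (G : Fin (m+1) → Fin n → ℝ) : ℝ≥0∞ :=
  ∫⁻ t in Set.Ioi (0:ℝ), (ENNReal.ofReal t)^q * psi ν v G t

lemma yv_sq (m : ℕ) (t : ℝ) : ∑ i, (yv m t i)^2 = t^2 := by
  simp [yv, Fin.sum_univ_succ]

lemma yv_meas (m : ℕ) (i : Fin (m+1)) : Measurable (fun t => yv m t i) := by
  unfold yv; split_ifs <;> fun_prop

lemma kap_nonneg {k n : ℕ} (v : ℝ) (y : Fin k → ℝ) (G : Fin k → Fin n → ℝ) (z : Fin n → ℝ) :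
    0 ≤ kap v y G z := (Real.exp_nonneg _)

lemma kap_meas3 (m n : ℕ) (v : ℝ) :
    Measurable (fun x : (Fin (m+1) → Fin n → ℝ) × ℝ × (Fin n → ℝ) =>
      ENNReal.ofReal (kap v (yv m x.2.1) x.1 x.2.2)) := by
  unfold kap dotProduct
  have : ∀ i, Measurable (fun x : (Fin (m+1) → Fin n → ℝ) × ℝ × (Fin n → ℝ) => yv m x.2.1 i) :=
    fun i => (yv_meas m i).comp (by fun_prop)
  fun_prop

lemma kap_meas_tz {m n : ℕ} (v : ℝ) (G : Fin (m+1) → Fin n → ℝ) :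
    Measurable (fun x : ℝ × (Fin n → ℝ) => ENNReal.ofReal (kap v (yv m x.1) G x.2)) :=
  by
  unfold kap dotProduct
  have : ∀ i, Measurable (fun x : ℝ × (Fin n → ℝ) => yv m x.1 i) :=
    fun i => (yv_meas m i).comp (by fun_prop)
  fun_prop

lemma kap_meas_z {m n : ℕ} (v : ℝ) (G : Fin (m+1) → Fin n → ℝ) (t : ℝ) :
    Measurable (fun z : (Fin n → ℝ) => ENNReal.ofReal (kap v (yv m t) G z)) :=
  by
  unfold kap dotProduct
  fun_prop

lemma psi_meas2 {m n : ℕ} (ν : Measure (Fin n → ℝ)) [SFinite ν] (v : ℝ) :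
    Measurable (fun x : (Fin (m+1) → Fin n → ℝ) × ℝ => psi ν v x.1 x.2) := by
  unfold psi
  have h : Measurable (fun x : ((Fin (m+1) → Fin n → ℝ) × ℝ) × (Fin n → ℝ) =>
      ENNReal.ofReal (kap v (yv m x.1.2) x.1.1 x.2)) :=
    by
    unfold kap dotProduct
    have : ∀ i, Measurable (fun x : ((Fin (m+1) → Fin n → ℝ) × ℝ) × (Fin n → ℝ) => yv m x.1.2 i) :=
      fun i => (yv_meas m i).comp (by fun_prop)
    fun_prop
  exact h.lintegral_prod_right'

lemma psi_meas {m n : ℕ} (ν : Measure (Fin n → ℝ)) [SFinite ν] (v : ℝ) (G : Fin (m+1) → Fin n → ℝ) :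
    Measurable (psi ν v G) := by
  unfold psi
  exact (kap_meas_tz v G).lintegral_prod_right'

lemma hq_meas {m n : ℕ} (ν : Measure (Fin n → ℝ)) [SFinite ν] (v : ℝ) (q : ℕ) :
    Measurable (hq (m := m) ν v q) := by
  unfold hq
  have h : Measurable (fun x : (Fin (m+1) → Fin n → ℝ) × ℝ => (ENNReal.ofReal x.2)^q * psi ν v x.1 x.2) :=
    (by fun_prop : Measurable fun x : (Fin (m+1) → Fin n → ℝ) × ℝ => (ENNReal.ofReal x.2)^q).mul (psi_meas2 ν v)
  exact h.lintegral_prod_right'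

lemma kap_mid {m n : ℕ} (v : ℝ) (hv : 0 < v) (G : Fin (m+1) → Fin n → ℝ) (s t : ℝ) (z z' : Fin n → ℝ) :
    kap v (yv m s) G z * kap v (yv m t) G z' ≤
      (kap v (yv m ((1/2) * (s + t))) G ((1/2:ℝ) • (z + z')))^2 := by
  unfold kap
  rw [← Real.exp_add, ← Real.exp_nat_mul]
  apply Real.exp_le_exp.2
  rw [← add_div, ← mul_div_assoc]
  gcongr
  rw [← neg_add, mul_neg]
  apply neg_le_neg
  rw [Finset.mul_sum, ← Finset.sum_add_distrib]
  refine Finset.sum_le_sum fun i _ => ?_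
  have h1 : yv m ((1/2) * (s+t)) i = (1/2) * (yv m s i + yv m t i) := by
    unfold yv; split_ifs <;> ring
  rw [h1, dotProduct_smul, dotProduct_add, smul_eq_mul]
  push_cast
  nlinarith [sq_nonneg ((yv m s i - G i ⬝ᵥ z) - (yv m t i - G i ⬝ᵥ z'))]

lemma pl_half : PL ((volume : Measure ℝ).restrict (Set.Ioi 0)) (fun _ => 0) := by
  rw [← withDensity_indicator_one measurableSet_Ioi]
  refine pl_volume.withDensity (d := fun _ => 0) _ (measurable_one.indicator measurableSet_Ioi) ?_ (by simp)
  intro x y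
  by_cases hx : x ∈ Set.Ioi (0:ℝ)
  · by_cases hy : y ∈ Set.Ioi (0:ℝ)
    · have hm : (1/2:ℝ) • (x + y) ∈ Set.Ioi (0:ℝ) := by
        simp at hx hy ⊢; linarith
      simp only [Set.indicator_of_mem hx, Set.indicator_of_mem hy, Set.indicator_of_mem hm]
      simp
    · simp [hy]
  · simp [hx]

lemma scalar_pl (m p : ℕ) (hp : p < m) (s t : ℝ) (hs : 0 ≤ s) (ht : 0 ≤ t) :
    s^(m+p) * t^(m-p) ≤ Real.exp (2 * p^2 / m) * ((1/2) * (s + t))^(2*m) := by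
  have hm : (0:ℝ) < m := by exact_mod_cast (by omega : 0 < m)
  have hpm : (p:ℝ) < m := by exact_mod_cast hp
  by_cases hc : s + t = 0
  · have hs0 : s = 0 := by linarith
    rw [hs0, zero_pow (by omega), zero_mul]
    positivity
  set c := (1/2) * (s+t) with hcd
  have hcp : 0 < c := by
    have : 0 ≤ s + t := by positivity
    have : 0 < s + t := lt_of_le_of_ne this (Ne.symm hc)
    positivity
  set y := (p:ℝ) / m with hy
  have hy0 : 0 ≤ y := by positivity
  have hy1 : y < 1 := by rw [hy, div_lt_one hm]; exact hpm
  set S := s / c with hS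
  set T := t / c with hT
  have hST : S + T = 2 := by rw [hS, hT, ← add_div, hcd]; field_simp
  have hS0 : 0 ≤ S := by positivity
  have hT0 : 0 ≤ T := by positivity
  have h1 : S ≤ (1+y) * Real.exp (S/(1+y) - 1) := by
    have := Real.add_one_le_exp (S/(1+y) - 1)
    have h2 : S = (1+y) * (S/(1+y) - 1 + 1) := by field_simp; ring
    calc S = (1+y) * (S/(1+y) - 1 + 1) := h2
      _ ≤ _ := by gcongr
  have hy1' : 0 < 1 - y := by linarith
  have h2 : T ≤ (1-y) * Real.exp (T/(1-y) - 1) := by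
    have := Real.add_one_le_exp (T/(1-y) - 1)
    have h2 : T = (1-y) * (T/(1-y) - 1 + 1) := by field_simp; ring
    calc T = (1-y) * (T/(1-y) - 1 + 1) := h2
      _ ≤ _ := by gcongr
  have h3 : 1 + y ≤ Real.exp y := by rw [add_comm]; exact Real.add_one_le_exp y
  have h4 : 1 - y ≤ Real.exp (-y) := by have := Real.add_one_le_exp (-y); linarith
  have key : S^(m+p) * T^(m-p) ≤ Real.exp (2 * p^2/m) := by
    calc S^(m+p) * T^(m-p) ≤ (Real.exp y * Real.exp (S/(1+y) - 1))^(m+p) *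
          (Real.exp (-y) * Real.exp (T/(1-y) - 1))^(m-p) := by
          gcongr
          · exact h1.trans (by gcongr)
          · exact h2.trans (by gcongr)
      _ = Real.exp (2 * p^2/m) := by
          rw [← Real.exp_add, ← Real.exp_add, ← Real.exp_nat_mul, ← Real.exp_nat_mul, ← Real.exp_add]
          congr 1
          rw [Nat.cast_sub hp.le]
          push_cast
          have e1 : ((m:ℝ) + p) = m * (1 + y) := by rw [hy]; field_simp
          have e2 : ((m:ℝ) - p) = m * (1 - y) := by rw [hy]; field_simp
          rw [e1, e2]
          have e3 : (p:ℝ) = m * y := by rw [hy]; field_simp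
          have e4 : T = 2 - S := by linarith
          rw [e3, e4]
          field_simp
          ring
  have hs' : s = S * c := by rw [hS]; field_simp
  have ht' : t = T * c := by rw [hT]; field_simp
  calc s^(m+p) * t^(m-p) = (S^(m+p) * T^(m-p)) * c^(2*m) := by
        have h2m : 2 * m = (m+p) + (m-p) := by omega
        rw [h2m, pow_add]
        clear_value S T c
        rw [hs', ht', mul_pow, mul_pow]; ring
    _ ≤ _ := by gcongr

lemma hq_eq_prod {m n : ℕ} (ν : Measure (Fin n → ℝ)) [SFinite ν] (v : ℝ) (q : ℕ)
    (G : Fin (m+1) → Fin n → ℝ) :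
    hq ν v q G = ∫⁻ x, (ENNReal.ofReal x.1)^q * ENNReal.ofReal (kap v (yv m x.1) G x.2)
      ∂((volume.restrict (Set.Ioi (0:ℝ))).prod ν) := by
  rw [lintegral_prod _ (by
    exact ((by fun_prop : Measurable fun x : ℝ × (Fin n → ℝ) => (ENNReal.ofReal x.1)^q).mul
      (kap_meas_tz v G)).aemeasurable)]
  unfold hq psi
  refine lintegral_congr fun t => ?_
  rw [lintegral_const_mul' _ _ (ENNReal.pow_ne_top ENNReal.ofReal_ne_top)]

lemma hq_pl {m n : ℕ} (ν : Measure (Fin n → ℝ)) [SFinite ν] (hν : PL ν (fun _ => 0)) (v : ℝ) (hv : 0 < v)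
    (p : ℕ) (hp : p < m) (G : Fin (m+1) → Fin n → ℝ) :
    hq ν v (m+p) G * hq ν v (m-p) G ≤ ENNReal.ofReal (Real.exp (2*p^2/m)) * (hq ν v m G)^2 := by
  have hQ := pl_half.prod hν
  simp only [add_zero] at hQ
  have hmm : ∀ q, Measurable (fun x : ℝ × (Fin n → ℝ) => (ENNReal.ofReal x.1)^q *
      ENNReal.ofReal (kap v (yv m x.1) G x.2)) := fun q =>
    (by fun_prop : Measurable fun x : ℝ × (Fin n → ℝ) => (ENNReal.ofReal x.1)^q).mul (kap_meas_tz v G)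
  have key := hQ _ _ (fun x => ENNReal.ofReal (Real.exp ((2*p^2/m)/2)) * ((ENNReal.ofReal x.1)^m *
      ENNReal.ofReal (kap v (yv m x.1) G x.2))) (hmm (m+p)) (hmm (m-p)) ((hmm m).const_mul _) ?_
  · rw [lintegral_const_mul' _ _ ENNReal.ofReal_ne_top] at key
    rw [hq_eq_prod, hq_eq_prod, hq_eq_prod, exp_half_sq, ← mul_pow]
    exact key
  · rintro ⟨s, z⟩ ⟨t, z'⟩
    simp only [Real.exp_zero, ENNReal.ofReal_one, one_mul, Prod.mk_add_mk, Prod.smul_mk, smul_eq_mul]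
    rw [mul_pow, ← exp_half_sq]
    rcases le_or_gt s 0 with hs | hs
    · rw [ENNReal.ofReal_of_nonpos hs, zero_pow (by omega)]; simp
    rcases le_or_gt t 0 with ht | ht
    · rw [ENNReal.ofReal_of_nonpos ht, zero_pow (by omega)]; simp
    have hk := kap_nonneg v (yv m (1 / 2 * (s + t))) G ((1 / 2:ℝ) • (z + z'))
    have hk1 := kap_nonneg v (yv m s) G z
    have hk2 := kap_nonneg v (yv m t) G z'
    rw [← ENNReal.ofReal_pow hs.le, ← ENNReal.ofReal_pow ht.le, ← ENNReal.ofReal_pow (by positivity),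
      ← ENNReal.ofReal_mul (by positivity), ← ENNReal.ofReal_mul (by positivity),
      ← ENNReal.ofReal_mul (by positivity), ← ENNReal.ofReal_mul (by positivity),
      ← ENNReal.ofReal_pow (by positivity), ← ENNReal.ofReal_mul (by positivity)]
    apply ENNReal.ofReal_le_ofReal
    calc s^(m+p) * kap v (yv m s) G z * (t^(m-p) * kap v (yv m t) G z') =
          (s^(m+p) * t^(m-p)) * (kap v (yv m s) G z * kap v (yv m t) G z') := by ring
      _ ≤ (Real.exp (2 * p^2 / m) * ((1/2) * (s + t))^(2*m)) *
          (kap v (yv m ((1/2) * (s + t))) G ((1/2:ℝ) • (z + z')))^2 :=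
          mul_le_mul (scalar_pl m p hp s t hs.le ht.le) (kap_mid v hv G s t z z') (by positivity) (by positivity)
      _ = _ := by
          have h2m : ∀ c : ℝ, c^(2*m) = (c^m)^2 := by intro c; rw [← pow_mul, mul_comm m 2]
          rw [h2m]; ring

lemma psi_mid {m n : ℕ} (ν : Measure (Fin n → ℝ)) (hν : PL ν (fun _ => 0)) (v : ℝ) (hv : 0 < v)
    (G : Fin (m+1) → Fin n → ℝ) (t : ℝ) :
    psi ν v G t * psi ν v G 0 ≤ (psi ν v G (t/2))^2 := by
  unfold psi
  refine hν _ _ _ (kap_meas_z v G t) (kap_meas_z v G 0) (kap_meas_z v G (t/2)) ?_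
  intro z z'
  rw [← ENNReal.ofReal_mul (kap_nonneg _ _ _ _), ← ENNReal.ofReal_pow (kap_nonneg _ _ _ _),
    Real.exp_zero, ENNReal.ofReal_one, one_mul]
  apply ENNReal.ofReal_le_ofReal
  have := kap_mid v hv G t 0 z z'
  rwa [show (1/2) * (t + 0) = t/2 by ring] at this

lemma ennreal_le_of_sq {a b : ℝ≥0∞} (h : a^2 ≤ b^2) : a ≤ b :=
  (ENNReal.pow_le_pow_left_iff (by norm_num)).1 h



/-- Gaussian radial constants. -/
def cq (q : ℕ) : ℝ := (Real.sqrt 2)^(q+1) * ((1/2) * Real.Gamma ((q+1)/2))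

lemma cq_pos (q : ℕ) : 0 < cq q := by
  unfold cq
  have : 0 < Real.Gamma (((q:ℝ)+1)/2) := Real.Gamma_pos_of_pos (by positivity)
  positivity

lemma cq_add_two (q : ℕ) : cq (q+2) = (q+1) * cq q := by
  unfold cq
  have h : (((q+2:ℕ):ℝ)+1)/2 = ((q:ℝ)+1)/2 + 1 := by push_cast; ring
  rw [h, Real.Gamma_add_one (by positivity), show q+2+1 = (q+1)+2 by ring, pow_add (Real.sqrt 2), Real.sq_sqrt (by norm_num)]
  ring

lemma cq_logconvex (m p : ℕ) (hp : p < m) : (cq m)^2 ≤ cq (m+p) * cq (m-p) := by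
  unfold cq
  have hpm : (p:ℝ) < m := by exact_mod_cast hp
  have hs : 0 < (((m+p:ℕ):ℝ)+1)/2 := by positivity
  have ht : 0 < (((m-p:ℕ):ℝ)+1)/2 := by positivity
  have h := Real.Gamma_mul_add_mul_le_rpow_Gamma_mul_rpow_Gamma hs ht (a := 1/2) (b := 1/2)
    (by norm_num) (by norm_num) (by norm_num)
  have e : (1/2:ℝ) * ((((m+p:ℕ):ℝ)+1)/2) + 1/2 * ((((m-p:ℕ):ℝ)+1)/2) = ((m:ℝ)+1)/2 := by
    rw [Nat.cast_sub hp.le]; push_cast; ring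
  rw [e] at h
  have g1 := Real.Gamma_pos_of_pos hs
  have g2 := Real.Gamma_pos_of_pos ht
  have g0 : 0 < Real.Gamma (((m:ℝ)+1)/2) := Real.Gamma_pos_of_pos (by positivity)
  have h2 : (Real.Gamma (((m:ℝ)+1)/2))^2 ≤ Real.Gamma ((((m+p:ℕ):ℝ)+1)/2) * Real.Gamma ((((m-p:ℕ):ℝ)+1)/2) := by
    calc _ ≤ _ := pow_le_pow_left₀ g0.le h 2
      _ = _ := by
        rw [mul_pow, ← Real.rpow_natCast, ← Real.rpow_natCast, ← Real.rpow_mul g1.le, ← Real.rpow_mul g2.le]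
        norm_num
  have e2 : (Real.sqrt 2)^(m+p+1) * (Real.sqrt 2)^(m-p+1) = ((Real.sqrt 2)^(m+1))^2 := by
    rw [← pow_add, ← pow_mul]; congr 1; omega
  calc _ = ((Real.sqrt 2)^(m+1))^2 * (1/4) * (Real.Gamma (((m:ℝ)+1)/2))^2 := by ring
    _ ≤ ((Real.sqrt 2)^(m+1))^2 * (1/4) * (Real.Gamma ((((m+p:ℕ):ℝ)+1)/2) * Real.Gamma ((((m-p:ℕ):ℝ)+1)/2)) := by gcongr
    _ = _ := by rw [← e2]; ring

lemma gint (q : ℕ) (W : ℝ) (hW : 0 < W) :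
    ∫⁻ t in Set.Ioi (0:ℝ), (ENNReal.ofReal t)^q * ENNReal.ofReal (Real.exp (-t^2/(2*W))) =
      ENNReal.ofReal (cq q * (Real.sqrt W)^(q+1)) := by
  have hb : 0 < 1/(2*W) := by positivity
  have hq : (-1:ℝ) < q := by have : (0:ℝ) ≤ q := by positivity
                             linarith
  have hi := integrableOn_rpow_mul_exp_neg_mul_rpow hq (two_pos : (0:ℝ) < 2) hb
  have hv := integral_rpow_mul_exp_neg_mul_rpow (two_pos : (0:ℝ) < 2) hq hb
  have e1 : ∫⁻ t in Set.Ioi (0:ℝ), (ENNReal.ofReal t)^q * ENNReal.ofReal (Real.exp (-t^2/(2*W))) =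
      ∫⁻ t in Set.Ioi (0:ℝ), ENNReal.ofReal (t ^ (q:ℝ) * Real.exp (-(1/(2*W)) * t ^ (2:ℝ))) := by
    refine setLIntegral_congr_fun measurableSet_Ioi fun t ht => ?_
    have ht' : (0:ℝ) < t := ht
    rw [← ENNReal.ofReal_pow ht'.le, ← ENNReal.ofReal_mul (by positivity), Real.rpow_natCast, Real.rpow_two]
    congr 3; field_simp
  rw [e1, ← ofReal_integral_eq_lintegral_ofReal hi ?_, hv]
  · congr 1
    unfold cq
    rw [← mul_assoc, mul_assoc]
    have : (1/(2*W)) ^ (-((q:ℝ)+1)/2) = (Real.sqrt 2)^(q+1) * (Real.sqrt W)^(q+1) := by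
      rw [← mul_pow, ← Real.sqrt_mul (by norm_num), one_div, Real.inv_rpow (by positivity),
        ← Real.rpow_neg (by positivity), ← Real.rpow_natCast, Real.sqrt_eq_rpow, ← Real.rpow_mul (by positivity)]
      congr 1; push_cast; ring
    rw [this]; ring
  · refine (ae_restrict_iff' measurableSet_Ioi).2 (Filter.Eventually.of_forall fun t ht => ?_)
    have ht' : (0:ℝ) < t := ht
    simp only [Pi.zero_apply]; positivity

/-- the factor `(v/W)^{k/2}`. -/
def gk (m : ℕ) (v W : ℝ) : ℝ := (Real.sqrt (v / W))^(m+1)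

lemma gk_nonneg (m : ℕ) (v W : ℝ) : 0 ≤ gk m v W := by unfold gk; positivity

lemma Wmeas {n : ℕ} (v : ℝ) : Measurable (fun z : Fin n → ℝ => v + z ⬝ᵥ z) := by
  unfold dotProduct; fun_prop

lemma gk_meas {n : ℕ} (m : ℕ) (v : ℝ) : Measurable (fun z : Fin n → ℝ => gk m v (v + z ⬝ᵥ z)) := by
  unfold gk
  have := Wmeas (n := n) v
  fun_prop

lemma kap_meas_Gx (m n : ℕ) (v : ℝ) :
    Measurable (fun x : (Fin (m+1) → Fin n → ℝ) × (ℝ × (Fin n → ℝ)) =>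
      ENNReal.ofReal (kap v (yv m x.2.1) x.1 x.2.2)) := kap_meas3 m n v

lemma hq_mean {m n : ℕ} (ν : Measure (Fin n → ℝ)) [IsProbabilityMeasure ν] (v : ℝ) (hv : 0 < v) (q : ℕ) :
    ∫⁻ G, hq ν v q G ∂(gm (m+1) n) =
      ∫⁻ z, ENNReal.ofReal (gk m v (v + z ⬝ᵥ z)) *
        ENNReal.ofReal (cq q * (Real.sqrt (v + z ⬝ᵥ z))^(q+1)) ∂ν := by
  simp_rw [hq_eq_prod]
  have hmeas := kap_meas3 m n v
  rw [lintegral_lintegral_swap (by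
    refine Measurable.aemeasurable ?_
    exact (by fun_prop : Measurable fun x : (Fin (m+1) → Fin n → ℝ) × (ℝ × (Fin n → ℝ)) => (ENNReal.ofReal x.2.1)^q).mul hmeas)]
  simp_rw [lintegral_const_mul' _ _ (ENNReal.pow_ne_top ENNReal.ofReal_ne_top), mat_one _ _ _ hv, yv_sq]
  rw [lintegral_prod_symm]
  · refine lintegral_congr fun z => ?_
    have hW : 0 < v + z ⬝ᵥ z := by have := dot_self_nonneg' z; positivity
    rw [← gint q _ hW, ← lintegral_const_mul' _ _ ENNReal.ofReal_ne_top]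
    refine lintegral_congr fun t => ?_
    simp only
    rw [ENNReal.ofReal_mul (by positivity)]
    unfold gk; ring
  · have := Wmeas (n := n) v
    exact Measurable.aemeasurable (by fun_prop)

/-- second moment of rows. -/
def SS {m n : ℕ} (ν : Measure (Fin n → ℝ)) (G : Fin (m+1) → Fin n → ℝ) : ℝ≥0∞ :=
  ∫⁻ a, ENNReal.ofReal (∑ i, (G i ⬝ᵥ a)^2) ∂ν

lemma SS_meas {m n : ℕ} (ν : Measure (Fin n → ℝ)) [SFinite ν] : Measurable (SS (m := m) ν) := by
  unfold SS
  have h : Measurable (fun x : (Fin (m+1) → Fin n → ℝ) × (Fin n → ℝ) => ENNReal.ofReal (∑ i, (x.1 i ⬝ᵥ x.2)^2)) := by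
    unfold dotProduct; fun_prop
  exact h.lintegral_prod_right'

lemma SS_one {m n : ℕ} (ν : Measure (Fin n → ℝ)) [IsProbabilityMeasure ν] (v : ℝ) (hv : 0 < v) (q : ℕ)
    (a : Fin n → ℝ) :
    ∫⁻ G, ENNReal.ofReal (∑ i, (G i ⬝ᵥ a)^2) * hq ν v q G ∂(gm (m+1) n) ≤
      ∫⁻ x, (ENNReal.ofReal x.1)^q * (ENNReal.ofReal (2 * ((m+1) * (a ⬝ᵥ a) + x.1^2 * (a ⬝ᵥ x.2)^2 / (v + x.2 ⬝ᵥ x.2)^2)) *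
        ENNReal.ofReal (gk m v (v + x.2 ⬝ᵥ x.2) * Real.exp (-x.1^2/(2 * (v + x.2 ⬝ᵥ x.2)))))
      ∂((volume.restrict (Set.Ioi (0:ℝ))).prod ν) := by
  have hmeas := kap_meas3 m n v
  have hmS : Measurable (fun x : (Fin (m+1) → Fin n → ℝ) × (ℝ × (Fin n → ℝ)) => ENNReal.ofReal (∑ i, (x.1 i ⬝ᵥ a)^2)) := by
    unfold dotProduct; fun_prop
  simp_rw [hq_eq_prod, ← lintegral_const_mul' _ _ ENNReal.ofReal_ne_top]
  rw [lintegral_lintegral_swap (by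
    refine Measurable.aemeasurable ?_
    exact hmS.mul ((by fun_prop : Measurable fun x : (Fin (m+1) → Fin n → ℝ) × (ℝ × (Fin n → ℝ)) => (ENNReal.ofReal x.2.1)^q).mul hmeas))]
  refine lintegral_mono fun x => ?_
  calc ∫⁻ G, ENNReal.ofReal (∑ i, (G i ⬝ᵥ a)^2) * ((ENNReal.ofReal x.1)^q * ENNReal.ofReal (kap v (yv m x.1) G x.2)) ∂(gm (m+1) n)
      = (ENNReal.ofReal x.1)^q * ∫⁻ G, ∑ i, ENNReal.ofReal ((G i ⬝ᵥ a)^2 * kap v (yv m x.1) G x.2) ∂(gm (m+1) n) := by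
        rw [← lintegral_const_mul' _ _ (ENNReal.pow_ne_top ENNReal.ofReal_ne_top)]
        refine lintegral_congr fun G => ?_
        rw [← ENNReal.ofReal_sum_of_nonneg (fun i _ => mul_nonneg (sq_nonneg _) (kap_nonneg _ _ _ _)), ← Finset.sum_mul,
          ENNReal.ofReal_mul (by positivity)]
        ring
    _ ≤ _ := by
        gcongr
        rw [lintegral_finsetSum' _ (fun i _ => Measurable.aemeasurable (by unfold kap dotProduct; fun_prop))]
        refine (Finset.sum_le_sum fun i _ => mat_two (m+1) n v hv (yv m x.1) a x.2 i).trans ?_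
        rw [← Finset.sum_mul, mat_one _ _ _ hv, yv_sq]
        have hW : 0 < v + x.2 ⬝ᵥ x.2 := by have := dot_self_nonneg' x.2; positivity
        have haa := dot_self_nonneg' a
        rw [← ENNReal.ofReal_sum_of_nonneg (fun i _ => by positivity)]
        unfold gk
        gcongr
        rw [← Finset.mul_sum, Finset.sum_add_distrib, ← Finset.sum_div, ← Finset.sum_mul, yv_sq]
        simp

lemma SS_mean {m n : ℕ} (ν : Measure (Fin n → ℝ)) [IsProbabilityMeasure ν] (v : ℝ) (hv : 0 < v) (q : ℕ)
    (h1 : ∫⁻ z, ENNReal.ofReal (z ⬝ᵥ z) ∂ν ≤ ENNReal.ofReal n)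
    (h2 : ∀ η : Fin n → ℝ, ∫⁻ z, ENNReal.ofReal ((z ⬝ᵥ η)^2) ∂ν ≤ ENNReal.ofReal (n * (η ⬝ᵥ η))) :
    ∫⁻ G, SS ν G * hq ν v q G ∂(gm (m+1) n) ≤
      ENNReal.ofReal (2 * (n * (m + 1 + (q + 1)))) * ∫⁻ G, hq ν v q G ∂(gm (m+1) n) := by
  have hmS : Measurable (fun x : (Fin (m+1) → Fin n → ℝ) × (Fin n → ℝ) => ENNReal.ofReal (∑ i, (x.1 i ⬝ᵥ x.2)^2)) := by
    unfold dotProduct; fun_prop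
  have hW0 : ∀ z : Fin n → ℝ, 0 < v + z ⬝ᵥ z := fun z => by have := dot_self_nonneg' z; positivity
  have hWm := Wmeas (n := n) v
  have hgm := gk_meas (n := n) m v
  have e1 : ∀ G : Fin (m+1) → Fin n → ℝ, SS ν G * hq ν v q G =
      ∫⁻ a, ENNReal.ofReal (∑ i, (G i ⬝ᵥ a)^2) * hq ν v q G ∂ν := by
    intro G
    unfold SS
    rw [lintegral_mul_const _ (by unfold dotProduct; fun_prop)]
  simp_rw [e1]
  rw [lintegral_lintegral_swap (by
    refine Measurable.aemeasurable ?_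
    exact hmS.mul ((hq_meas ν v q).comp measurable_fst))]
  refine (lintegral_mono fun a => SS_one ν v hv q a).trans ?_
  have hbig : Measurable (fun y : (Fin n → ℝ) × (ℝ × (Fin n → ℝ)) =>
     (ENNReal.ofReal y.2.1)^q * (ENNReal.ofReal (2 * ((m+1) * (y.1 ⬝ᵥ y.1) + y.2.1^2 * (y.1 ⬝ᵥ y.2.2)^2 / (v + y.2.2 ⬝ᵥ y.2.2)^2)) *
        ENNReal.ofReal (gk m v (v + y.2.2 ⬝ᵥ y.2.2) * Real.exp (-y.2.1^2/(2 * (v + y.2.2 ⬝ᵥ y.2.2)))))) := by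
    unfold gk dotProduct; fun_prop
  rw [lintegral_lintegral_swap hbig.aemeasurable]
  have e2 : ∀ x : ℝ × (Fin n → ℝ), ∫⁻ a, (ENNReal.ofReal x.1)^q * (ENNReal.ofReal (2 * ((m+1) * (a ⬝ᵥ a) + x.1^2 * (a ⬝ᵥ x.2)^2 / (v + x.2 ⬝ᵥ x.2)^2)) *
        ENNReal.ofReal (gk m v (v + x.2 ⬝ᵥ x.2) * Real.exp (-x.1^2/(2 * (v + x.2 ⬝ᵥ x.2))))) ∂ν ≤
      (ENNReal.ofReal x.1)^q * (ENNReal.ofReal (2 * n * ((m+1) + x.1^2 / (v + x.2 ⬝ᵥ x.2))) *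
        ENNReal.ofReal (gk m v (v + x.2 ⬝ᵥ x.2) * Real.exp (-x.1^2/(2 * (v + x.2 ⬝ᵥ x.2))))) := by
    intro x
    have hW := hW0 x.2
    have hzz := dot_self_nonneg' x.2
    rw [lintegral_const_mul' _ _ (ENNReal.pow_ne_top ENNReal.ofReal_ne_top), lintegral_mul_const' _ _ ENNReal.ofReal_ne_top]
    gcongr
    calc ∫⁻ a, ENNReal.ofReal (2 * ((m+1) * (a ⬝ᵥ a) + x.1^2 * (a ⬝ᵥ x.2)^2 / (v + x.2 ⬝ᵥ x.2)^2)) ∂ν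
        = ∫⁻ a, (ENNReal.ofReal (2 * (m+1)) * ENNReal.ofReal (a ⬝ᵥ a) +
            ENNReal.ofReal (2 * x.1^2 / (v + x.2 ⬝ᵥ x.2)^2) * ENNReal.ofReal ((a ⬝ᵥ x.2)^2)) ∂ν := by
          refine lintegral_congr fun a => ?_
          have haa := dot_self_nonneg' a
          rw [← ENNReal.ofReal_mul (by positivity), ← ENNReal.ofReal_mul (by positivity), ← ENNReal.ofReal_add (by positivity) (by positivity)]
          congr 1; ring
      _ = ENNReal.ofReal (2 * (m+1)) * ∫⁻ a, ENNReal.ofReal (a ⬝ᵥ a) ∂ν +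
            ENNReal.ofReal (2 * x.1^2 / (v + x.2 ⬝ᵥ x.2)^2) * ∫⁻ a, ENNReal.ofReal ((a ⬝ᵥ x.2)^2) ∂ν := by
          rw [lintegral_add_left (by unfold dotProduct; fun_prop), lintegral_const_mul' _ _ ENNReal.ofReal_ne_top,
            lintegral_const_mul' _ _ ENNReal.ofReal_ne_top]
      _ ≤ ENNReal.ofReal (2 * (m+1)) * ENNReal.ofReal n +
            ENNReal.ofReal (2 * x.1^2 / (v + x.2 ⬝ᵥ x.2)^2) * ENNReal.ofReal (n * (x.2 ⬝ᵥ x.2)) := by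
          gcongr
          exact h2 _
      _ ≤ _ := by
          rw [← ENNReal.ofReal_mul (by positivity), ← ENNReal.ofReal_mul (by positivity), ← ENNReal.ofReal_add (by positivity) (by positivity)]
          apply ENNReal.ofReal_le_ofReal
          have : x.1^2 / (v + x.2 ⬝ᵥ x.2)^2 * (x.2 ⬝ᵥ x.2) ≤ x.1^2 / (v + x.2 ⬝ᵥ x.2) := by
            rw [sq (v + x.2 ⬝ᵥ x.2), ← div_div, div_mul_eq_mul_div, div_le_iff₀ hW]
            gcongr
            linarith
          calc _ = 2 * n * ((m+1) + x.1^2 / (v + x.2 ⬝ᵥ x.2)^2 * (x.2 ⬝ᵥ x.2)) := by ring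
            _ ≤ _ := by gcongr
  refine (lintegral_mono e2).trans ?_
  rw [lintegral_prod_symm, hq_mean ν v hv, ← lintegral_const_mul' _ _ ENNReal.ofReal_ne_top]
  · refine le_of_eq (lintegral_congr fun z => ?_)
    have hW := hW0 z
    have hg := gk_nonneg m v (v + z ⬝ᵥ z)
    simp only
    calc _ = ∫⁻ t in Set.Ioi (0:ℝ), (ENNReal.ofReal (2 * n * (m+1) * gk m v (v + z ⬝ᵥ z)) * ((ENNReal.ofReal t)^q * ENNReal.ofReal (Real.exp (-t^2/(2*(v + z ⬝ᵥ z)))))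
          + ENNReal.ofReal (2 * n / (v + z ⬝ᵥ z) * gk m v (v + z ⬝ᵥ z)) * ((ENNReal.ofReal t)^(q+2) * ENNReal.ofReal (Real.exp (-t^2/(2*(v + z ⬝ᵥ z)))))) := by
          refine setLIntegral_congr_fun measurableSet_Ioi fun t ht => ?_
          have ht' : (0:ℝ) < t := ht
          rw [← ENNReal.ofReal_pow ht'.le, ← ENNReal.ofReal_pow ht'.le]
          simp only [← ENNReal.ofReal_mul (show (0:ℝ) ≤ t^q by positivity), ← ENNReal.ofReal_mul (show (0:ℝ) ≤ t^(q+2) by positivity)]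
          rw [← ENNReal.ofReal_mul (by positivity), ← ENNReal.ofReal_mul (by positivity), ← ENNReal.ofReal_mul (by positivity), ← ENNReal.ofReal_mul (by positivity), ← ENNReal.ofReal_add (by positivity) (by positivity)]
          congr 1; ring
      _ = _ := by
          rw [lintegral_add_left (by fun_prop), lintegral_const_mul' _ _ ENNReal.ofReal_ne_top,
            lintegral_const_mul' _ _ ENNReal.ofReal_ne_top, gint q _ hW, gint (q+2) _ hW, cq_add_two]
          have hc := cq_pos q
          rw [← ENNReal.ofReal_mul (by positivity), ← ENNReal.ofReal_mul (by positivity), ← ENNReal.ofReal_mul (by positivity), ← ENNReal.ofReal_mul (by positivity), ← ENNReal.ofReal_add (by positivity) (by positivity)]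
          congr 1
          have : (Real.sqrt (v + z ⬝ᵥ z))^(q+2+1) = (v + z ⬝ᵥ z) * (Real.sqrt (v + z ⬝ᵥ z))^(q+1) := by
            rw [show q+2+1 = (q+1)+2 by ring, pow_add _ (q+1) 2, Real.sq_sqrt hW.le]; ring
          rw [this]
          field_simp
  · have := Wmeas (n := n) v
    exact Measurable.aemeasurable (by unfold gk dotProduct; fun_prop)



lemma jensen_exp {α : Type*} [MeasurableSpace α] (μ : Measure α) [IsProbabilityMeasure μ] (x : α → ℝ)
    (hx : Measurable x) (hx0 : ∀ z, 0 ≤ x z) (a : ℝ) (ha : 0 ≤ a) (h : ∫⁻ z, ENNReal.ofReal (x z) ∂μ ≤ ENNReal.ofReal a) :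
    ENNReal.ofReal (Real.exp (-a)) ≤ ∫⁻ z, ENNReal.ofReal (Real.exp (-(x z))) ∂μ := by
  have h1 : ∀ z, ENNReal.ofReal (Real.exp (-a) * (1 + a)) ≤
      ENNReal.ofReal (Real.exp (-(x z))) + ENNReal.ofReal (Real.exp (-a)) * ENNReal.ofReal (x z) := by
    intro z
    have := hx0 z
    rw [← ENNReal.ofReal_mul (by positivity), ← ENNReal.ofReal_add (by positivity) (by positivity)]
    apply ENNReal.ofReal_le_ofReal
    have h2 := Real.add_one_le_exp (a - x z)
    have h3 : Real.exp (-(x z)) = Real.exp (-a) * Real.exp (a - x z) := by rw [← Real.exp_add]; congr 1; ring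
    rw [h3]
    nlinarith [Real.exp_pos (-a)]
  have h2 := lintegral_mono (μ := μ) h1
  rw [lintegral_const, measure_univ, mul_one, lintegral_add_left (by fun_prop), lintegral_const_mul' _ _ ENNReal.ofReal_ne_top] at h2
  have h3 : ENNReal.ofReal (Real.exp (-a)) + ENNReal.ofReal (Real.exp (-a)) * ENNReal.ofReal a ≤
      ∫⁻ z, ENNReal.ofReal (Real.exp (-(x z))) ∂μ + ENNReal.ofReal (Real.exp (-a)) * ENNReal.ofReal a := by
    calc _ = ENNReal.ofReal (Real.exp (-a) * (1 + a)) := by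
          rw [← ENNReal.ofReal_mul (by positivity), ← ENNReal.ofReal_add (by positivity) (by positivity)]; congr 1; ring
      _ ≤ _ := h2
      _ ≤ _ := by gcongr
  exact ENNReal.le_of_add_le_add_right (ENNReal.mul_ne_top ENNReal.ofReal_ne_top ENNReal.ofReal_ne_top) h3

lemma mink {α ι : Type*} [MeasurableSpace α] (μ : Measure α) (N : ℕ) (hN : 1 ≤ N) (s : Finset ι)
    (f : ι → α → ℝ≥0∞) (hf : ∀ i, Measurable (f i)) (b : ι → ℝ≥0∞)
    (h : ∀ i, ∫⁻ z, (f i z)^N ∂μ ≤ (b i)^N) :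
    ∫⁻ z, (∑ i ∈ s, f i z)^N ∂μ ≤ (∑ i ∈ s, b i)^N := by
  have hN0 : (0:ℝ) < N := by exact_mod_cast (by omega : 0 < N)
  have conv : ∀ (g : α → ℝ≥0∞) (c : ℝ≥0∞), (∫⁻ z, (g z)^N ∂μ ≤ c^N) ↔ ((∫⁻ z, (g z)^(N:ℝ) ∂μ)^(1/(N:ℝ)) ≤ c) := by
    intro g c
    simp_rw [ENNReal.rpow_natCast]
    rw [one_div, ENNReal.rpow_inv_le_iff hN0, ENNReal.rpow_natCast]
  classical
  induction s using Finset.induction_on with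
  | empty => simp [show N ≠ 0 by omega]
  | insert i s hi ih =>
    simp only [Finset.sum_insert hi]
    rw [conv]
    rw [conv] at ih
    have hi' := (conv _ _).1 (h i)
    have hm : Measurable (fun z => ∑ i ∈ s, f i z) := by fun_prop
    refine (ENNReal.lintegral_Lp_add_le (hf i).aemeasurable hm.aemeasurable (by exact_mod_cast hN)).trans ?_
    gcongr

lemma mom_H {m k n : ℕ} (ν : Measure (Fin n → ℝ)) (B : ℝ) (hB : 0 < B)
    (hm : ∀ η : Fin n → ℝ, ∫⁻ z, ENNReal.ofReal ((z ⬝ᵥ η)^(8*(m+1))) ∂ν ≤ ENNReal.ofReal ((B * (η ⬝ᵥ η))^(4*(m+1))))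
    (H : Fin k → Fin n → ℝ) :
    ∫⁻ z, ENNReal.ofReal ((∑ i, (H i ⬝ᵥ z)^2)^(4*(m+1))) ∂ν ≤ ENNReal.ofReal ((B * ∑ i, H i ⬝ᵥ H i)^(4*(m+1))) := by
  have h := mink ν (4*(m+1)) (by omega) Finset.univ (fun i z => ENNReal.ofReal ((H i ⬝ᵥ z)^2))
    (fun i => by unfold dotProduct; fun_prop) (fun i => ENNReal.ofReal (B * (H i ⬝ᵥ H i))) ?_
  · have hnn : ∀ i ∈ Finset.univ, 0 ≤ B * (H i ⬝ᵥ H i) := fun i _ => mul_nonneg hB.le (dot_self_nonneg' _)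
    rw [← ENNReal.ofReal_sum_of_nonneg hnn, ← ENNReal.ofReal_pow (Finset.sum_nonneg hnn), ← Finset.mul_sum] at h
    refine le_trans (le_of_eq (lintegral_congr fun z => ?_)) h
    rw [← ENNReal.ofReal_sum_of_nonneg (fun i _ => sq_nonneg _), ← ENNReal.ofReal_pow (Finset.sum_nonneg fun i _ => sq_nonneg _)]
  · intro i
    have hi := hm (H i)
    rw [← ENNReal.ofReal_pow (mul_nonneg hB.le (dot_self_nonneg' _))]
    refine le_trans (le_of_eq (lintegral_congr fun z => ?_)) hi
    rw [← ENNReal.ofReal_pow (sq_nonneg _), ← pow_mul, dotProduct_comm, show 2 * (4*(m+1)) = 8*(m+1) by ring]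

lemma tail_H {m k n : ℕ} (ν : Measure (Fin n → ℝ)) (B : ℝ) (hB : 0 < B)
    (hm : ∀ η : Fin n → ℝ, ∫⁻ z, ENNReal.ofReal ((z ⬝ᵥ η)^(8*(m+1))) ∂ν ≤ ENNReal.ofReal ((B * (η ⬝ᵥ η))^(4*(m+1))))
    (H : Fin k → Fin n → ℝ) (e : ℝ) :
    ν {z | Real.exp e * (B * ∑ i, H i ⬝ᵥ H i) < ∑ i, (H i ⬝ᵥ z)^2} ≤ ENNReal.ofReal (Real.exp (-(e * (4*(m+1))))) := by
  set T := B * ∑ i, H i ⬝ᵥ H i with hT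
  have hT0 : 0 ≤ T := mul_nonneg hB.le (Finset.sum_nonneg fun i _ => dot_self_nonneg' _)
  rcases hT0.eq_or_lt with h0 | h0
  · have hs : ∑ i, H i ⬝ᵥ H i = 0 := by
      rcases mul_eq_zero.1 h0.symm with h | h
      · exact absurd h hB.ne'
      · exact h
    have hH : ∀ i, H i = 0 := by
      intro i
      have := (Finset.sum_eq_zero_iff_of_nonneg (fun i _ => dot_self_nonneg' (H i))).1 hs i (Finset.mem_univ i)
      exact dotProduct_self_eq_zero.1 this
    have : {z : Fin n → ℝ | Real.exp e * T < ∑ i, (H i ⬝ᵥ z)^2} = ∅ := by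
      ext z; simp [hH, ← h0]
    rw [this]; simp
  · have h := mom_H ν B hB hm H
    rw [← hT] at h
    have hmk := mul_meas_ge_le_lintegral (μ := ν) (f := fun z => ENNReal.ofReal ((∑ i, (H i ⬝ᵥ z)^2)^(4*(m+1))))
      (by unfold dotProduct; fun_prop) (ENNReal.ofReal ((Real.exp e * T)^(4*(m+1))))
    have hc : ENNReal.ofReal ((Real.exp e * T)^(4*(m+1))) * ν {z | Real.exp e * T < ∑ i, (H i ⬝ᵥ z)^2} ≤
        ENNReal.ofReal (T^(4*(m+1))) := by
      refine le_trans ?_ (hmk.trans h)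
      refine mul_le_mul_right (measure_mono ?_) _
      intro z hz
      simp only [Set.mem_ofPred_eq] at hz ⊢
      apply ENNReal.ofReal_le_ofReal
      gcongr
    have hp : 0 < (Real.exp e * T)^(4*(m+1)) := by positivity
    have h2 : ENNReal.ofReal (T^(4*(m+1))) = ENNReal.ofReal ((Real.exp e * T)^(4*(m+1))) * ENNReal.ofReal (Real.exp (-(e * (4*(m+1))))) := by
      rw [← ENNReal.ofReal_mul hp.le]
      congr 1
      clear_value T
      rw [mul_pow, ← Real.exp_nat_mul, mul_right_comm, ← Real.exp_add]
      push_cast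
      rw [show (4 * ((m:ℝ)+1) * e + -(e * (4*(m+1)))) = 0 by ring, Real.exp_zero, one_mul]
    rw [h2] at hc
    exact (ENNReal.mul_le_mul_iff_right (by simpa using hp) ENNReal.ofReal_ne_top).1 hc

lemma psi_compare {m n : ℕ} (ν : Measure (Fin n → ℝ)) [IsProbabilityMeasure ν] (hn : 1 ≤ n) (v δ B : ℝ) (hδ : 0 < δ) (hv : v = δ * n)
    (hB : 0 < B) (hcond : Real.exp (2 + 2/δ) * B * (2 * (14 + 12/δ) * (m+1) + 1) ≤ v)
    (hm : ∀ η : Fin n → ℝ, ∫⁻ z, ENNReal.ofReal ((z ⬝ᵥ η)^(8*(m+1))) ∂ν ≤ ENNReal.ofReal ((B * (η ⬝ᵥ η))^(4*(m+1))))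
    (G G' : Fin (m+1) → Fin n → ℝ) (hG : SS ν G ≤ ENNReal.ofReal (12 * (m+1) * n)) (t : ℝ) :
    psi ν v G t ≤ ENNReal.ofReal (Real.exp (1/4 + (∑ i, (G' i - G i) ⬝ᵥ (G' i - G i)) / 2)) * psi ν v G' t +
      ENNReal.ofReal (2 * Real.exp (-7 * (m+1))) * psi ν v G 0 := by
  have hn0 : (0:ℝ) < n := by exact_mod_cast hn
  have hv0 : 0 < v := by rw [hv]; positivity
  set H : Fin (m+1) → Fin n → ℝ := fun i => G' i - G i with hH
  set Q := ∑ i, (G' i - G i) ⬝ᵥ (G' i - G i) with hQ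
  have hQ0 : 0 ≤ Q := Finset.sum_nonneg fun i _ => dot_self_nonneg' _
  set D := 14 + 12/δ with hD
  have hD0 : 0 < D := by positivity
  set E := Real.exp (2 + 2/δ) with hE
  -- lower bound at zero
  have h0 : ENNReal.ofReal (Real.exp (-(6 * (m+1) / δ))) ≤ psi ν v G 0 := by
    unfold psi kap
    have := jensen_exp ν (fun z => (∑ i, (G i ⬝ᵥ z)^2) / (2 * v)) (by unfold dotProduct; fun_prop)
      (fun z => by positivity) (6 * (m+1)/δ) (by positivity) ?_
    · refine this.trans (le_of_eq (lintegral_congr fun z => ?_))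
      congr 2
      simp [yv, neg_div]
    · calc ∫⁻ z, ENNReal.ofReal ((∑ i, (G i ⬝ᵥ z)^2) / (2 * v)) ∂ν = ENNReal.ofReal (1/(2*v)) * SS ν G := by
            unfold SS
            rw [← lintegral_const_mul' _ _ ENNReal.ofReal_ne_top]
            refine lintegral_congr fun z => ?_
            rw [← ENNReal.ofReal_mul (by positivity)]; congr 1; ring
        _ ≤ ENNReal.ofReal (1/(2*v)) * ENNReal.ofReal (12 * (m+1) * n) := by gcongr
        _ = _ := by
            rw [← ENNReal.ofReal_mul (by positivity), hv]; congr 1; field_simp; ring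
  -- the two bad sets
  set S2 : Set (Fin n → ℝ) := {z | E * (B * Q) < ∑ i, (H i ⬝ᵥ z)^2} with hS2
  have hS2m : MeasurableSet S2 := by
    refine measurableSet_lt measurable_const ?_
    unfold dotProduct; fun_prop
  have hS2le : ν S2 ≤ ENNReal.ofReal (Real.exp (-7 * (m+1))) * psi ν v G 0 := by
    refine (tail_H ν B hB hm H (2 + 2/δ)).trans ?_
    refine le_trans ?_ (mul_le_mul_right h0 _)
    rw [← ENNReal.ofReal_mul (by positivity), ← Real.exp_add]
    apply ENNReal.ofReal_le_ofReal
    apply Real.exp_le_exp.2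
    have : (2 + 2/δ) * (4 * ((m:ℝ)+1)) = 8 * (m+1) + 8 * (m+1)/δ := by ring
    rw [this]
    have : 6 * ((m:ℝ)+1)/δ ≤ 8 * (m+1)/δ := by gcongr; norm_num
    have hm0 : (0:ℝ) ≤ m := by positivity
    linarith
  have hpt : ∀ z, ENNReal.ofReal (kap v (yv m t) G z) ≤
      ENNReal.ofReal (Real.exp (1/4 + Q/2)) * ENNReal.ofReal (kap v (yv m t) G' z) +
        (ENNReal.ofReal (Real.exp (-(D * (m+1) / 2))) + S2.indicator 1 z) := by
    intro z
    by_cases hz2 : z ∈ S2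
    · rw [Set.indicator_of_mem hz2]
      refine le_trans ?_ (le_add_left (le_add_left le_rfl))
      simp only [Pi.one_apply]
      rw [ENNReal.ofReal_le_one]
      unfold kap
      apply Real.exp_le_one_iff.2
      rw [neg_div]
      have : 0 ≤ (∑ i, (yv m t i - G i ⬝ᵥ z)^2) / (2*v) := by positivity
      linarith
    set ρ := ∑ i, (yv m t i - G i ⬝ᵥ z)^2 with hρ
    have hρ0 : 0 ≤ ρ := by positivity
    by_cases hz1 : D * (m+1) * v < ρ
    · refine le_trans ?_ (le_add_left (le_add_right le_rfl))
      apply ENNReal.ofReal_le_ofReal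
      unfold kap
      apply Real.exp_le_exp.2
      rw [neg_div, ← hρ]
      apply neg_le_neg
      rw [div_le_div_iff₀ (by norm_num) (by positivity)]
      nlinarith
    · push Not at hz1
      refine le_trans ?_ (le_add_right le_rfl)
      rw [← ENNReal.ofReal_mul (by positivity)]
      apply ENNReal.ofReal_le_ofReal
      unfold kap
      rw [← Real.exp_add]
      apply Real.exp_le_exp.2
      have hz2' : ∑ i, (H i ⬝ᵥ z)^2 ≤ E * (B * Q) := not_lt.1 hz2
      set a := 1/(2 * D * (m+1)) with ha
      have ha0 : 0 < a := by positivity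
      have hle : ∑ i, (yv m t i - G' i ⬝ᵥ z)^2 ≤ (1 + a) * ρ + (1 + 1/a) * ∑ i, (H i ⬝ᵥ z)^2 := by
        rw [hρ, Finset.mul_sum, Finset.mul_sum, ← Finset.sum_add_distrib]
        refine Finset.sum_le_sum fun i _ => ?_
        have : G' i ⬝ᵥ z = G i ⬝ᵥ z + H i ⬝ᵥ z := by
          rw [hH]; simp only [sub_dotProduct]; ring
        rw [this]
        set r := yv m t i - G i ⬝ᵥ z
        set s := H i ⬝ᵥ z
        have e : (yv m t i - (G i ⬝ᵥ z + s))^2 = (r - s)^2 := by ring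
        rw [e]
        have hsq : 0 ≤ (1/a) * (a * r + s)^2 := by positivity
        have e2 : (1/a) * (a * r + s)^2 = a * r^2 + 2 * r * s + (1/a) * s^2 := by field_simp; ring
        rw [e2] at hsq
        nlinarith
      have h1a : 1/a = 2 * D * (m+1) := by rw [ha]; simp
      have hA : a * ρ ≤ v/2 := by
        calc a * ρ ≤ a * (D * (m+1) * v) := by gcongr
          _ = v/2 := by rw [ha]; field_simp
      have hB2 : (1 + 1/a) * ∑ i, (H i ⬝ᵥ z)^2 ≤ v * Q := by
        calc (1 + 1/a) * ∑ i, (H i ⬝ᵥ z)^2 ≤ (1 + 1/a) * (E * (B * Q)) := by gcongr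
          _ = (E * B * (2 * D * (m+1) + 1)) * Q := by rw [h1a]; ring
          _ ≤ v * Q := by gcongr
      rw [← hρ]
      have e3 : (1/4 + Q/2) = (v/2 + v * Q)/(2*v) := by field_simp; ring
      rw [e3, ← add_div]
      gcongr
      linarith
  calc psi ν v G t ≤ ∫⁻ z, (ENNReal.ofReal (Real.exp (1/4 + Q/2)) * ENNReal.ofReal (kap v (yv m t) G' z) +
        (ENNReal.ofReal (Real.exp (-(D * (m+1) / 2))) + S2.indicator 1 z)) ∂ν := lintegral_mono hpt
    _ = ENNReal.ofReal (Real.exp (1/4 + Q/2)) * psi ν v G' t + (ENNReal.ofReal (Real.exp (-(D * (m+1) / 2))) + ν S2) := by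
        rw [lintegral_add_left ((kap_meas_z v G' t).const_mul _), lintegral_const_mul' _ _ ENNReal.ofReal_ne_top,
          lintegral_add_left (by fun_prop), lintegral_const, measure_univ, mul_one, lintegral_indicator_one hS2m]
        rfl
    _ ≤ _ := by
        gcongr
        have e1 : ENNReal.ofReal (Real.exp (-(D * (m+1) / 2))) ≤ ENNReal.ofReal (Real.exp (-7 * (m+1))) * psi ν v G 0 := by
          refine le_trans (le_of_eq ?_) (mul_le_mul_right h0 _)
          rw [← ENNReal.ofReal_mul (by positivity), ← Real.exp_add]
          congr 2
          rw [hD]; ring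
        calc _ ≤ ENNReal.ofReal (Real.exp (-7 * (m+1))) * psi ν v G 0 + ENNReal.ofReal (Real.exp (-7 * (m+1))) * psi ν v G 0 := add_le_add e1 hS2le
          _ = _ := by rw [ENNReal.ofReal_mul (by norm_num)]; simp [two_mul, add_mul]

lemma lint_scale (F : ℝ → ℝ≥0∞) (hF : Measurable F) :
    ∫⁻ t in Set.Ioi (0:ℝ), F (t/2) = 2 * ∫⁻ t in Set.Ioi (0:ℝ), F t := by
  have h := Real.smul_map_volume_mul_left (a := 2) (by norm_num)
  rw [← lintegral_indicator measurableSet_Ioi]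
  conv_lhs => rw [← h]
  rw [lintegral_smul_measure, lintegral_map _ (by fun_prop)]
  · rw [← lintegral_indicator measurableSet_Ioi]
    simp only [abs_two, smul_eq_mul]
    congr 1
    · simp
    · refine lintegral_congr fun t => ?_
      simp [Set.indicator]
  · exact (hF.comp (by fun_prop)).indicator measurableSet_Ioi

lemma ennreal_absorb {h X : ℝ≥0∞} (hh : h ≠ ∞) (hle : h ≤ X + h/2) : h ≤ 2 * X := by
  have h2 : h/2 ≠ ∞ := ENNReal.div_ne_top hh (by norm_num)
  have : h/2 + h/2 ≤ X + h/2 := by rwa [ENNReal.add_halves]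
  have h3 := ENNReal.le_of_add_le_add_right h2 this
  calc h = h/2 + h/2 := (ENNReal.add_halves h).symm
    _ ≤ X + X := add_le_add h3 h3
    _ = _ := (two_mul X).symm

lemma hq_compare {m n : ℕ} (ν : Measure (Fin n → ℝ)) [IsProbabilityMeasure ν] (hν : PL ν (fun _ => 0))
    (hn : 1 ≤ n) (v δ B : ℝ) (hδ : 0 < δ) (hv : v = δ * n)
    (hB : 0 < B) (hcond : Real.exp (2 + 2/δ) * B * (2 * (14 + 12/δ) * (m+1) + 1) ≤ v)
    (hm : ∀ η : Fin n → ℝ, ∫⁻ z, ENNReal.ofReal ((z ⬝ᵥ η)^(8*(m+1))) ∂ν ≤ ENNReal.ofReal ((B * (η ⬝ᵥ η))^(4*(m+1))))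
    (G G' : Fin (m+1) → Fin n → ℝ) (hG : SS ν G ≤ ENNReal.ofReal (12 * (m+1) * n)) (q : ℕ) (hq2 : q ≤ 2 * m)
    (hfin : hq ν v q G ≠ ∞) :
    hq ν v q G ≤ ENNReal.ofReal (6 * Real.exp ((∑ i, (G' i - G i) ⬝ᵥ (G' i - G i)) / 2)) * hq ν v q G' := by
  have hn0 : (0:ℝ) < n := by exact_mod_cast hn
  have hv0 : 0 < v := by rw [hv]; positivity
  set Q := ∑ i, (G' i - G i) ⬝ᵥ (G' i - G i) with hQ
  set L := ENNReal.ofReal (Real.exp (1/4 + Q/2)) with hL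
  set ε : ℝ := (1/2)^(q+2) with hε
  have hε0 : 0 < ε := by positivity
  have hsmall : 4 * Real.exp (-7 * (m+1)) ≤ ε^2 := by
    have h1 : Real.exp (-7 * (m+1)) = (Real.exp (-7))^(m+1) := by
      rw [← Real.exp_nat_mul]; congr 1; push_cast; ring
    have h2 : Real.exp (-7) ≤ (1/2)^8 := by
      rw [Real.exp_neg]
      have : (2:ℝ)^8 ≤ Real.exp 7 := by
        have e : Real.exp 7 = (Real.exp 1)^7 := by rw [← Real.exp_nat_mul]; norm_num
        rw [e]
        have := Real.exp_one_gt_d9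
        calc (2:ℝ)^8 ≤ (2.7)^7 := by norm_num
          _ ≤ _ := by gcongr; linarith
      calc (Real.exp 7)⁻¹ ≤ (2^8)⁻¹ := by gcongr
        _ = _ := by norm_num
    rw [h1, hε]
    calc 4 * (Real.exp (-7))^(m+1) ≤ 4 * ((1/2)^8)^(m+1) := by gcongr
      _ = (1/2:ℝ)^(8*(m+1) - 2) := by
          rw [← pow_mul]
          have : 8*(m+1) = (8*(m+1)-2) + 2 := by omega
          conv_lhs => rw [this, pow_add]
          norm_num
          ring
      _ ≤ (1/2:ℝ)^((q+2)*2) := pow_le_pow_of_le_one (by norm_num) (by norm_num) (by omega)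
      _ = _ := by rw [pow_mul]
  have hpt : ∀ t, psi ν v G t ≤ 2 * L * psi ν v G' t + ENNReal.ofReal ε * psi ν v G (t/2) := by
    intro t
    have h1 := psi_compare ν hn v δ B hδ hv hB hcond hm G G' hG t
    rw [← hQ, ← hL] at h1
    set E := ENNReal.ofReal (2 * Real.exp (-7 * (m+1))) * psi ν v G 0 with hE
    rcases le_total E (L * psi ν v G' t) with h2 | h2
    · refine le_trans ?_ (le_add_right le_rfl)
      calc _ ≤ L * psi ν v G' t + E := h1
        _ ≤ L * psi ν v G' t + L * psi ν v G' t := by gcongr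
        _ = _ := by ring
    · refine le_trans ?_ (le_add_left le_rfl)
      apply ennreal_le_of_sq
      have h3 : psi ν v G t ≤ ENNReal.ofReal (ε^2) * psi ν v G 0 := by
        calc _ ≤ L * psi ν v G' t + E := h1
          _ ≤ E + E := by gcongr
          _ = ENNReal.ofReal (4 * Real.exp (-7 * (m+1))) * psi ν v G 0 := by
            rw [hE, ← add_mul, ← ENNReal.ofReal_add (by positivity) (by positivity)]; congr 2; ring
          _ ≤ _ := by gcongr
      calc (psi ν v G t)^2 = psi ν v G t * psi ν v G t := sq _
        _ ≤ psi ν v G t * (ENNReal.ofReal (ε^2) * psi ν v G 0) := by gcongr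
        _ = ENNReal.ofReal (ε^2) * (psi ν v G t * psi ν v G 0) := by ring
        _ ≤ ENNReal.ofReal (ε^2) * (psi ν v G (t/2))^2 := by gcongr; exact psi_mid ν hν v hv0 G t
        _ = _ := by rw [mul_pow, ENNReal.ofReal_pow hε0.le]
  have hpm := psi_meas ν v G
  have hpm' := psi_meas ν v G'
  have hmain : hq ν v q G ≤ 2 * L * hq ν v q G' + hq ν v q G / 2 := by
    calc hq ν v q G ≤ ∫⁻ t in Set.Ioi (0:ℝ), (2 * L * ((ENNReal.ofReal t)^q * psi ν v G' t) +
          ENNReal.ofReal (ε * 2^q) * ((ENNReal.ofReal (t/2))^q * psi ν v G (t/2))) := by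
          refine setLIntegral_mono' measurableSet_Ioi fun t ht => ?_
          have ht' : (0:ℝ) < t := ht
          calc _ ≤ (ENNReal.ofReal t)^q * (2 * L * psi ν v G' t + ENNReal.ofReal ε * psi ν v G (t/2)) := by
                gcongr; exact hpt t
            _ = 2 * L * ((ENNReal.ofReal t)^q * psi ν v G' t) + (ENNReal.ofReal ε * (ENNReal.ofReal t)^q) * psi ν v G (t/2) := by ring
            _ = _ := by
                rw [← mul_assoc (ENNReal.ofReal (ε * 2^q))]
                congr 2
                rw [← ENNReal.ofReal_pow ht'.le, ← ENNReal.ofReal_pow (by positivity), ← ENNReal.ofReal_mul (by positivity),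
                  ← ENNReal.ofReal_mul (by positivity)]
                congr 1
                rw [div_pow]; field_simp
      _ = 2 * L * hq ν v q G' + ENNReal.ofReal (ε * 2^q) * (2 * hq ν v q G) := by
          rw [lintegral_add_left ((by fun_prop : Measurable fun t : ℝ => (ENNReal.ofReal t)^q * psi ν v G' t).const_mul _),
            lintegral_const_mul _ (by fun_prop), lintegral_const_mul' _ _ ENNReal.ofReal_ne_top,
            lint_scale (fun t => (ENNReal.ofReal t)^q * psi ν v G t) (by fun_prop)]
          rfl
      _ = _ := by
          congr 1
          have : ε * 2^q = 1/4 := by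
            rw [hε, pow_add, mul_right_comm, ← mul_pow]; norm_num
          rw [this, ENNReal.div_eq_inv_mul, ← mul_assoc]
          congr 1
          rw [show (2:ℝ≥0∞) = ENNReal.ofReal 2 by simp, ← ENNReal.ofReal_mul (by norm_num), ← ENNReal.ofReal_inv_of_pos (by norm_num)]
          congr 1; norm_num
  have h4 := ennreal_absorb hfin hmain
  refine h4.trans ?_
  rw [← mul_assoc, ← mul_assoc]
  gcongr
  rw [hL, show (2:ℝ≥0∞) = ENNReal.ofReal 2 by simp, ← ENNReal.ofReal_mul (by norm_num), ← ENNReal.ofReal_mul (by norm_num)]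
  apply ENNReal.ofReal_le_ofReal
  rw [Real.exp_add]
  have h14 : Real.exp (1/4) ≤ 3/2 := by
    have : (Real.exp (1/4))^4 ≤ (3/2)^4 := by
      rw [← Real.exp_nat_mul]; norm_num
      have := Real.exp_one_lt_d9
      linarith
    exact le_of_pow_le_pow_left₀ (by norm_num) (by norm_num) this
  nlinarith [Real.exp_pos (Q/2)]



lemma half_K {m n : ℕ} (ν : Measure (Fin n → ℝ)) [IsProbabilityMeasure ν] (hn : 1 ≤ n) (v : ℝ) (hv : 0 < v) (q : ℕ) (hq2 : q ≤ 2*m)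
    (h1 : ∫⁻ z, ENNReal.ofReal (z ⬝ᵥ z) ∂ν ≤ ENNReal.ofReal n)
    (h2 : ∀ η : Fin n → ℝ, ∫⁻ z, ENNReal.ofReal ((z ⬝ᵥ η)^2) ∂ν ≤ ENNReal.ofReal (n * (η ⬝ᵥ η)))
    (hfin : ∫⁻ G, hq ν v q G ∂(gm (m+1) n) ≠ ∞) (K : Set (Fin (m+1) → Fin n → ℝ))
    (hK : K =ᵐ[gm (m+1) n] {G | SS ν G ≤ ENNReal.ofReal (12 * (m+1) * n)}) :
    ∫⁻ G, hq ν v q G ∂(gm (m+1) n) ≤ 2 * ∫⁻ G in K, hq ν v q G ∂(gm (m+1) n) := by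
  have hn0 : (0:ℝ) < n := by exact_mod_cast hn
  rw [setLIntegral_congr hK]
  apply ennreal_absorb hfin
  have hKm : MeasurableSet {G : Fin (m+1) → Fin n → ℝ | SS ν G ≤ ENNReal.ofReal (12 * (m+1) * n)} :=
    measurableSet_le (SS_meas ν) measurable_const
  conv_lhs => rw [← lintegral_add_compl _ hKm]
  gcongr
  set I := ∫⁻ G, hq ν v q G ∂(gm (m+1) n) with hI
  have hSS := SS_mean ν v hv q h1 h2 (m := m)
  rw [← hI] at hSS
  have hc : ENNReal.ofReal (12 * (m+1) * n) * ∫⁻ G in {G | SS ν G ≤ ENNReal.ofReal (12 * (m+1) * n)}ᶜ, hq ν v q G ∂(gm (m+1) n) ≤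
      ENNReal.ofReal (12 * (m+1) * n) * (I/2) := by
    calc _ = ∫⁻ G in {G | SS ν G ≤ ENNReal.ofReal (12 * (m+1) * n)}ᶜ, ENNReal.ofReal (12 * (m+1) * n) * hq ν v q G ∂(gm (m+1) n) := by
          rw [lintegral_const_mul' _ _ ENNReal.ofReal_ne_top]
      _ ≤ ∫⁻ G in {G | SS ν G ≤ ENNReal.ofReal (12 * (m+1) * n)}ᶜ, SS ν G * hq ν v q G ∂(gm (m+1) n) := by
          refine setLIntegral_mono' hKm.compl fun G hG => ?_
          gcongr
          simp only [Set.mem_compl_iff, Set.mem_ofPred_eq, not_le] at hG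
          exact hG.le
      _ ≤ ∫⁻ G, SS ν G * hq ν v q G ∂(gm (m+1) n) := setLIntegral_le_lintegral _ _
      _ ≤ _ := hSS
      _ ≤ ENNReal.ofReal (12 * (m+1) * n / 2) * I := by
          gcongr
          have : (q:ℝ) ≤ 2 * m := by exact_mod_cast hq2
          nlinarith
      _ = _ := by
          rw [ENNReal.ofReal_div_of_pos (by norm_num), ENNReal.div_eq_inv_mul, ENNReal.div_eq_inv_mul]
          simp only [ENNReal.ofReal_ofNat]; ring
  exact (ENNReal.mul_le_mul_iff_right (by simp; positivity) ENNReal.ofReal_ne_top).1 hc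

lemma mean_plus {m n : ℕ} (ν : Measure (Fin n → ℝ)) [IsProbabilityMeasure ν] (v : ℝ) (hv : 0 < v) (p : ℕ) :
    ∫⁻ G, hq ν v (m+p) G ∂(gm (m+1) n) = ENNReal.ofReal (cq (m+p) * (Real.sqrt v)^(m+1)) *
      ∫⁻ z, ENNReal.ofReal ((Real.sqrt (v + z ⬝ᵥ z))^p) ∂ν := by
  rw [hq_mean ν v hv, ← lintegral_const_mul' _ _ ENNReal.ofReal_ne_top]
  refine lintegral_congr fun z => ?_
  have hW : 0 < v + z ⬝ᵥ z := by have := dot_self_nonneg' z; positivity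
  have hc := cq_pos (m+p)
  rw [← ENNReal.ofReal_mul (gk_nonneg _ _ _), ← ENNReal.ofReal_mul (by positivity)]
  congr 1
  unfold gk
  rw [Real.sqrt_div hv.le, show m+p+1 = (m+1)+p by ring, pow_add _ (m+1) p, div_pow]
  have : 0 < Real.sqrt (v + z ⬝ᵥ z) := Real.sqrt_pos.2 hW
  field_simp

lemma mean_minus {m n : ℕ} (ν : Measure (Fin n → ℝ)) [IsProbabilityMeasure ν] (v : ℝ) (hv : 0 < v) (p : ℕ) (hp : p ≤ m) :
    ∫⁻ G, hq ν v (m-p) G ∂(gm (m+1) n) = ENNReal.ofReal (cq (m-p) * (Real.sqrt v)^(m+1)) *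
      ∫⁻ z, ENNReal.ofReal ((Real.sqrt (v + z ⬝ᵥ z))⁻¹^p) ∂ν := by
  rw [hq_mean ν v hv, ← lintegral_const_mul' _ _ ENNReal.ofReal_ne_top]
  refine lintegral_congr fun z => ?_
  have hW : 0 < v + z ⬝ᵥ z := by have := dot_self_nonneg' z; positivity
  have hc := cq_pos (m-p)
  rw [← ENNReal.ofReal_mul (gk_nonneg _ _ _), ← ENNReal.ofReal_mul (by positivity)]
  congr 1
  unfold gk
  obtain ⟨r, rfl⟩ := Nat.exists_eq_add_of_le hp
  have : 0 < Real.sqrt (v + z ⬝ᵥ z) := Real.sqrt_pos.2 hW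
  rw [Real.sqrt_div hv.le, show p + r - p = r by omega, div_pow, show p + r + 1 = (r+1) + p by ring, pow_add (Real.sqrt (v + z ⬝ᵥ z)) (r+1) p,
    inv_pow]
  field_simp

lemma R_fin {m n : ℕ} (ν : Measure (Fin n → ℝ)) [IsProbabilityMeasure ν] (v B : ℝ) (hv : 0 < v) (hB : 0 < B)
    (hm : ∀ η : Fin n → ℝ, ∫⁻ z, ENNReal.ofReal ((z ⬝ᵥ η)^(8*(m+1))) ∂ν ≤ ENNReal.ofReal ((B * (η ⬝ᵥ η))^(4*(m+1))))
    (p : ℕ) (hp : p ≤ 8 * (m+1)) : ∫⁻ z, ENNReal.ofReal ((Real.sqrt (v + z ⬝ᵥ z))^p) ∂ν ≠ ∞ := by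
  have h := mom_H ν B hB hm (fun i : Fin n => Pi.single i (1:ℝ))
  set N := 4*(m+1) with hN
  have hle : ∀ z : Fin n → ℝ, ENNReal.ofReal ((Real.sqrt (v + z ⬝ᵥ z))^p) ≤
      ENNReal.ofReal (1 + 2^(N-1) * v^N) + ENNReal.ofReal (2^(N-1)) * ENNReal.ofReal ((∑ i, ((Pi.single i (1:ℝ) : Fin n → ℝ) ⬝ᵥ z)^2)^N) := by
    intro z
    have e : ∑ i, ((Pi.single i (1:ℝ) : Fin n → ℝ) ⬝ᵥ z)^2 = z ⬝ᵥ z := by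
      simp [dotProduct, Pi.single_apply, sq]
    rw [e]
    have hz := dot_self_nonneg' z
    rw [← ENNReal.ofReal_mul (by positivity), ← ENNReal.ofReal_add (by positivity) (by positivity)]
    apply ENNReal.ofReal_le_ofReal
    have h1 : (Real.sqrt (v + z ⬝ᵥ z))^p ≤ 1 + (Real.sqrt (v + z ⬝ᵥ z))^(2*N) := by
      rcases le_total (Real.sqrt (v + z ⬝ᵥ z)) 1 with h | h
      · have := pow_le_one₀ (n := p) (Real.sqrt_nonneg _) h
        have h' : 0 ≤ (Real.sqrt (v + z ⬝ᵥ z))^(2*N) := by positivity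
        linarith
      · have := pow_le_pow_right₀ h (show p ≤ 2 * N by omega)
        linarith
    rw [pow_mul, Real.sq_sqrt (by positivity)] at h1
    have h2 := add_pow_le hv.le hz N
    nlinarith
  refine ne_top_of_le_ne_top ?_ (lintegral_mono hle)
  rw [lintegral_add_left (by fun_prop), lintegral_const, lintegral_const_mul' _ _ ENNReal.ofReal_ne_top]
  refine ENNReal.add_ne_top.2 ⟨?_, ENNReal.mul_ne_top ENNReal.ofReal_ne_top (ne_top_of_le_ne_top ENNReal.ofReal_ne_top h)⟩
  simp

lemma mainT {m n : ℕ} (ν : Measure (Fin n → ℝ)) [IsProbabilityMeasure ν] (hν : PL ν (fun _ => 0))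
    (hn : 1 ≤ n) (v δ B : ℝ) (hδ : 0 < δ) (hv : v = δ * n)
    (hB : 0 < B) (hcond : Real.exp (2 + 2/δ) * B * (2 * (14 + 12/δ) * (m+1) + 1) ≤ v)
    (h1 : ∫⁻ z, ENNReal.ofReal (z ⬝ᵥ z) ∂ν ≤ ENNReal.ofReal n)
    (h2 : ∀ η : Fin n → ℝ, ∫⁻ z, ENNReal.ofReal ((z ⬝ᵥ η)^2) ∂ν ≤ ENNReal.ofReal (n * (η ⬝ᵥ η)))
    (hm : ∀ η : Fin n → ℝ, ∫⁻ z, ENNReal.ofReal ((z ⬝ᵥ η)^(8*(m+1))) ∂ν ≤ ENNReal.ofReal ((B * (η ⬝ᵥ η))^(4*(m+1))))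
    (p : ℕ) (hp : p < m) :
    (∫⁻ z, ENNReal.ofReal ((Real.sqrt (v + z ⬝ᵥ z))^p) ∂ν) * (∫⁻ z, ENNReal.ofReal ((Real.sqrt (v + z ⬝ᵥ z))⁻¹^p) ∂ν) ≤
      ENNReal.ofReal (144 * Real.exp (2*p^2/m)) := by
  have hn0 : (0:ℝ) < n := by exact_mod_cast hn
  have hv0 : 0 < v := by rw [hv]; positivity
  have hAp : ∫⁻ z, ENNReal.ofReal ((Real.sqrt (v + z ⬝ᵥ z))^p) ∂ν ≠ ∞ := R_fin ν v B hv0 hB hm p (by omega)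
  have hAm : ∫⁻ z, ENNReal.ofReal ((Real.sqrt (v + z ⬝ᵥ z))⁻¹^p) ∂ν ≠ ∞ := by
    refine ne_top_of_le_ne_top (b := ENNReal.ofReal ((Real.sqrt v)⁻¹^p)) ENNReal.ofReal_ne_top ?_
    calc _ ≤ ∫⁻ z, ENNReal.ofReal ((Real.sqrt v)⁻¹^p) ∂ν := by
          refine lintegral_mono fun z => ENNReal.ofReal_le_ofReal ?_
          have := dot_self_nonneg' z
          have hs : 0 < Real.sqrt v := Real.sqrt_pos.2 hv0
          gcongr
          linarith
      _ = _ := by simp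
  have eP := mean_plus (m := m) ν v hv0 p
  have eM := mean_minus (m := m) ν v hv0 p hp.le
  have e0 := mean_plus (m := m) ν v hv0 0
  simp only [add_zero, pow_zero, ENNReal.ofReal_one, lintegral_const, measure_univ, mul_one] at e0
  have hIP : ∫⁻ G, hq ν v (m+p) G ∂(gm (m+1) n) ≠ ∞ := by rw [eP]; exact ENNReal.mul_ne_top ENNReal.ofReal_ne_top hAp
  have hIM : ∫⁻ G, hq ν v (m-p) G ∂(gm (m+1) n) ≠ ∞ := by rw [eM]; exact ENNReal.mul_ne_top ENNReal.ofReal_ne_top hAm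
  have hmP := hq_meas (m := m) ν v (m+p)
  have hmM := hq_meas (m := m) ν v (m-p)
  have hm0 := hq_meas (m := m) ν v m
  set K : Set (Fin (m+1) → Fin n → ℝ) := {G | SS ν G ≤ ENNReal.ofReal (12 * (m+1) * n)} ∩
    ({G | hq ν v (m+p) G ≠ ∞} ∩ {G | hq ν v (m-p) G ≠ ∞}) with hK
  have hKm : MeasurableSet K := (measurableSet_le (SS_meas ν) measurable_const).inter
    ((measurableSet_eq_fun hmP measurable_const).compl.inter (measurableSet_eq_fun hmM measurable_const).compl)
  have hKae : K =ᵐ[gm (m+1) n] {G | SS ν G ≤ ENNReal.ofReal (12 * (m+1) * n)} := by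
    filter_upwards [ae_lt_top hmP hIP, ae_lt_top hmM hIM] with G g1 g2
    apply propext
    constructor
    · exact fun h => h.1
    · exact fun h => ⟨h, g1.ne, g2.ne⟩
  have hP := half_K ν hn v hv0 (m+p) (by omega) h1 h2 hIP K hKae
  have hM := half_K ν hn v hv0 (m-p) (by omega) h1 h2 hIM K hKae
  have key := pl_gm (m+1) n (K.indicator (hq ν v (m+p))) (K.indicator (hq ν v (m-p)))
    (fun G => ENNReal.ofReal (6 * Real.exp (p^2/m)) * hq ν v m G)
    (hmP.indicator hKm) (hmM.indicator hKm) (hm0.const_mul _) ?_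
  · rw [lintegral_indicator hKm, lintegral_indicator hKm, lintegral_const_mul' _ _ ENNReal.ofReal_ne_top, e0] at key
    have hfinal : (∫⁻ G, hq ν v (m+p) G ∂(gm (m+1) n)) * (∫⁻ G, hq ν v (m-p) G ∂(gm (m+1) n)) ≤
        4 * (ENNReal.ofReal (6 * Real.exp (p^2/m)) * ENNReal.ofReal (cq m * (Real.sqrt v)^(m+1)))^2 := by
      calc _ ≤ (2 * ∫⁻ G in K, hq ν v (m+p) G ∂(gm (m+1) n)) * (2 * ∫⁻ G in K, hq ν v (m-p) G ∂(gm (m+1) n)) := mul_le_mul' hP hM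
        _ = 4 * ((∫⁻ G in K, hq ν v (m+p) G ∂(gm (m+1) n)) * (∫⁻ G in K, hq ν v (m-p) G ∂(gm (m+1) n))) := by ring
        _ ≤ _ := by gcongr
    rw [eP, eM] at hfinal
    have hcp := cq_pos (m+p)
    have hcm := cq_pos (m-p)
    have hc0 := cq_pos m
    have hsv : 0 < Real.sqrt v := Real.sqrt_pos.2 hv0
    set cc := cq (m+p) * (Real.sqrt v)^(m+1) * (cq (m-p) * (Real.sqrt v)^(m+1)) with hcc
    have hcc0 : 0 < cc := by positivity
    have hl : ENNReal.ofReal cc * ((∫⁻ z, ENNReal.ofReal ((Real.sqrt (v + z ⬝ᵥ z))^p) ∂ν) * (∫⁻ z, ENNReal.ofReal ((Real.sqrt (v + z ⬝ᵥ z))⁻¹^p) ∂ν)) ≤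
        ENNReal.ofReal cc * ENNReal.ofReal (144 * Real.exp (2*p^2/m)) := by
      calc _ = _ := by
            rw [hcc, ENNReal.ofReal_mul (by positivity), mul_mul_mul_comm]
        _ ≤ _ := hfinal
        _ = ENNReal.ofReal (144 * Real.exp (2*p^2/m) * (cq m)^2 * ((Real.sqrt v)^(m+1))^2) := by
            rw [← ENNReal.ofReal_mul (by positivity), ← ENNReal.ofReal_pow (by positivity),
              show (4:ℝ≥0∞) = ENNReal.ofReal 4 by simp, ← ENNReal.ofReal_mul (by positivity)]
            congr 1
            have : Real.exp (2*p^2/m) = (Real.exp (p^2/m))^2 := by rw [← Real.exp_nat_mul]; congr 1; push_cast; ring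
            rw [this]; ring
        _ ≤ _ := by
            rw [← ENNReal.ofReal_mul hcc0.le]
            apply ENNReal.ofReal_le_ofReal
            have := cq_logconvex m p hp
            calc _ ≤ 144 * Real.exp (2*p^2/m) * (cq (m+p) * cq (m-p)) * ((Real.sqrt v)^(m+1))^2 := by gcongr
              _ = _ := by rw [hcc]; ring
    exact (ENNReal.mul_le_mul_iff_right (by simpa using hcc0) ENNReal.ofReal_ne_top).1 hl
  · intro G1 G2
    by_cases hG1 : G1 ∈ K
    swap
    · simp [hG1]
    by_cases hG2 : G2 ∈ K
    swap
    · simp [hG2]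
    rw [Set.indicator_of_mem hG1, Set.indicator_of_mem hG2]
    set M := (1/2:ℝ) • (G1 + G2) with hMd
    have c1 := hq_compare ν hν hn v δ B hδ hv hB hcond hm G1 M hG1.1 (m+p) (by omega) hG1.2.1
    have c2 := hq_compare ν hν hn v δ B hδ hv hB hcond hm G2 M hG2.1 (m-p) (by omega) hG2.2.2
    have q1 : ∑ i, (M i - G1 i) ⬝ᵥ (M i - G1 i) = ∑ i, ∑ j, ((G1 - G2) i j)^2/4 := by
      refine Finset.sum_congr rfl fun i _ => ?_
      unfold dotProduct
      refine Finset.sum_congr rfl fun j _ => ?_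
      simp [hMd]; ring
    have q2 : ∑ i, (M i - G2 i) ⬝ᵥ (M i - G2 i) = ∑ i, ∑ j, ((G1 - G2) i j)^2/4 := by
      refine Finset.sum_congr rfl fun i _ => ?_
      unfold dotProduct
      refine Finset.sum_congr rfl fun j _ => ?_
      simp [hMd]; ring
    rw [q1] at c1
    rw [q2] at c2
    set Q := ∑ i, ∑ j, ((G1 - G2) i j)^2/4 with hQ
    calc _ ≤ (ENNReal.ofReal (6 * Real.exp (Q/2)) * hq ν v (m+p) M) * (ENNReal.ofReal (6 * Real.exp (Q/2)) * hq ν v (m-p) M) := mul_le_mul' c1 c2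
      _ = (ENNReal.ofReal (6 * Real.exp (Q/2)) * ENNReal.ofReal (6 * Real.exp (Q/2))) * (hq ν v (m+p) M * hq ν v (m-p) M) := by ring
      _ ≤ (ENNReal.ofReal (6 * Real.exp (Q/2)) * ENNReal.ofReal (6 * Real.exp (Q/2))) * (ENNReal.ofReal (Real.exp (2*p^2/m)) * (hq ν v m M)^2) := by
          exact mul_le_mul_right (hq_pl ν hν v hv0 p hp M) _
      _ = _ := by
          rw [mul_pow, ← mul_assoc, ← mul_assoc]
          congr 1
          rw [← ENNReal.ofReal_mul (by positivity), ← ENNReal.ofReal_mul (by positivity), ← ENNReal.ofReal_pow (by positivity), ← ENNReal.ofReal_mul (by positivity)]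
          congr 1
          have e1 : Real.exp (2*p^2/m) = (Real.exp (p^2/m))^2 := by rw [← Real.exp_nat_mul]; congr 1; push_cast; ring
          have e2 : Real.exp Q = (Real.exp (Q/2))^2 := by rw [← Real.exp_nat_mul]; congr 1; push_cast; ring
          rw [e1, e2]; ring


lemma tail_lower (ρ : Measure ℝ) [IsProbabilityMeasure ρ] (h : PL ρ (fun _ => 0))
    (h2 : ∫⁻ s, ENNReal.ofReal (s^2) ∂ρ = 1) (h0 : ∫ s, s ∂ρ = 0) :
    ENNReal.ofReal (1/160000) ≤ ρ (Set.Ici (1/400)) := by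
  have h4 := mom4 ρ h h2.le
  have i2 : Integrable (fun s : ℝ => s^2) ρ := by
    refine ⟨by fun_prop, ?_⟩
    rw [hasFiniteIntegral_iff_ofReal (Filter.Eventually.of_forall fun s => sq_nonneg s), h2]
    exact ENNReal.one_lt_top
  have i4 : Integrable (fun s : ℝ => s^4) ρ := by
    refine ⟨by fun_prop, ?_⟩
    rw [hasFiniteIntegral_iff_ofReal (Filter.Eventually.of_forall fun s => by positivity)]
    exact lt_of_le_of_lt h4 (by norm_num)
  have i1 : Integrable (fun s : ℝ => s) ρ := by
    refine Integrable.mono' ((integrable_const (1:ℝ)).add i2) (by fun_prop) (Filter.Eventually.of_forall fun s => ?_)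
    simp only [Real.norm_eq_abs, Pi.add_apply]
    have := sq_abs s
    nlinarith [sq_nonneg (|s| - 1), abs_nonneg s]
  have ip : Integrable (fun s : ℝ => max s 0) ρ := i1.pos_part
  have e2 : ∫ s, s^2 ∂ρ = 1 := by
    rw [integral_eq_lintegral_of_nonneg_ae (Filter.Eventually.of_forall fun s => sq_nonneg s) (by fun_prop), h2]; simp
  have e4 : ∫ s, s^4 ∂ρ ≤ 1200 := by
    rw [integral_eq_lintegral_of_nonneg_ae (Filter.Eventually.of_forall fun s => by positivity) (by fun_prop)]
    exact ENNReal.toReal_le_of_le_ofReal (by norm_num) (h4.trans (by norm_num))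
  have s1 : ∫ s, s^2 ∂ρ ≤ ∫ s, (100 * max s 0 - 50 * s + 1/2500 * s^4) ∂ρ := by
    refine integral_mono i2 (((ip.const_mul _).sub (i1.const_mul _)).add (i4.const_mul _)) fun s => ?_
    simp only
    have ha : |s| = 2 * max s 0 - s := by
      rcases le_total s 0 with hs | hs
      · rw [max_eq_right hs, abs_of_nonpos hs]; ring
      · rw [max_eq_left hs, abs_of_nonneg hs]; ring
    have : s^2 ≤ 50 * |s| + 1/2500 * s^4 := by
      have hs2 := sq_abs s
      have hs4 : s^4 = (|s|^2)^2 := by rw [sq_abs]; ring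
      rw [hs4, ← hs2]
      have h0 := abs_nonneg s
      rcases le_total (|s|) 50 with hs | hs
      · nlinarith [sq_nonneg (|s|^2)]
      · have : 2500 ≤ |s|^2 := by nlinarith
        nlinarith
    linarith
  have j1 : Integrable (fun s : ℝ => 100 * max s 0 - 50 * s) ρ := (ip.const_mul _).sub (i1.const_mul _)
  have j2 : Integrable (fun s : ℝ => 1/400 + 1/800 * s^2) ρ := (integrable_const _).add (i2.const_mul _)
  rw [integral_add j1 (i4.const_mul _), integral_sub (ip.const_mul _) (i1.const_mul _),
    integral_const_mul, integral_const_mul, integral_const_mul, h0, e2] at s1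
  have hm : MeasurableSet (Set.Ici (1/400:ℝ)) := measurableSet_Ici
  have ii : Integrable ((Set.Ici (1/400:ℝ)).indicator (fun _ => (200:ℝ))) ρ := (integrable_const _).indicator hm
  have s2 : ∫ s, max s 0 ∂ρ ≤ ∫ s, (1/400 + 1/800 * s^2 + (Set.Ici (1/400:ℝ)).indicator (fun _ => (200:ℝ)) s) ∂ρ := by
    refine integral_mono ip (((integrable_const _).add (i2.const_mul _)).add ii) fun s => ?_
    simp only
    by_cases hs : s ∈ Set.Ici (1/400:ℝ)
    · rw [Set.indicator_of_mem hs]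
      have : max s 0 = s := max_eq_left (le_trans (by norm_num) hs)
      rw [this]
      nlinarith [sq_nonneg (s - 400)]
    · rw [Set.indicator_of_notMem hs]
      simp only [Set.mem_Ici, not_le] at hs
      have : max s 0 ≤ 1/400 := max_le hs.le (by norm_num)
      nlinarith [sq_nonneg s]
  rw [integral_add j2 ii, integral_add (integrable_const _) (i2.const_mul _),
    integral_const_mul, e2, integral_indicator_const _ hm, integral_const] at s2
  simp only [probReal_univ, smul_eq_mul] at s2
  rw [ENNReal.ofReal_le_iff_le_toReal (measure_ne_top _ _)]
  change _ ≤ ρ.real _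
  nlinarith


open scoped Matrix

/-- Gaussian kernel. -/
def gs {K : ℕ} (s : ℝ) (y : Fin K → ℝ) : ℝ := Real.exp (-(s * (y ⬝ᵥ y)))

lemma gs_cont {K : ℕ} (s : ℝ) : Continuous (gs (K := K) s) := by
  unfold gs dotProduct; fun_prop

lemma gs_pos {K : ℕ} (s : ℝ) (y : Fin K → ℝ) : 0 < gs s y := Real.exp_pos _

lemma gs_le_one {K : ℕ} (s : ℝ) (hs : 0 < s) (y : Fin K → ℝ) : gs s y ≤ 1 := by
  unfold gs
  rw [Real.exp_le_one_iff]
  have := dot_self_nonneg' y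
  have := mul_nonneg hs.le this
  linarith

lemma gs_lint {K : ℕ} (s : ℝ) (hs : 0 < s) :
    ∫⁻ y : Fin K → ℝ, ENNReal.ofReal (gs s y) = ENNReal.ofReal ((√(π/s))^K) := by
  have h1 : ∀ y : Fin K → ℝ, ENNReal.ofReal (gs s y) = ∏ i, ENNReal.ofReal (Real.exp (-s * (y i)^2)) := by
    intro y
    rw [← ENNReal.ofReal_prod_of_nonneg (fun i _ => (Real.exp_pos _).le), ← Real.exp_sum]
    unfold gs dotProduct
    congr 2
    rw [Finset.mul_sum, ← Finset.sum_neg_distrib]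
    refine Finset.sum_congr rfl fun i _ => by ring
  simp_rw [h1]
  rw [volume_pi, lint_pi volume K (fun _ t => ENNReal.ofReal (Real.exp (-s * t^2))) (fun i => by fun_prop)]
  rw [← ofReal_integral_eq_lintegral_ofReal (integrable_exp_neg_mul_sq hs) (Filter.Eventually.of_forall fun t => (Real.exp_pos _).le),
    integral_gaussian]
  rw [Finset.prod_const, Finset.card_univ, Fintype.card_fin, ENNReal.ofReal_pow (Real.sqrt_nonneg _)]

/-- Gaussian smoothing. -/
def ph {K : ℕ} (ρ : Measure (Fin K → ℝ)) (s : ℝ) (y : Fin K → ℝ) : ℝ := ∫ x, gs s (y - x) ∂ρ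

lemma ph_int {K : ℕ} (ρ : Measure (Fin K → ℝ)) [IsProbabilityMeasure ρ] (s : ℝ) (hs : 0 < s) (y : Fin K → ℝ) :
    Integrable (fun x => gs s (y - x)) ρ := by
  refine Integrable.mono' (integrable_const (1:ℝ)) ?_ (Filter.Eventually.of_forall fun x => ?_)
  · exact ((gs_cont s).comp (by fun_prop)).aestronglyMeasurable
  · rw [Real.norm_of_nonneg (gs_pos _ _).le]; exact gs_le_one s hs _

lemma ph_cont {K : ℕ} (ρ : Measure (Fin K → ℝ)) [IsProbabilityMeasure ρ] (s : ℝ) (hs : 0 < s) :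
    Continuous (ph ρ s) := by
  unfold ph
  refine continuous_of_dominated (bound := fun _ => 1) (fun y => (ph_int ρ s hs y).aestronglyMeasurable) ?_ (integrable_const _) ?_
  · intro y
    refine Filter.Eventually.of_forall fun x => ?_
    rw [Real.norm_of_nonneg (gs_pos _ _).le]; exact gs_le_one s hs _
  · refine Filter.Eventually.of_forall fun x => ?_
    exact (gs_cont s).comp (by fun_prop)

lemma ph_of {K : ℕ} (ρ : Measure (Fin K → ℝ)) [IsProbabilityMeasure ρ] (s : ℝ) (hs : 0 < s) (y : Fin K → ℝ) :
    ENNReal.ofReal (ph ρ s y) = ∫⁻ x, ENNReal.ofReal (gs s (y - x)) ∂ρ :=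
  ofReal_integral_eq_lintegral_ofReal (ph_int ρ s hs y) (Filter.Eventually.of_forall fun x => (gs_pos _ _).le)

lemma ph_nonneg {K : ℕ} (ρ : Measure (Fin K → ℝ)) (s : ℝ) (y : Fin K → ℝ) : 0 ≤ ph ρ s y :=
  integral_nonneg fun x => (gs_pos _ _).le

lemma ph_mid {K : ℕ} (ρ : Measure (Fin K → ℝ)) [IsProbabilityMeasure ρ] (hρ : PL ρ (fun _ => 0)) (s : ℝ) (hs : 0 < s)
    (y1 y2 : Fin K → ℝ) : ph ρ s y1 * ph ρ s y2 ≤ (ph ρ s ((1/2:ℝ) • (y1 + y2)))^2 := by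
  have hm : ∀ y : Fin K → ℝ, Measurable (fun x => ENNReal.ofReal (gs s (y - x))) := fun y =>
    ((gs_cont s).comp (continuous_const.sub continuous_id)).measurable.ennreal_ofReal
  have := hρ _ _ _ (hm y1) (hm y2) (hm ((1/2:ℝ) • (y1 + y2))) (by
    intro x1 x2
    rw [← ENNReal.ofReal_pow (gs_pos _ _).le, ← ENNReal.ofReal_mul (gs_pos _ _).le, ← ENNReal.ofReal_mul (Real.exp_pos _).le]
    apply ENNReal.ofReal_le_ofReal
    unfold gs
    rw [Real.exp_zero, one_mul, ← Real.exp_add, ← Real.exp_nat_mul]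
    apply Real.exp_le_exp.2
    have e : (1/2:ℝ) • (y1 + y2) - (1/2:ℝ) • (x1 + x2) = (1/2:ℝ) • ((y1 - x1) + (y2 - x2)) := by
      module
    rw [e]
    generalize y1 - x1 = a
    generalize y2 - x2 = b
    have h := dot_self_nonneg' (a - b)
    simp only [smul_dotProduct, dotProduct_smul, add_dotProduct, dotProduct_add, sub_dotProduct, dotProduct_sub, smul_eq_mul] at h ⊢
    rw [dotProduct_comm b a] at h ⊢
    push_cast
    nlinarith [mul_nonneg hs.le h])
  rw [← ph_of ρ s hs, ← ph_of ρ s hs, ← ph_of ρ s hs, ← ENNReal.ofReal_pow (ph_nonneg _ _ _), ← ENNReal.ofReal_mul (ph_nonneg _ _ _)] at this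
  exact (ENNReal.ofReal_le_ofReal_iff (by positivity)).1 this

lemma sep_mid {K : ℕ} (L : Set (Fin K → ℝ)) (hL : IsClosed L) (h0 : (0 : Fin K → ℝ) ∈ L)
    (hmid : ∀ x ∈ L, ∀ y ∈ L, (1/2:ℝ) • (x + y) ∈ L) (y0 : Fin K → ℝ) (hy0 : y0 ∉ L) :
    ∃ θ : Fin K → ℝ, θ ⬝ᵥ θ = 1 ∧ ∀ z ∈ L, z ⬝ᵥ θ < y0 ⬝ᵥ θ := by
  set F : (Fin K → ℝ) → ℝ := fun z => (y0 - z) ⬝ᵥ (y0 - z) with hF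
  have hFc : Continuous F := by rw [hF]; unfold dotProduct; fun_prop
  set R : ℝ := F 0 + 1 with hR
  have hF0 : 0 ≤ F 0 := dot_self_nonneg' _
  have hout : ∀ z, z ∉ Metric.closedBall y0 R → F 0 < F z := by
    intro z hz
    simp only [Metric.mem_closedBall, not_le] at hz
    have h1 : ‖y0 - z‖^2 ≤ F z := by
      have : ‖y0 - z‖ ≤ √(F z) := by
        rw [pi_norm_le_iff_of_nonneg (Real.sqrt_nonneg _)]
        intro i
        apply Real.le_sqrt_of_sq_le
        rw [Real.norm_eq_abs, sq_abs, hF]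
        simp only [dotProduct]
        rw [sq]
        exact Finset.single_le_sum (f := fun i => (y0 - z) i * (y0 - z) i) (fun i _ => mul_self_nonneg _) (Finset.mem_univ i)
      calc _ ≤ (√(F z))^2 := by gcongr
        _ = F z := Real.sq_sqrt (dot_self_nonneg' _)
    rw [dist_comm, dist_eq_norm] at hz
    nlinarith
  obtain ⟨q, hq, hqm⟩ := ((isCompact_closedBall y0 R).inter_left hL).exists_isMinOn (f := F) ⟨0, h0, by
    by_contra hc; exact lt_irrefl _ (hout 0 hc)⟩ hFc.continuousOn
  have hqL : q ∈ L := hq.1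
  have hqmin : ∀ z ∈ L, F q ≤ F z := by
    intro z hz
    by_cases hc : z ∈ Metric.closedBall y0 R
    · exact hqm ⟨hz, hc⟩
    · have h1 : F q ≤ F 0 := hqm ⟨h0, by by_contra hc; exact lt_irrefl _ (hout 0 hc)⟩
      exact h1.trans (hout z hc).le
  set w := y0 - q with hw
  have hw0 : 0 < w ⬝ᵥ w := by
    rcases (dot_self_nonneg' w).lt_or_eq with h | h
    · exact h
    · exfalso
      have : w = 0 := dotProduct_self_eq_zero.1 h.symm
      apply hy0
      rw [hw, sub_eq_zero] at this
      rw [this]; exact hqL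
  have hkey : ∀ z ∈ L, (z - q) ⬝ᵥ w ≤ 0 := by
    intro z hz
    have hk : ∀ k : ℕ, q + ((1/2:ℝ)^k) • (z - q) ∈ L := by
      intro k
      induction k with
      | zero => simpa using hz
      | succ k ih =>
        have := hmid _ hqL _ ih
        convert this using 1
        rw [pow_succ]
        module
    have h2 : ∀ k : ℕ, 2 * ((z - q) ⬝ᵥ w) ≤ (1/2:ℝ)^k * ((z - q) ⬝ᵥ (z - q)) := by
      intro k
      have h3 := hqmin _ (hk k)
      set ε : ℝ := (1/2:ℝ)^k with hε
      have hεp : 0 < ε := by positivity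
      simp only [hF] at h3
      have e : y0 - (q + ε • (z - q)) = w - ε • (z - q) := by rw [hw]; module
      rw [e, ← hw] at h3
      simp only [sub_dotProduct w, dotProduct_sub _ w, smul_dotProduct, dotProduct_smul, smul_eq_mul] at h3
      rw [dotProduct_comm w (z - q)] at h3
      have : ε * (2 * ((z - q) ⬝ᵥ w)) ≤ ε * (ε * ((z - q) ⬝ᵥ (z - q))) := by linarith
      exact le_of_mul_le_mul_left this hεp
    have hlim : Filter.Tendsto (fun k : ℕ => (1/2:ℝ)^k * ((z - q) ⬝ᵥ (z - q))) Filter.atTop (nhds (0 * ((z - q) ⬝ᵥ (z - q)))) :=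
      (tendsto_pow_atTop_nhds_zero_of_lt_one (by norm_num) (by norm_num)).mul_const _
    have := ge_of_tendsto' hlim h2
    linarith
  refine ⟨(√(w ⬝ᵥ w))⁻¹ • w, ?_, ?_⟩
  · rw [smul_dotProduct, dotProduct_smul, smul_eq_mul, smul_eq_mul, ← mul_assoc, ← mul_inv, Real.mul_self_sqrt hw0.le]
    field_simp
  · intro z hz
    rw [dotProduct_smul, dotProduct_smul, smul_eq_mul, smul_eq_mul]
    apply mul_lt_mul_of_pos_left _ (by positivity)
    have h1 := hkey z hz
    have e : y0 = q + w := by rw [hw]; module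
    rw [e, add_dotProduct]
    rw [sub_dotProduct] at h1
    linarith

lemma half_gauss {K : ℕ} (s : ℝ) (hs : 0 < s) (θ : Fin K → ℝ) :
    ∫⁻ y : Fin K → ℝ, ENNReal.ofReal (gs s y) ≤ 2 * ∫⁻ y in {y | 0 ≤ y ⬝ᵥ θ}, ENNReal.ofReal (gs s y) := by
  have hm : Measurable (fun y : Fin K → ℝ => ENNReal.ofReal (gs s y)) := (gs_cont s).measurable.ennreal_ofReal
  have hc : Continuous (fun y : Fin K → ℝ => y ⬝ᵥ θ) := by unfold dotProduct; fun_prop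
  have hS : MeasurableSet {y : Fin K → ℝ | 0 ≤ y ⬝ᵥ θ} := measurableSet_le measurable_const hc.measurable
  rw [← lintegral_indicator hS, two_mul]
  have e : ∫⁻ y : Fin K → ℝ, ({y : Fin K → ℝ | 0 ≤ y ⬝ᵥ θ}.indicator (fun y => ENNReal.ofReal (gs s y)) y)
      = ∫⁻ y : Fin K → ℝ, ({y : Fin K → ℝ | 0 ≤ y ⬝ᵥ θ}.indicator (fun y => ENNReal.ofReal (gs s y)) (-y)) :=
    ((Measure.measurePreserving_neg (volume : Measure (Fin K → ℝ))).lintegral_comp (hm.indicator hS)).symm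
  nth_rw 2 [e]
  rw [← lintegral_add_left (hm.indicator hS)]
  refine lintegral_mono fun y => ?_
  simp only
  have hneg : gs s (-y) = gs s y := by unfold gs; simp
  by_cases h : 0 ≤ y ⬝ᵥ θ
  · rw [Set.indicator_of_mem (show y ∈ {y : Fin K → ℝ | 0 ≤ y ⬝ᵥ θ} from h)]; exact le_self_add
  · have : -y ∈ {y : Fin K → ℝ | 0 ≤ y ⬝ᵥ θ} := by
      change 0 ≤ (-y) ⬝ᵥ θ
      rw [neg_dotProduct]; linarith
    rw [Set.indicator_of_mem this, hneg]; exact le_add_self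

lemma ph_half {K : ℕ} (ρ : Measure (Fin K → ℝ)) [IsProbabilityMeasure ρ] (s : ℝ) (hs : 0 < s) (θ : Fin K → ℝ) (c : ℝ) :
    ρ {x | c ≤ x ⬝ᵥ θ} * (∫⁻ y : Fin K → ℝ, ENNReal.ofReal (gs s y)) ≤
      2 * ∫⁻ y in {y | c ≤ y ⬝ᵥ θ}, ENNReal.ofReal (ph ρ s y) := by
  have hc : Continuous (fun y : Fin K → ℝ => y ⬝ᵥ θ) := by unfold dotProduct; fun_prop
  have hS : MeasurableSet {y : Fin K → ℝ | c ≤ y ⬝ᵥ θ} := measurableSet_le measurable_const hc.measurable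
  have hS0 : MeasurableSet {y : Fin K → ℝ | 0 ≤ y ⬝ᵥ θ} := measurableSet_le measurable_const hc.measurable
  simp_rw [ph_of ρ s hs]
  have hj : Measurable (fun p : (Fin K → ℝ) × (Fin K → ℝ) => ENNReal.ofReal (gs s (p.1 - p.2))) :=
    ((gs_cont s).comp (by fun_prop)).measurable.ennreal_ofReal
  rw [lintegral_lintegral_swap hj.aemeasurable]
  calc _ = ∫⁻ x in {x | c ≤ x ⬝ᵥ θ}, (∫⁻ y : Fin K → ℝ, ENNReal.ofReal (gs s y)) ∂ρ := by
        rw [setLIntegral_const, mul_comm]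
    _ ≤ ∫⁻ x in {x | c ≤ x ⬝ᵥ θ}, 2 * (∫⁻ y in {y | c ≤ y ⬝ᵥ θ}, ENNReal.ofReal (gs s (y - x))) ∂ρ := by
        refine setLIntegral_mono' hS fun x hx => ?_
        refine (half_gauss s hs θ).trans ?_
        refine mul_le_mul_right ?_ 2
        rw [← lintegral_indicator hS0, ← lintegral_indicator hS]
        rw [← lintegral_sub_right_eq_self _ x]
        refine lintegral_mono fun y => ?_
        simp only
        by_cases h : y - x ∈ {y : Fin K → ℝ | 0 ≤ y ⬝ᵥ θ}
        · rw [Set.indicator_of_mem h, Set.indicator_of_mem]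
          change 0 ≤ (y - x) ⬝ᵥ θ at h
          change c ≤ x ⬝ᵥ θ at hx
          change c ≤ y ⬝ᵥ θ
          rw [sub_dotProduct] at h; linarith
        · rw [Set.indicator_of_notMem h]; exact zero_le
    _ ≤ ∫⁻ x, 2 * (∫⁻ y in {y | c ≤ y ⬝ᵥ θ}, ENNReal.ofReal (gs s (y - x))) ∂ρ := setLIntegral_le_lintegral _ _
    _ = _ := by
        rw [lintegral_const_mul]
        exact Measurable.lintegral_prod_left' hj

lemma ph_total {K : ℕ} (ρ : Measure (Fin K → ℝ)) [IsProbabilityMeasure ρ] (s : ℝ) (hs : 0 < s) :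
    ∫⁻ y, ENNReal.ofReal (ph ρ s y) = ∫⁻ y : Fin K → ℝ, ENNReal.ofReal (gs s y) := by
  have hj : Measurable (fun p : (Fin K → ℝ) × (Fin K → ℝ) => ENNReal.ofReal (gs s (p.1 - p.2))) :=
    ((gs_cont s).comp (by fun_prop)).measurable.ennreal_ofReal
  simp_rw [ph_of ρ s hs]
  rw [lintegral_lintegral_swap hj.aemeasurable]
  simp_rw [lintegral_sub_right_eq_self (fun y : Fin K → ℝ => ENNReal.ofReal (gs s y))]
  simp

lemma scale_half {K : ℕ} (F : (Fin K → ℝ) → ℝ≥0∞) (hF : Measurable F) :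
    ∫⁻ y, F ((1/2:ℝ) • y) = 2^K * ∫⁻ y, F y := by
  have h := Measure.map_addHaar_smul (volume : Measure (Fin K → ℝ)) (r := (1/2:ℝ)) (by norm_num)
  rw [← lintegral_map (f := F) (g := fun y : Fin K → ℝ => (1/2:ℝ) • y) hF (by fun_prop)]
  rw [h, lintegral_smul_measure]
  simp

lemma le_of_sq_le_sqD {a b : ℝ} (h : a^2 ≤ b^2) (hb : 0 ≤ b) : a ≤ b := by
  exact le_of_abs_le (by simpa [abs_of_nonneg hb] using sq_le_sq.1 h)

lemma density_bound {K : ℕ} (hK : 1 ≤ K) (ρ : Measure (Fin K → ℝ)) [IsProbabilityMeasure ρ] (hρ : PL ρ (fun _ => 0))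
    (h1 : ∀ θ : Fin K → ℝ, ∫ y, y ⬝ᵥ θ ∂ρ = 0)
    (h2 : ∀ θ : Fin K → ℝ, ∫⁻ y, ENNReal.ofReal ((y ⬝ᵥ θ)^2) ∂ρ = ENNReal.ofReal (θ ⬝ᵥ θ)) (s : ℝ) (hs : 0 < s) :
    ∫⁻ y, ENNReal.ofReal (Real.exp (-(s * (y ⬝ᵥ y)))) ∂ρ ≤ ENNReal.ofReal ((300000000000000 * K / √s)^K) := by
  have hK0 : (0:ℝ) < K := by exact_mod_cast hK
  set c1 : ℝ := 1/400000 with hc1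
  set τ : ℝ := (c1 / 2^K)^2 with hτ
  have hτ0 : 0 < τ := by positivity
  have hτ1 : τ ≤ 1 := by
    rw [hτ, sq_le_one_iff₀ (by positivity), div_le_one (by positivity), hc1]
    have : (1:ℝ) ≤ 2^K := one_le_pow₀ (by norm_num)
    linarith
  set φ := ph ρ s with hφ
  have hφ0 : ∀ y, 0 ≤ φ y := fun y => ph_nonneg _ _ _
  have hφm : Measurable φ := (ph_cont ρ s hs).measurable
  set G := ∫⁻ y : Fin K → ℝ, ENNReal.ofReal (gs s y) with hG
  have hGe : G = ENNReal.ofReal ((√(π/s))^K) := gs_lint s hs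
  have hGpos : G ≠ 0 := by rw [hGe]; simp only [ne_eq, ENNReal.ofReal_eq_zero, not_le]; positivity
  have hGtop : G ≠ ∞ := by rw [hGe]; exact ENNReal.ofReal_ne_top
  set L : Set (Fin K → ℝ) := {y | τ * φ 0 ≤ φ y} with hL
  have hLc : IsClosed L := isClosed_le continuous_const (ph_cont ρ s hs)
  have h0L : (0 : Fin K → ℝ) ∈ L := by
    change τ * φ 0 ≤ φ 0
    nlinarith [hφ0 0]
  have hmid : ∀ x ∈ L, ∀ y ∈ L, (1/2:ℝ) • (x + y) ∈ L := by
    intro x hx y hy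
    change τ * φ 0 ≤ φ x at hx
    change τ * φ 0 ≤ φ y at hy
    change τ * φ 0 ≤ φ _
    have := ph_mid ρ hρ s hs x y
    have h3 : (τ * φ 0)^2 ≤ (φ ((1/2:ℝ) • (x + y)))^2 := by
      refine le_trans ?_ this
      rw [sq]
      exact mul_le_mul hx hy (mul_nonneg hτ0.le (hφ0 _)) (hφ0 _)
    exact le_of_sq_le_sqD h3 (hφ0 _)
  have hLm : MeasurableSet L := hLc.measurableSet
  have hcompl : ∫⁻ y in Lᶜ, ENNReal.ofReal (φ y) ≤ ENNReal.ofReal c1 * G := by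
    calc _ ≤ ∫⁻ y in Lᶜ, ENNReal.ofReal (c1 / 2^K) * ENNReal.ofReal (φ ((1/2:ℝ) • y)) := by
          refine setLIntegral_mono' hLm.compl fun y hy => ?_
          rw [← ENNReal.ofReal_mul (by positivity)]
          apply ENNReal.ofReal_le_ofReal
          have hy' : φ y < τ * φ 0 := not_le.1 hy
          have h3 := ph_mid ρ hρ s hs y 0
          rw [add_zero] at h3
          refine le_of_sq_le_sqD ?_ (mul_nonneg (by positivity) (hφ0 _))
          rw [mul_pow, ← hτ]
          calc (φ y)^2 = φ y * φ y := sq _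
            _ ≤ (τ * φ 0) * φ y := mul_le_mul_of_nonneg_right hy'.le (hφ0 _)
            _ = τ * (φ y * φ 0) := by ring
            _ ≤ _ := mul_le_mul_of_nonneg_left h3 hτ0.le
      _ ≤ ∫⁻ y, ENNReal.ofReal (c1 / 2^K) * ENNReal.ofReal (φ ((1/2:ℝ) • y)) := setLIntegral_le_lintegral _ _
      _ = ENNReal.ofReal (c1 / 2^K) * (2^K * ∫⁻ y, ENNReal.ofReal (φ y)) := by
          rw [lintegral_const_mul _ (by fun_prop), scale_half (fun y => ENNReal.ofReal (φ y)) (by fun_prop)]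
      _ = ENNReal.ofReal c1 * G := by
          rw [hφ, ph_total ρ s hs, ← hG, ← mul_assoc]
          congr 1
          rw [show (2:ℝ≥0∞)^K = ENNReal.ofReal (2^K) by rw [ENNReal.ofReal_pow (by norm_num)]; simp,
            ← ENNReal.ofReal_mul (by positivity)]
          congr 1
          field_simp
  have hball : ∀ y0 : Fin K → ℝ, y0 ⬝ᵥ y0 ≤ (1/400)^2 → y0 ∈ L := by
    intro y0 hy0
    by_contra hc
    obtain ⟨θ, hθ, hsep⟩ := sep_mid L hLc h0L hmid y0 hc
    have hyθ : y0 ⬝ᵥ θ ≤ 1/400 := by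
      have h := dot_self_nonneg' (y0 - (1/400:ℝ) • θ)
      simp only [sub_dotProduct, dotProduct_sub, smul_dotProduct, dotProduct_smul, smul_eq_mul, hθ] at h
      rw [dotProduct_comm θ y0] at h
      linarith
    have hsub : {y : Fin K → ℝ | 1/400 ≤ y ⬝ᵥ θ} ⊆ Lᶜ := by
      intro y hy hyL
      have := hsep y hyL
      change 1/400 ≤ y ⬝ᵥ θ at hy
      linarith
    have hc : Continuous (fun y : Fin K → ℝ => y ⬝ᵥ θ) := by unfold dotProduct; fun_prop
    have hpr : IsProbabilityMeasure (ρ.map (fun y => y ⬝ᵥ θ)) := Measure.isProbabilityMeasure_map hc.measurable.aemeasurable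
    have ht := tail_lower (ρ.map (fun y => y ⬝ᵥ θ)) (hρ.map _ hc.measurable (by
      intro x y; simp only [smul_dotProduct, add_dotProduct, smul_eq_mul]) (by simp)) (by
      rw [lintegral_map (by fun_prop) hc.measurable, h2, hθ]; simp) (by
      rw [integral_map hc.measurable.aemeasurable (by fun_prop), h1])
    rw [Measure.map_apply hc.measurable measurableSet_Ici] at ht
    have h5 := ph_half ρ s hs θ (1/400)
    have h6 : ENNReal.ofReal (1/160000) * G ≤ 2 * (ENNReal.ofReal c1 * G) := by
      calc _ ≤ ρ {x | 1/400 ≤ x ⬝ᵥ θ} * G := by gcongr; exact ht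
        _ ≤ _ := h5
        _ ≤ _ := by
          refine mul_le_mul_right ?_ 2
          exact (lintegral_mono_set hsub).trans hcompl
    rw [← mul_assoc, ENNReal.mul_le_mul_iff_left hGpos hGtop, show (2:ℝ≥0∞) = ENNReal.ofReal 2 by simp, ← ENNReal.ofReal_mul (by norm_num),
      ENNReal.ofReal_le_ofReal_iff (by positivity), hc1] at h6
    norm_num at h6
  set Q : Set (Fin K → ℝ) := Set.univ.pi (fun _ => Set.Icc (-(1/(400*K))) (1/(400*(K:ℝ)))) with hQ
  have hQL : Q ⊆ L := by
    intro y hy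
    apply hball
    unfold dotProduct
    calc ∑ i, y i * y i ≤ ∑ i : Fin K, (1/(400*(K:ℝ)))^2 := by
          refine Finset.sum_le_sum fun i _ => ?_
          have := hy i (Set.mem_univ i)
          rw [← sq]
          exact sq_le_sq' this.1 this.2
      _ = K * (1/(400*(K:ℝ)))^2 := by simp
      _ = (1/400)^2 * (1/K) := by field_simp
      _ ≤ (1/400)^2 * 1 := by
          gcongr
          rw [div_le_one hK0]; exact_mod_cast hK
      _ = _ := mul_one _
  have hvQ : volume Q = ENNReal.ofReal ((1/(200*(K:ℝ)))^K) := by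
    rw [hQ, volume_pi_pi]
    simp only [Real.volume_Icc, Finset.prod_const, Finset.card_univ, Fintype.card_fin]
    rw [ENNReal.ofReal_pow (by positivity)]
    congr 2
    field_simp; norm_num
  have hfin : ENNReal.ofReal (τ * φ 0) * ENNReal.ofReal ((1/(200*(K:ℝ)))^K) ≤ ENNReal.ofReal ((√(π/s))^K) := by
    rw [← hGe, ← hvQ, ← setLIntegral_const, hG, ← ph_total ρ s hs]
    refine le_trans ?_ (setLIntegral_le_lintegral Q _)
    have hQm : MeasurableSet Q := MeasurableSet.univ_pi fun _ => measurableSet_Icc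
    refine setLIntegral_mono' hQm fun y hy => ?_
    exact ENNReal.ofReal_le_ofReal (hQL hy)
  rw [← ENNReal.ofReal_mul (mul_nonneg hτ0.le (hφ0 _)), ENNReal.ofReal_le_ofReal_iff (by positivity)] at hfin
  have hphi : ∫⁻ y, ENNReal.ofReal (Real.exp (-(s * (y ⬝ᵥ y)))) ∂ρ = ENNReal.ofReal (φ 0) := by
    rw [hφ, ph_of ρ s hs]
    refine lintegral_congr fun y => ?_
    unfold gs; simp
  rw [hphi]
  apply ENNReal.ofReal_le_ofReal
  have hpi : √(π/s) ≤ 1.8 / √s := by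
    rw [Real.sqrt_div' _ hs.le]
    gcongr
    rw [Real.sqrt_le_left (by norm_num)]
    have := Real.pi_lt_d2
    norm_num at this ⊢
    linarith
  have hE : (√(π/s))^K ≤ (1.8 / √s)^K := pow_le_pow_left₀ (Real.sqrt_nonneg _) hpi K
  have h16 : (160000000000:ℝ) ≤ (160000000000)^K := le_self_pow₀ (by norm_num) (by omega)
  have hss : 0 < √s := Real.sqrt_pos.2 hs
  have e1 : φ 0 = 160000000000 * (800 * K)^K * (τ * φ 0 * (1/(200*(K:ℝ)))^K) := by
    have e2 : (800 * (K:ℝ))^K * (1/(200*(K:ℝ)))^K = (2^K)^2 := by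
      rw [← mul_pow, ← pow_mul, mul_comm K 2, pow_mul]
      congr 1
      field_simp; norm_num
    calc φ 0 = 160000000000 * (2^K)^2 * (τ * φ 0) := by
          rw [hτ, hc1]; field_simp; norm_num
      _ = _ := by rw [← e2]; ring
  rw [e1]
  calc _ ≤ 160000000000 * (800 * (K:ℝ))^K * (1.8 / √s)^K := by
        gcongr
        exact hfin.trans hE
    _ ≤ (160000000000)^K * (800 * (K:ℝ))^K * (1.8 / √s)^K := by gcongr
    _ = (160000000000 * (800 * (K:ℝ)) * (1.8 / √s))^K := by rw [← mul_pow, ← mul_pow]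
    _ ≤ _ := by
        apply pow_le_pow_left₀ (by positivity)
        rw [mul_div_assoc', div_le_div_iff_of_pos_right hss]
        nlinarith


lemma birk {n : ℕ} (K : ℕ) (hK : 1 ≤ K) (hKn : K < n) (μ : Fin n → ℝ) (h0 : ∀ j, 0 ≤ μ j) (h1 : ∀ j, μ j ≤ 1)
    (hsum : ∑ j, μ j = K) :
    ∃ w : Equiv.Perm (Fin n) → ℝ, (∀ σ, 0 ≤ w σ) ∧ ∑ σ, w σ = 1 ∧
      ∀ a : Fin n → ℝ, ∑ j, μ j * a j = ∑ σ, w σ * ∑ i : Fin K, a (σ (Fin.castLE hKn.le i)) := by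
  classical
  have hK0 : (0:ℝ) < K := by exact_mod_cast hK
  have hnK : (0:ℝ) < n - K := by
    have : (K:ℝ) < n := by exact_mod_cast hKn
    linarith
  set M : Matrix (Fin n) (Fin n) ℝ := fun i j => if i.val < K then μ j / K else (1 - μ j) / (n - K) with hM
  have hsplit : ∀ F : Fin n → ℝ, ∑ i, (if i.val < K then F i else 0) = ∑ i : Fin K, F (Fin.castLE hKn.le i) := by
    intro F
    rw [← Finset.sum_filter]
    symm
    refine Finset.sum_bij (fun i _ => Fin.castLE hKn.le i) ?_ ?_ ?_ ?_
    · intro i _; simp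
    · intro i _ j _ h; simpa using h
    · intro i hi
      simp only [Finset.mem_filter, Finset.mem_univ, true_and] at hi
      exact ⟨⟨i.val, hi⟩, Finset.mem_univ _, by ext; simp⟩
    · intro i _; rfl
  have hcount : ∑ i : Fin n, (if i.val < K then (1:ℝ) else 0) = K := by
    rw [hsplit (fun _ => 1)]; simp
  have hMd : M ∈ doublyStochastic ℝ (Fin n) := by
    rw [mem_doublyStochastic_iff_sum]
    refine ⟨?_, ?_, ?_⟩
    · intro i j
      simp only [hM]
      split_ifs
      · exact div_nonneg (h0 j) hK0.le
      · exact div_nonneg (by linarith [h1 j]) hnK.le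
    · intro i
      simp only [hM]
      split_ifs
      · rw [← Finset.sum_div, hsum, div_self hK0.ne']
      · rw [← Finset.sum_div, Finset.sum_sub_distrib, hsum]
        simp only [Finset.sum_const, Finset.card_univ, Fintype.card_fin, nsmul_eq_mul, mul_one]
        rw [div_self hnK.ne']
    · intro j
      have : ∀ i : Fin n, M i j = (1 - μ j) / (n - K) + (if i.val < K then (1:ℝ) else 0) * (μ j / K - (1 - μ j) / (n - K)) := by
        intro i
        simp only [hM]
        split_ifs <;> ring
      simp_rw [this]
      rw [Finset.sum_add_distrib, ← Finset.sum_mul, hcount]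
      simp only [Finset.sum_const, Finset.card_univ, Fintype.card_fin, nsmul_eq_mul]
      field_simp
      ring
  obtain ⟨w, hw0, hw1, hw⟩ := exists_eq_sum_perm_of_mem_doublyStochastic hMd
  refine ⟨w, hw0, hw1, fun a => ?_⟩
  have hmu : ∀ j, μ j = ∑ i : Fin n, (if i.val < K then M i j else 0) := by
    intro j
    have : ∀ i : Fin n, (if i.val < K then M i j else 0) = (if i.val < K then (1:ℝ) else 0) * (μ j / K) := by
      intro i
      simp only [hM]
      split_ifs <;> simp
    simp_rw [this]
    rw [← Finset.sum_mul, hcount]; field_simp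
  have hMa : ∀ i, ∑ j, M i j * a j = ∑ σ, w σ * a (σ i) := by
    intro i
    rw [← hw]
    simp only [Matrix.sum_apply, Matrix.smul_apply, smul_eq_mul, Finset.sum_mul]
    rw [Finset.sum_comm]
    refine Finset.sum_congr rfl fun σ _ => ?_
    simp only [Equiv.Perm.permMatrix, PEquiv.toMatrix_apply, Equiv.toPEquiv_apply, Option.mem_def, Option.some.injEq]
    simp [mul_assoc]
  calc ∑ j, μ j * a j = ∑ j, ∑ i : Fin n, (if i.val < K then M i j * a j else 0) := by
        refine Finset.sum_congr rfl fun j _ => ?_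
        rw [hmu j, Finset.sum_mul]
        refine Finset.sum_congr rfl fun i _ => ?_
        split_ifs <;> simp
    _ = ∑ i : Fin n, (if i.val < K then ∑ σ, w σ * a (σ i) else 0) := by
        rw [Finset.sum_comm]
        refine Finset.sum_congr rfl fun i _ => ?_
        split_ifs with h
        · exact hMa i
        · simp
    _ = ∑ i : Fin K, ∑ σ, w σ * a (σ (Fin.castLE hKn.le i)) := hsplit (fun i => ∑ σ, w σ * a (σ i))
    _ = _ := by
        rw [Finset.sum_comm]
        refine Finset.sum_congr rfl fun σ _ => ?_
        rw [Finset.mul_sum]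

lemma svd_sum {n : ℕ} (A : Matrix (Fin n) (Fin n) ℝ) :
    ∃ (u : OrthonormalBasis (Fin n) ℝ (EuclideanSpace ℝ (Fin n))) (l : Fin n → ℝ), (∀ j, 0 ≤ l j) ∧ (∀ j, l j ≤ opNorm A ^ 2) ∧
      ∑ j, l j = hsNorm A ^ 2 ∧ ∀ x, ‖mApp A x‖^2 = ∑ j, l j * ⟪u j, x⟫^2 := by
  set T := Matrix.toEuclideanLin A with hT
  set S := LinearMap.adjoint T ∘ₗ T with hS
  have hSy : S.IsSymmetric := by
    intro x y
    simp only [hS, LinearMap.comp_apply]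
    rw [LinearMap.adjoint_inner_left, LinearMap.adjoint_inner_right]
  have hfr : Module.finrank ℝ (EuclideanSpace ℝ (Fin n)) = n := by simp
  set u := hSy.eigenvectorBasis hfr with hu
  set ev := hSy.eigenvalues hfr with hev
  have hSu : ∀ j, S (u j) = ev j • u j := fun j => hSy.apply_eigenvectorBasis hfr j
  have hTS : ∀ x, ‖T x‖^2 = ⟪x, S x⟫ := by
    intro x
    simp only [hS, LinearMap.comp_apply]
    rw [LinearMap.adjoint_inner_right, real_inner_self_eq_norm_sq]
  have hl : ∀ j, ev j = ‖T (u j)‖^2 := by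
    intro j
    rw [hTS, hSu, inner_smul_right, real_inner_self_eq_norm_sq, u.norm_eq_one]; simp
  refine ⟨u, ev, ?_, ?_, ?_, ?_⟩
  · intro j; rw [hl]; positivity
  · intro j
    rw [hl]
    have := (LinearMap.toContinuousLinearMap T).le_opNorm (u j)
    rw [u.norm_eq_one, mul_one] at this
    exact pow_le_pow_left₀ (norm_nonneg _) this 2
  · have h1 := LinearMap.trace_eq_sum_inner S u
    have h2 := LinearMap.trace_eq_sum_inner S (EuclideanSpace.basisFun (Fin n) ℝ)
    have h3 : ∑ j, ev j = ∑ i, ⟪u i, S (u i)⟫ := by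
      refine Finset.sum_congr rfl fun j _ => ?_
      rw [hl, hTS]
    rw [h3, ← h1, h2]
    simp_rw [← hTS]
    unfold hsNorm
    rw [Real.sq_sqrt (by positivity), Finset.sum_comm]
    refine Finset.sum_congr rfl fun j _ => ?_
    rw [EuclideanSpace.real_norm_sq_eq]
    refine Finset.sum_congr rfl fun i _ => ?_
    simp [hT, Matrix.toEuclideanLin_apply]
  · intro x
    change ‖T x‖^2 = _
    rw [hTS, ← u.sum_inner_mul_inner]
    refine Finset.sum_congr rfl fun j _ => ?_
    rw [show ⟪u j, S x⟫ = ⟪S (u j), x⟫ from (hSy _ _).symm, hSu, inner_smul_left, real_inner_comm x]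
    simp; ring

lemma neg_lap {n : ℕ} {Ω : Type} [MeasurableSpace Ω] (P : Measure Ω) [IsProbabilityMeasure P]
    (X : Ω → EuclideanSpace ℝ (Fin n)) (hX : Measurable X) (hPL : PL (P.map X) (fun _ => 0))
    (h1 : ∀ θ, ∫ ω, ⟪X ω, θ⟫ ∂P = 0)
    (h2 : ∀ θ, ∫⁻ ω, ENNReal.ofReal (⟪X ω, θ⟫^2) ∂P = ENNReal.ofReal (‖θ‖^2))
    (A : Matrix (Fin n) (Fin n) ℝ) (hA : hsNorm A ^ 2 = n) (K : ℕ) (hK : 1 ≤ K) (hn : 1 ≤ n) (hKA : 2 * K * opNorm A ^ 2 ≤ n)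
    (t : ℝ) (ht : 0 < t) :
    ∫⁻ ω, ENNReal.ofReal (Real.exp (-(t * (‖mApp A (X ω)‖^2 / n)))) ∂P ≤ ENNReal.ofReal ((300000000000000 * K / √(t/K))^K) := by
  obtain ⟨u, l, hl0, hl1, hls, hlx⟩ := svd_sum A
  have hn0 : (0:ℝ) < n := by exact_mod_cast hn
  have hK0 : (0:ℝ) < K := by exact_mod_cast hK
  rw [hA] at hls
  have hop : 1 ≤ opNorm A ^ 2 := by
    have : (n:ℝ) ≤ n * opNorm A ^ 2 := by
      calc (n:ℝ) = ∑ j, l j := hls.symm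
        _ ≤ ∑ j : Fin n, opNorm A ^ 2 := Finset.sum_le_sum fun j _ => hl1 j
        _ = _ := by simp
    by_contra hc
    push Not at hc
    nlinarith
  have hKn : K < n := by
    have : (K:ℝ) < n := by nlinarith
    exact_mod_cast this
  obtain ⟨w, hw0, hw1, hw⟩ := birk K hK hKn (fun j => K * l j / n) (fun j => by have := hl0 j; positivity)
    (fun j => by
      rw [div_le_one hn0]
      have := hl1 j
      nlinarith) (by rw [← Finset.sum_div, ← Finset.mul_sum, hls]; field_simp)
  have hs : 0 < t / K := by positivity
  have hX' : ∀ θ : EuclideanSpace ℝ (Fin n), Measurable (fun ω => ⟪θ, X ω⟫) := fun θ => by fun_prop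
  have hpt : ∀ ω, ENNReal.ofReal (Real.exp (-(t * (‖mApp A (X ω)‖^2 / n)))) ≤
      ∑ σ, ENNReal.ofReal (w σ) * ENNReal.ofReal (Real.exp (-(t/K * ∑ i : Fin K, ⟪u (σ (Fin.castLE hKn.le i)), X ω⟫^2))) := by
    intro ω
    have e : -(t * (‖mApp A (X ω)‖^2 / n)) = ∑ σ, w σ • (-(t/K * ∑ i : Fin K, ⟪u (σ (Fin.castLE hKn.le i)), X ω⟫^2)) := by
      have := hw (fun j => ⟪u j, X ω⟫^2)
      rw [hlx]
      simp only [smul_eq_mul, mul_neg, Finset.sum_neg_distrib]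
      congr 1
      have e2 : ∀ σ, w σ * (t/K * ∑ i : Fin K, ⟪u (σ (Fin.castLE hKn.le i)), X ω⟫^2) =
        t/K * (w σ * ∑ i : Fin K, ⟪u (σ (Fin.castLE hKn.le i)), X ω⟫^2) := fun σ => by ring
      simp_rw [e2]
      rw [← Finset.mul_sum, ← this, Finset.sum_div, Finset.mul_sum, Finset.mul_sum]
      refine Finset.sum_congr rfl fun j _ => ?_
      field_simp
    rw [e]
    refine (ENNReal.ofReal_le_ofReal (convexOn_exp.map_sum_le (fun σ _ => hw0 σ) hw1 (fun _ _ => Set.mem_univ _))).trans ?_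
    simp only [smul_eq_mul]
    rw [ENNReal.ofReal_sum_of_nonneg (fun σ _ => mul_nonneg (hw0 σ) (Real.exp_pos _).le)]
    refine Finset.sum_le_sum fun σ _ => ?_
    rw [ENNReal.ofReal_mul (hw0 σ)]
  refine (lintegral_mono hpt).trans ?_
  rw [lintegral_finsetSum' _ (fun σ _ => by fun_prop)]
  have hσ : ∀ σ : Equiv.Perm (Fin n), ∫⁻ ω, ENNReal.ofReal (Real.exp (-(t/K * ∑ i : Fin K, ⟪u (σ (Fin.castLE hKn.le i)), X ω⟫^2))) ∂P
      ≤ ENNReal.ofReal ((300000000000000 * K / √(t/K))^K) := by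
    intro σ
    set Y : EuclideanSpace ℝ (Fin n) → (Fin K → ℝ) := fun x i => ⟪u (σ (Fin.castLE hKn.le i)), x⟫ with hY
    have hYm : Measurable Y := by fun_prop
    set ρ := (P.map X).map Y with hρ
    have i1 : IsProbabilityMeasure (P.map X) := Measure.isProbabilityMeasure_map hX.aemeasurable
    have i2 : IsProbabilityMeasure ρ := Measure.isProbabilityMeasure_map hYm.aemeasurable
    have hdot : ∀ (x : EuclideanSpace ℝ (Fin n)) (θ : Fin K → ℝ), Y x ⬝ᵥ θ = ⟪x, ∑ i, θ i • u (σ (Fin.castLE hKn.le i))⟫ := by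
      intro x θ
      rw [inner_sum]
      unfold dotProduct
      refine Finset.sum_congr rfl fun i _ => ?_
      rw [inner_smul_right, real_inner_comm, mul_comm]
    have hnorm : ∀ θ : Fin K → ℝ, ‖∑ i, θ i • u (σ (Fin.castLE hKn.le i))‖^2 = θ ⬝ᵥ θ := by
      intro θ
      have ho : Orthonormal ℝ (fun i : Fin K => u (σ (Fin.castLE hKn.le i))) :=
        u.orthonormal.comp _ (σ.injective.comp (Fin.castLE_injective hKn.le))
      rw [← real_inner_self_eq_norm_sq, ho.inner_sum]
      simp [dotProduct]
    have hc : ∀ θ : Fin K → ℝ, Measurable (fun y : Fin K → ℝ => y ⬝ᵥ θ) := fun θ => by unfold dotProduct; fun_prop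
    have hb := density_bound hK ρ (hPL.map Y hYm (by
      intro x y; funext i
      simp only [hY, Pi.smul_apply, Pi.add_apply, inner_smul_right, inner_add_right, smul_eq_mul]) (by simp)) (by
      intro θ
      rw [hρ, integral_map hYm.aemeasurable (hc θ).aestronglyMeasurable]
      simp_rw [hdot]
      rw [integral_map hX.aemeasurable (by fun_prop)]
      exact h1 _) (by
      intro θ
      have hc' := hc θ
      rw [hρ, lintegral_map (by fun_prop) hYm, lintegral_map (by fun_prop) hX]
      simp_rw [hdot]
      rw [h2, hnorm]) (t/K) hs
    refine le_trans (le_of_eq ?_) hb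
    have hc2 : Measurable (fun y : Fin K → ℝ => y ⬝ᵥ y) := by unfold dotProduct; fun_prop
    rw [hρ, lintegral_map (by fun_prop) hYm, lintegral_map (by fun_prop) hX]
    refine lintegral_congr fun ω => ?_
    simp only [hY, dotProduct, sq]
  calc _ ≤ ∑ σ, ENNReal.ofReal (w σ) * ENNReal.ofReal ((300000000000000 * K / √(t/K))^K) := by
        refine Finset.sum_le_sum fun σ _ => ?_
        rw [lintegral_const_mul _ (by fun_prop)]
        exact mul_le_mul_right (hσ σ) _
    _ = _ := by
        rw [← Finset.sum_mul, ← ENNReal.ofReal_sum_of_nonneg (fun σ _ => hw0 σ), hw1]; simp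


lemma neg_mom {Ω : Type} [MeasurableSpace Ω] (P : Measure Ω) [IsProbabilityMeasure P] (U : Ω → ℝ) (hU : Measurable U)
    (hU0 : ∀ ω, 0 ≤ U ω) (M : ℕ) (T : ℝ) (hT : 0 < T)
    (hL : ∀ t : ℝ, 0 < t → ∫⁻ ω, ENNReal.ofReal (Real.exp (-(t * U ω))) ∂P ≤ ENNReal.ofReal ((T/t)^(M+2))) :
    (∀ᵐ ω ∂P, 0 < U ω) ∧ ∫⁻ ω, ENNReal.ofReal ((U ω)⁻¹^(M+1)) ∂P ≤ ENNReal.ofReal (2 * T^(M+1)) := by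
  have hpos : ∀ᵐ ω ∂P, 0 < U ω := by
    have hz : P {ω | ¬ 0 < U ω} = 0 := by
      have hb : ∀ t : ℝ, 0 < t → P {ω | ¬ 0 < U ω} ≤ ENNReal.ofReal ((T/t)^(M+2)) := by
        intro t ht
        refine le_trans ?_ (hL t ht)
        have hm : MeasurableSet {ω | ¬ 0 < U ω} := (measurableSet_lt measurable_const hU).compl
        calc P {ω | ¬ 0 < U ω} = ∫⁻ ω in {ω | ¬ 0 < U ω}, 1 ∂P := by simp
          _ ≤ ∫⁻ ω in {ω | ¬ 0 < U ω}, ENNReal.ofReal (Real.exp (-(t * U ω))) ∂P := by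
              refine setLIntegral_mono' hm fun ω hω => ?_
              have : U ω = 0 := le_antisymm (not_lt.1 hω) (hU0 ω)
              rw [this]; simp
          _ ≤ _ := setLIntegral_le_lintegral _ _
      have hlim : Filter.Tendsto (fun t : ℝ => ENNReal.ofReal ((T/t)^(M+2))) Filter.atTop (nhds (ENNReal.ofReal (0^(M+2)))) := by
        refine ENNReal.tendsto_ofReal (Filter.Tendsto.pow ?_ _)
        exact Filter.Tendsto.div_atTop tendsto_const_nhds Filter.tendsto_id
      have := ge_of_tendsto hlim (Filter.eventually_atTop.2 ⟨1, fun t ht => hb t (by linarith)⟩)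
      simpa using this
    exact hz
  refine ⟨hpos, ?_⟩
  have hgam : ∀ r : ℝ, 0 < r → ENNReal.ofReal (r⁻¹^(M+1)) ≤ ∫⁻ t in Set.Ioi (0:ℝ), ENNReal.ofReal (t^M * Real.exp (-(t * r))) := by
    intro r hr
    have h := Real.integral_rpow_mul_exp_neg_mul_Ioi (a := (M:ℝ) + 1) (r := r) (by positivity) hr
    simp only [add_sub_cancel_right, Real.rpow_natCast] at h
    have hG : Real.Gamma ((M:ℝ) + 1) = M.factorial := Real.Gamma_nat_eq_factorial M
    rw [hG] at h
    have hv : 0 < (1/r)^((M:ℝ)+1) * (M.factorial : ℝ) := by positivity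
    have hi : IntegrableOn (fun t : ℝ => t^M * Real.exp (-(r * t))) (Set.Ioi 0) := by
      by_contra hc
      rw [integral_undef hc] at h
      linarith
    have e : ∫⁻ t in Set.Ioi (0:ℝ), ENNReal.ofReal (t^M * Real.exp (-(t * r))) = ENNReal.ofReal ((1/r)^((M:ℝ)+1) * (M.factorial : ℝ)) := by
      rw [← h, ofReal_integral_eq_lintegral_ofReal hi]
      · simp_rw [mul_comm r]
      · refine (ae_restrict_iff' measurableSet_Ioi).2 (Filter.Eventually.of_forall fun t ht => ?_)
        have : (0:ℝ) < t := ht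
        simp only [Pi.zero_apply]
        positivity
    rw [e]
    apply ENNReal.ofReal_le_ofReal
    have e2 : (1/r)^((M:ℝ)+1) = r⁻¹^(M+1) := by
      rw [one_div]; exact_mod_cast Real.rpow_natCast r⁻¹ (M+1)
    rw [e2]
    have : (1:ℝ) ≤ M.factorial := by exact_mod_cast M.factorial_pos
    have h3 : 0 ≤ r⁻¹^(M+1) := by positivity
    nlinarith
  calc ∫⁻ ω, ENNReal.ofReal ((U ω)⁻¹^(M+1)) ∂P
      ≤ ∫⁻ ω, (∫⁻ t in Set.Ioi (0:ℝ), ENNReal.ofReal (t^M * Real.exp (-(t * U ω)))) ∂P :=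
        lintegral_mono_ae (hpos.mono fun ω h => hgam _ h)
    _ = ∫⁻ t in Set.Ioi (0:ℝ), ∫⁻ ω, ENNReal.ofReal (t^M * Real.exp (-(t * U ω))) ∂P := by
        rw [lintegral_lintegral_swap]
        exact Measurable.aemeasurable (by fun_prop)
    _ ≤ ∫⁻ t in Set.Ioi (0:ℝ), (ENNReal.ofReal (t^M) * ∫⁻ ω, ENNReal.ofReal (Real.exp (-(t * U ω))) ∂P) := by
        refine setLIntegral_mono' measurableSet_Ioi fun t ht => ?_
        have ht' : (0:ℝ) < t := ht
        rw [← lintegral_const_mul _ (by fun_prop)]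
        refine lintegral_mono fun ω => ?_
        simp only
        rw [ENNReal.ofReal_mul (by positivity)]
    _ ≤ ∫⁻ t in Set.Ioc 0 T ∪ Set.Ioi T, (ENNReal.ofReal (t^M) * ∫⁻ ω, ENNReal.ofReal (Real.exp (-(t * U ω))) ∂P) := by
        rw [Set.Ioc_union_Ioi_eq_Ioi hT.le]
    _ ≤ (∫⁻ t in Set.Ioc 0 T, (ENNReal.ofReal (t^M) * ∫⁻ ω, ENNReal.ofReal (Real.exp (-(t * U ω))) ∂P)) +
          ∫⁻ t in Set.Ioi T, (ENNReal.ofReal (t^M) * ∫⁻ ω, ENNReal.ofReal (Real.exp (-(t * U ω))) ∂P) := lintegral_union_le _ _ _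
    _ ≤ (∫⁻ t in Set.Ioc 0 T, ENNReal.ofReal (T^M)) + ∫⁻ t in Set.Ioi T, ENNReal.ofReal (T^(M+2) * t^(-2:ℝ)) := by
        refine add_le_add (setLIntegral_mono' measurableSet_Ioc fun t ht => ?_) (setLIntegral_mono' measurableSet_Ioi fun t ht => ?_)
        · have h1 : ∫⁻ ω, ENNReal.ofReal (Real.exp (-(t * U ω))) ∂P ≤ 1 := by
            calc _ ≤ ∫⁻ ω, 1 ∂P := by
                  refine lintegral_mono fun ω => ?_
                  simp only
                  rw [← ENNReal.ofReal_one]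
                  apply ENNReal.ofReal_le_ofReal
                  rw [Real.exp_le_one_iff]
                  have := mul_nonneg ht.1.le (hU0 ω)
                  linarith
              _ = 1 := by simp
          calc _ ≤ ENNReal.ofReal (T^M) * 1 := by
                gcongr
                · exact ht.1.le
                · exact ht.2
            _ = _ := mul_one _
        · have ht' : 0 < t := lt_trans hT ht
          calc _ ≤ ENNReal.ofReal (t^M) * ENNReal.ofReal ((T/t)^(M+2)) := mul_le_mul_right (hL t ht') _
            _ = _ := by
              rw [← ENNReal.ofReal_mul (by positivity)]
              congr 1
              rw [show (-2:ℝ) = ((-2:ℤ):ℝ) by norm_num, Real.rpow_intCast, div_pow, pow_add t M 2]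
              field_simp
    _ = ENNReal.ofReal (T^(M+1)) + ENNReal.ofReal (T^(M+1)) := by
        congr 1
        · rw [setLIntegral_const, Real.volume_Ioc, ← ENNReal.ofReal_mul (by positivity)]
          congr 1; ring
        · have hi := (integrableOn_Ioi_rpow_of_lt (a := -2) (by norm_num) hT).const_mul (T^(M+2))
          rw [← ofReal_integral_eq_lintegral_ofReal hi]
          · rw [integral_const_mul, integral_Ioi_rpow_of_lt (by norm_num) hT]
            congr 1
            norm_num
            rw [Real.rpow_neg_one, pow_succ T (M+1)]
            field_simp
          · refine (ae_restrict_iff' measurableSet_Ioi).2 (Filter.Eventually.of_forall fun t ht => ?_)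
            have : (0:ℝ) < t := lt_trans hT ht
            simp only [Pi.zero_apply]
            positivity
    _ = _ := by rw [← ENNReal.ofReal_add (by positivity) (by positivity)]; congr 1; ring


section E1
variable {n : ℕ} {Ω : Type} [MeasurableSpace Ω] (P : Measure Ω) [IsProbabilityMeasure P]
    (X : Ω → EuclideanSpace ℝ (Fin n)) (hX : Measurable X)

lemma iso_int2 (hX : Measurable X) (hI : Isotropic P X) (θ : EuclideanSpace ℝ (Fin n)) : Integrable (fun ω => ⟪X ω, θ⟫^2) P := by
  by_cases h : θ = 0
  · simp [h]
  · by_contra hc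
    have := hI.2 θ θ
    simp_rw [← sq] at this
    rw [integral_undef hc, real_inner_self_eq_norm_sq] at this
    have h2 : 0 < ‖θ‖^2 := by have := norm_pos_iff.2 h; positivity
    linarith

lemma iso_sq (hX : Measurable X) (hI : Isotropic P X) (θ : EuclideanSpace ℝ (Fin n)) : ∫ ω, ⟪X ω, θ⟫^2 ∂P = ‖θ‖^2 := by
  have := hI.2 θ θ
  simp_rw [← sq] at this
  rw [this, real_inner_self_eq_norm_sq]

lemma iso_lsq (hX : Measurable X) (hI : Isotropic P X) (θ : EuclideanSpace ℝ (Fin n)) :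
    ∫⁻ ω, ENNReal.ofReal (⟪X ω, θ⟫^2) ∂P = ENNReal.ofReal (‖θ‖^2) := by
  rw [← iso_sq P X hX hI θ, ofReal_integral_eq_lintegral_ofReal (iso_int2 P X hX hI θ) (Filter.Eventually.of_forall fun ω => sq_nonneg _)]

lemma iso_mean (hX : Measurable X) (hI : Isotropic P X) (θ : EuclideanSpace ℝ (Fin n)) : ∫ ω, ⟪X ω, θ⟫ ∂P = 0 := by
  have h1 : ∀ θ, Integrable (fun ω => ⟪X ω, θ⟫) P := by
    intro θ
    refine Integrable.mono' ((integrable_const (1:ℝ)).add (iso_int2 P X hX hI θ)) (Measurable.aestronglyMeasurable (by fun_prop)) (Filter.Eventually.of_forall fun s => ?_)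
    simp only [Real.norm_eq_abs, Pi.add_apply]
    have := sq_abs ⟪X s, θ⟫
    nlinarith [sq_nonneg (|⟪X s, θ⟫| - 1), abs_nonneg ⟪X s, θ⟫]
  have hXi : Integrable X P := by
    have hs : Integrable (fun ω => ∑ i : Fin n, ⟪X ω, EuclideanSpace.basisFun (Fin n) ℝ i⟫ • (EuclideanSpace.basisFun (Fin n) ℝ i)) P :=
      integrable_finsetSum _ fun i _ => (h1 _).smul_const _
    refine hs.congr (Filter.Eventually.of_forall fun ω => ?_)
    simp only
    conv_rhs => rw [← (EuclideanSpace.basisFun (Fin n) ℝ).sum_repr' (X ω)]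
    refine Finset.sum_congr rfl fun i _ => ?_
    rw [real_inner_comm]
  simp_rw [real_inner_comm θ]
  rw [integral_inner hXi, hI.1, inner_zero_right]

lemma psi_mom (hX : Measurable X) (hPL : PL (P.map X) (fun _ => 0)) (hI : Isotropic P X) (α b : ℝ) (hψ : IsPsiAlpha P X α b) (hb : 0 ≤ b) (N : ℕ) (hN : 1 ≤ N) (y : EuclideanSpace ℝ (Fin n)) :
    ∫⁻ ω, ENNReal.ofReal (⟪X ω, y⟫^(2*N)) ∂P ≤ ENNReal.ofReal ((b^2 * (2*N:ℝ)^(2/α) * ‖y‖^2)^N) := by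
  have hm : Measurable (fun x : EuclideanSpace ℝ (Fin n) => ⟪x, y⟫) := by fun_prop
  have i1 : IsProbabilityMeasure (P.map X) := Measure.isProbabilityMeasure_map hX.aemeasurable
  have i2 : IsProbabilityMeasure ((P.map X).map (fun x => ⟪x, y⟫)) := Measure.isProbabilityMeasure_map hm.aemeasurable
  have hf := momfin ((P.map X).map (fun x => ⟪x, y⟫)) (hPL.map _ hm (by
    intro x z; simp only [inner_smul_left, inner_add_left, smul_eq_mul]; simp) (by simp)) (by
    rw [lintegral_map (by fun_prop) hm, lintegral_map (by fun_prop) hX, iso_lsq P X hX hI]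
    exact ENNReal.ofReal_ne_top) (2*N)
  rw [lintegral_map (by fun_prop) hm, lintegral_map (by fun_prop) hX] at hf
  have hintg : Integrable (fun ω => |⟪X ω, y⟫|^(2*N)) P := by
    refine ⟨Measurable.aestronglyMeasurable (by fun_prop), ?_⟩
    rw [hasFiniteIntegral_iff_ofReal (Filter.Eventually.of_forall fun s => by positivity)]
    exact lt_of_le_of_ne le_top hf
  have h := hψ (2*N:ℕ) (by have : (1:ℝ) ≤ N := by exact_mod_cast hN
                           push_cast; linarith) y
  simp_rw [Real.rpow_natCast] at h
  rw [iso_sq P X hX hI, ← Real.sqrt_eq_rpow, Real.sqrt_sq (norm_nonneg _)] at h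
  set I := ∫ ω, |⟪X ω, y⟫|^(2*N) ∂P with hIdef
  have hI0 : 0 ≤ I := integral_nonneg fun ω => by positivity
  have e1 : ∫⁻ ω, ENNReal.ofReal (⟪X ω, y⟫^(2*N)) ∂P = ENNReal.ofReal I := by
    rw [hIdef, ofReal_integral_eq_lintegral_ofReal hintg (Filter.Eventually.of_forall fun s => by positivity)]
    refine lintegral_congr fun ω => ?_
    rw [pow_mul, pow_mul, sq_abs]
  rw [e1]
  apply ENNReal.ofReal_le_ofReal
  have hNe : ((2*N:ℕ):ℝ) ≠ 0 := by positivity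
  have h3 := pow_le_pow_left₀ (Real.rpow_nonneg hI0 _) h (2*N)
  rw [one_div, Real.rpow_inv_natCast_pow hI0 (by omega)] at h3
  refine h3.trans (le_of_eq ?_)
  rw [pow_mul]
  congr 1
  have e2 : (((2*N:ℕ):ℝ)^(1/α))^2 = (2*N:ℝ)^(2/α) := by
    rw [← Real.rpow_natCast, ← Real.rpow_mul (by positivity)]
    push_cast
    congr 1
    ring
  rw [mul_pow, mul_pow, e2]

lemma psi_b (hX : Measurable X) (hn : 1 ≤ n) (hI : Isotropic P X) (α b : ℝ) (hα : 1 ≤ α) (hψ : IsPsiAlpha P X α b) : 1/2 ≤ b := by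
  have h := hψ 2 le_rfl (EuclideanSpace.single ⟨0, hn⟩ 1)
  simp_rw [Real.rpow_two, sq_abs] at h
  rw [iso_sq P X hX hI] at h
  simp only [EuclideanSpace.norm_single, norm_one, one_pow, Real.one_rpow, mul_one] at h
  have h2 : (2:ℝ)^(1/α) ≤ 2 := by
    calc (2:ℝ)^(1/α) ≤ 2^(1:ℝ) := Real.rpow_le_rpow_of_exponent_le (by norm_num) (by rw [div_le_one (by linarith)]; exact hα)
      _ = 2 := Real.rpow_one _
  have h3 : 0 < (2:ℝ)^(1/α) := by positivity
  by_contra hc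
  push Not at hc
  nlinarith

end E1


open scoped Matrix

lemma sqrt_pow_two_mul (x : ℝ) (hx : 0 ≤ x) (k : ℕ) : (√x)^(2*k) = x^k := by
  rw [pow_mul, Real.sq_sqrt hx]

lemma sqrt_inv_pow_two_mul (x : ℝ) (hx : 0 ≤ x) (k : ℕ) : (√x)⁻¹^(2*k) = (x⁻¹)^k := by
  rw [pow_mul, inv_pow, Real.sq_sqrt hx]

set_option maxHeartbeats 4000000 in
lemma setting {n : ℕ} (hn : 1 ≤ n) {Ω : Type} [MeasurableSpace Ω] (P : Measure Ω) [IsProbabilityMeasure P]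
    (X : Ω → EuclideanSpace ℝ (Fin n)) (hX : Measurable X) (hPL : PL (P.map X) (fun _ => 0))
    (hI : Isotropic P X) (α b : ℝ) (hα : 1 ≤ α) (hα2 : α ≤ 2) (hψ : IsPsiAlpha P X α b)
    (A : Matrix (Fin n) (Fin n) ℝ) (hA : hsNorm A ^ 2 = n) (j m : ℕ) (hj : 1 ≤ j) (hm8 : m = 8 * j^2)
    (hcond : Real.exp 130 * (b^2 * (8*((m:ℝ)+1))^(2/α) * opNorm A ^2) * (1564*((m:ℝ)+1)+1) ≤ n/64)
    (U : Ω → ℝ) (hU : U = fun ω => ‖mApp A (X ω)‖^2 / n) :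
    (∫⁻ ω, ENNReal.ofReal (U ω) ∂P = 1) ∧
    ((∫⁻ ω, ENNReal.ofReal (((1 + U ω)/2)^j) ∂P) * (∫⁻ ω, ENNReal.ofReal (((1 + U ω)/2)⁻¹^j) ∂P) ≤ ENNReal.ofReal (144 * Real.exp 1)) ∧
    (P {ω | U ω ≤ 1/64} ≤ ENNReal.ofReal (144 * Real.exp (-(2 * (j:ℝ)^2)))) ∧
    (∀ᵐ ω ∂P, 0 < U ω) ∧ ∫⁻ ω, ENNReal.ofReal ((U ω)⁻¹^j) ∂P ≤ ENNReal.ofReal (2 * (720000000000000000000000000000 * ((j:ℝ)+1)^3)^j) := by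
  have hn0 : (0:ℝ) < n := by exact_mod_cast hn
  have hj0 : (1:ℝ) ≤ j := by exact_mod_cast hj
  have hb := psi_b P X hX hn hI α b hα hψ
  set Λ := opNorm A with hΛ
  have hΛ0 : 0 ≤ Λ := norm_nonneg _
  obtain ⟨u, l, hl0, hl1, hls, hlx⟩ := svd_sum A
  rw [hA] at hls
  have hop : 1 ≤ Λ ^ 2 := by
    have : (n:ℝ) ≤ n * Λ ^ 2 := by
      calc (n:ℝ) = ∑ j, l j := hls.symm
        _ ≤ ∑ j : Fin n, Λ ^ 2 := Finset.sum_le_sum fun j _ => hl1 j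
        _ = _ := by simp
    by_contra hc
    push Not at hc
    nlinarith
  have hmr : (m:ℝ) = 8 * (j:ℝ)^2 := by rw [hm8]; push_cast; ring
  have hm0 : (0:ℝ) < m := by rw [hmr]; positivity
  set B : ℝ := b^2 * (8*((m:ℝ)+1))^(2/α) * Λ^2 with hB
  have hB0 : 0 < B := by positivity
  have hBn : B ≤ n := by
    have e1 : (1:ℝ) ≤ Real.exp 130 := Real.one_le_exp (by norm_num)
    have e2 : B ≤ Real.exp 130 * B := by nlinarith
    have e3 : Real.exp 130 * B ≤ Real.exp 130 * B * (1564*((m:ℝ)+1)+1) := by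
      have : 0 < Real.exp 130 * B := by positivity
      nlinarith
    linarith
  have hBl : 16 * (j:ℝ)^2 * Λ^2 ≤ B := by
    have e1 : 8*((m:ℝ)+1) ≤ (8*((m:ℝ)+1))^(2/α) := by
      calc 8*((m:ℝ)+1) = (8*((m:ℝ)+1))^(1:ℝ) := (Real.rpow_one _).symm
        _ ≤ _ := Real.rpow_le_rpow_of_exponent_le (by linarith) (by rw [le_div_iff₀ (by linarith)]; linarith)
    have e2 : 1/4 ≤ b^2 := by nlinarith
    have e3 : 1/4 * (8*((m:ℝ)+1)) ≤ b^2 * (8*((m:ℝ)+1))^(2/α) := mul_le_mul e2 e1 (by positivity) (by positivity)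
    rw [hB]
    apply mul_le_mul_of_nonneg_right _ (by positivity)
    linarith
  have hopn : Λ^2 ≤ n := by
    refine le_trans ?_ (hBl.trans hBn)
    have : (1:ℝ) ≤ 16 * (j:ℝ)^2 := by nlinarith
    exact le_mul_of_one_le_left (by positivity) this
  have hUm : Measurable U := by
    rw [hU]
    have : Continuous (fun x : EuclideanSpace ℝ (Fin n) => mApp A x) := (LinearMap.toContinuousLinearMap (Matrix.toEuclideanLin A)).continuous
    have := this.measurable
    fun_prop
  have hU0 : ∀ ω, 0 ≤ U ω := fun ω => by rw [hU]; positivity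
  set T := Matrix.toEuclideanLin A with hT
  set L : EuclideanSpace ℝ (Fin n) → (Fin n → ℝ) := fun x i => mApp A x i with hL
  have hLm : Measurable L := by
    have : Continuous (fun x : EuclideanSpace ℝ (Fin n) => mApp A x) := (LinearMap.toContinuousLinearMap (Matrix.toEuclideanLin A)).continuous
    have := this.measurable
    fun_prop
  have hLL : ∀ x, L x ⬝ᵥ L x = ‖mApp A x‖^2 := by
    intro x
    rw [EuclideanSpace.real_norm_sq_eq]
    simp only [hL, dotProduct, sq]
  have hLη : ∀ x (η : Fin n → ℝ), L x ⬝ᵥ η = ⟪x, LinearMap.adjoint T (WithLp.toLp 2 η)⟫ := by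
    intro x η
    rw [LinearMap.adjoint_inner_right]
    rw [PiLp.inner_apply]
    simp only [hL, dotProduct, hT, mApp]
    refine Finset.sum_congr rfl fun i _ => ?_
    simp [mul_comm]
  have hadj : ∀ η : Fin n → ℝ, ‖LinearMap.adjoint T (WithLp.toLp 2 η)‖^2 ≤ Λ^2 * (η ⬝ᵥ η) := by
    intro η
    set w := LinearMap.adjoint T (WithLp.toLp 2 η) with hw
    have h1 : ‖w‖^2 ≤ Λ * ‖w‖ * ‖(WithLp.toLp 2 η : EuclideanSpace ℝ (Fin n))‖ := by
      calc ‖w‖^2 = ⟪w, w⟫ := (real_inner_self_eq_norm_sq _).symm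
        _ = ⟪T w, WithLp.toLp 2 η⟫ := by nth_rw 2 [hw]; rw [LinearMap.adjoint_inner_right]
        _ ≤ ‖T w‖ * ‖(WithLp.toLp 2 η : EuclideanSpace ℝ (Fin n))‖ := real_inner_le_norm _ _
        _ ≤ _ := by
          gcongr
          exact (LinearMap.toContinuousLinearMap T).le_opNorm w
    have h2 : ‖(WithLp.toLp 2 η : EuclideanSpace ℝ (Fin n))‖^2 = η ⬝ᵥ η := by
      rw [EuclideanSpace.real_norm_sq_eq]; simp only [dotProduct, sq]
    rw [← h2]
    set g := ‖(WithLp.toLp 2 η : EuclideanSpace ℝ (Fin n))‖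
    have hg : 0 ≤ g := norm_nonneg _
    have hw0 := norm_nonneg w
    rw [← mul_pow]
    apply pow_le_pow_left₀ hw0
    by_contra hc
    push Not at hc
    have : 0 ≤ Λ * g := by positivity
    nlinarith
  set ν := (P.map X).map L with hν
  have i1 : IsProbabilityMeasure (P.map X) := Measure.isProbabilityMeasure_map hX.aemeasurable
  have i2 : IsProbabilityMeasure ν := Measure.isProbabilityMeasure_map hLm.aemeasurable
  have hνPL : PL ν (fun _ => 0) := hPL.map L hLm (by
    intro x y; funext i
    simp only [hL, mApp, map_smul, map_add, PiLp.smul_apply, PiLp.add_apply, Pi.smul_apply, Pi.add_apply]) (by simp)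
  have hdm : Measurable (fun z : Fin n → ℝ => z ⬝ᵥ z) := by unfold dotProduct; fun_prop
  have hdm2 : ∀ η : Fin n → ℝ, Measurable (fun z : Fin n → ℝ => z ⬝ᵥ η) := fun η => by unfold dotProduct; fun_prop
  have htr : ∀ F : (Fin n → ℝ) → ℝ≥0∞, Measurable F → ∫⁻ z, F z ∂ν = ∫⁻ ω, F (L (X ω)) ∂P := by
    intro F hF
    rw [hν, lintegral_map hF hLm, lintegral_map (by fun_prop) hX]
  have hzz : ∀ ω, L (X ω) ⬝ᵥ L (X ω) = n * U ω := by
    intro ω; rw [hLL, hU]; field_simp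
  have hEn : ∫⁻ ω, ENNReal.ofReal (‖mApp A (X ω)‖^2) ∂P = ENNReal.ofReal n := by
    simp_rw [hlx]
    have : ∀ ω, ENNReal.ofReal (∑ j, l j * ⟪u j, X ω⟫^2) = ∑ j, ENNReal.ofReal (l j) * ENNReal.ofReal (⟪X ω, u j⟫^2) := by
      intro ω
      rw [ENNReal.ofReal_sum_of_nonneg (fun j _ => mul_nonneg (hl0 j) (sq_nonneg _))]
      refine Finset.sum_congr rfl fun j _ => ?_
      rw [ENNReal.ofReal_mul (hl0 j), real_inner_comm]
    simp_rw [this]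
    rw [lintegral_finsetSum' _ (fun σ _ => by fun_prop)]
    have h3 : ∀ j, ∫⁻ ω, ENNReal.ofReal (l j) * ENNReal.ofReal (⟪X ω, u j⟫^2) ∂P = ENNReal.ofReal (l j) := by
      intro j
      rw [lintegral_const_mul _ (by fun_prop), iso_lsq P X hX hI, u.norm_eq_one]; simp
    simp_rw [h3]
    rw [← ENNReal.ofReal_sum_of_nonneg (fun j _ => hl0 j), hls]
  have hEU : ∫⁻ ω, ENNReal.ofReal (U ω) ∂P = 1 := by
    have e : ∀ ω, ENNReal.ofReal (U ω) = ENNReal.ofReal (1/n) * ENNReal.ofReal (‖mApp A (X ω)‖^2) := by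
      intro ω
      rw [← ENNReal.ofReal_mul (by positivity), hU]
      congr 1
      field_simp
    simp_rw [e]
    rw [lintegral_const_mul' _ _ ENNReal.ofReal_ne_top, hEn, ← ENNReal.ofReal_mul (by positivity)]
    rw [one_div, inv_mul_cancel₀ hn0.ne']; simp
  have g1 : ∫⁻ z, ENNReal.ofReal (z ⬝ᵥ z) ∂ν ≤ ENNReal.ofReal n := by
    rw [htr _ (by fun_prop), ← hEn]
    simp_rw [hLL]; exact le_rfl
  have g2 : ∀ η : Fin n → ℝ, ∫⁻ z, ENNReal.ofReal ((z ⬝ᵥ η)^2) ∂ν ≤ ENNReal.ofReal (n * (η ⬝ᵥ η)) := by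
    intro η
    have := hdm2 η
    rw [htr _ (by fun_prop)]
    simp_rw [hLη]
    rw [iso_lsq P X hX hI]
    apply ENNReal.ofReal_le_ofReal
    exact (hadj η).trans (mul_le_mul_of_nonneg_right hopn (dot_self_nonneg' _))
  have g3 : ∀ η : Fin n → ℝ, ∫⁻ z, ENNReal.ofReal ((z ⬝ᵥ η)^(8*(m+1))) ∂ν ≤ ENNReal.ofReal ((B*(η ⬝ᵥ η))^(4*(m+1))) := by
    intro η
    have := hdm2 η
    rw [htr _ (by fun_prop)]
    simp_rw [hLη]
    have h := psi_mom P X hX hPL hI α b hψ (by linarith) (4*(m+1)) (by omega) (LinearMap.adjoint T (WithLp.toLp 2 η))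
    rw [show 8*(m+1) = 2*(4*(m+1)) by ring]
    refine h.trans (ENNReal.ofReal_le_ofReal ?_)
    apply pow_le_pow_left₀ (by positivity)
    rw [hB, mul_assoc (b^2 * _)]
    have e8 : (2 * ((4*(m+1):ℕ):ℝ)) = 8*((m:ℝ)+1) := by push_cast; ring
    rw [e8]
    gcongr
    exact hadj η
  refine ⟨hEU, ?_, ?_, ?_⟩
  · have h := mainT (m := m) ν hνPL hn n 1 B one_pos (by simp) hB0 (by
      refine le_trans ?_ (hcond.trans (by linarith : (n:ℝ)/64 ≤ n))
      gcongr
      · norm_num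
      · norm_num) g1 g2 g3 (2*j) (by rw [hm8]; nlinarith)
    have hx : ∀ ω, (n:ℝ) + L (X ω) ⬝ᵥ L (X ω) = 2 * n * ((1 + U ω)/2) := by
      intro ω; rw [hzz]; ring
    have hV : ∀ ω, 0 < (1 + U ω)/2 := fun ω => by have := hU0 ω; positivity
    rw [htr _ (by fun_prop), htr _ (by fun_prop)] at h
    have e1 : ∀ ω, ENNReal.ofReal ((√((n:ℝ) + L (X ω) ⬝ᵥ L (X ω)))^(2*j)) = ENNReal.ofReal ((2*n)^j) * ENNReal.ofReal (((1 + U ω)/2)^j) := by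
      intro ω
      have := hV ω
      rw [hx, sqrt_pow_two_mul _ (by positivity), ← ENNReal.ofReal_mul (by positivity), mul_pow]
    have e2 : ∀ ω, ENNReal.ofReal ((√((n:ℝ) + L (X ω) ⬝ᵥ L (X ω)))⁻¹^(2*j)) = ENNReal.ofReal (((2*n)^j)⁻¹) * ENNReal.ofReal (((1 + U ω)/2)⁻¹^j) := by
      intro ω
      have := hV ω
      rw [hx, sqrt_inv_pow_two_mul _ (by positivity), ← ENNReal.ofReal_mul (by positivity), mul_inv, mul_pow, inv_pow (2*(n:ℝ))]
    simp_rw [e1, e2] at h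
    rw [lintegral_const_mul' _ _ ENNReal.ofReal_ne_top, lintegral_const_mul' _ _ ENNReal.ofReal_ne_top, mul_mul_mul_comm, ← ENNReal.ofReal_mul (by positivity),
      mul_inv_cancel₀ (by positivity)] at h
    simp only [ENNReal.ofReal_one, one_mul] at h
    refine h.trans (le_of_eq ?_)
    congr 3
    rw [hmr]; push_cast
    field_simp; norm_num
  · have h := mainT (m := m) ν hνPL hn (1/64*n) (1/64) B (by norm_num) rfl hB0 (by
      refine le_trans ?_ (hcond.trans (by linarith : (n:ℝ)/64 ≤ 1/64*n))
      gcongr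
      · norm_num
      · norm_num) g1 g2 g3 (2*(2*j^2)) (by rw [hm8]; nlinarith)
    set a := 2*j^2 with ha
    have hx : ∀ ω, (1/64*n:ℝ) + L (X ω) ⬝ᵥ L (X ω) = n * (1/64 + U ω) := by
      intro ω; rw [hzz]; ring
    have hV : ∀ ω, 0 < 1/64 + U ω := fun ω => by have := hU0 ω; positivity
    rw [htr _ (by fun_prop), htr _ (by fun_prop)] at h
    have e1 : ∀ ω, ENNReal.ofReal ((√((1/64*n:ℝ) + L (X ω) ⬝ᵥ L (X ω)))^(2*a)) = ENNReal.ofReal (n^a) * ENNReal.ofReal ((1/64 + U ω)^a) := by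
      intro ω
      have := hV ω
      rw [hx, sqrt_pow_two_mul _ (by positivity), ← ENNReal.ofReal_mul (by positivity), mul_pow]
    have e2 : ∀ ω, ENNReal.ofReal ((√((1/64*n:ℝ) + L (X ω) ⬝ᵥ L (X ω)))⁻¹^(2*a)) = ENNReal.ofReal (((n:ℝ)^a)⁻¹) * ENNReal.ofReal ((1/64 + U ω)⁻¹^a) := by
      intro ω
      have := hV ω
      rw [hx, sqrt_inv_pow_two_mul _ (by positivity), ← ENNReal.ofReal_mul (by positivity), mul_inv, mul_pow, inv_pow (n:ℝ)]
    simp_rw [e1, e2] at h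
    rw [lintegral_const_mul' _ _ ENNReal.ofReal_ne_top, lintegral_const_mul' _ _ ENNReal.ofReal_ne_top, mul_mul_mul_comm, ← ENNReal.ofReal_mul (by positivity),
      mul_inv_cancel₀ (by positivity)] at h
    simp only [ENNReal.ofReal_one, one_mul] at h
    have l1 : 1 ≤ ∫⁻ ω, ENNReal.ofReal ((1/64 + U ω)^a) ∂P := by
      have ha1 : (1:ℝ) ≤ a := by rw [ha]; push_cast; nlinarith
      have h5 : ∫⁻ ω, (ENNReal.ofReal a * ENNReal.ofReal (U ω) + 1) ∂P ≤ ∫⁻ ω, (ENNReal.ofReal ((1/64 + U ω)^a) + ENNReal.ofReal a) ∂P := by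
        refine lintegral_mono fun ω => ?_
        simp only
        rw [← ENNReal.ofReal_mul (by positivity), ← ENNReal.ofReal_one, ← ENNReal.ofReal_add (by have := hU0 ω; positivity) (by norm_num), ← ENNReal.ofReal_add (by have := hV ω; positivity) (by positivity)]
        apply ENNReal.ofReal_le_ofReal
        have := one_add_mul_le_pow (a := 1/64 + U ω - 1) (by have := hU0 ω; linarith) a
        rw [add_sub_cancel] at this
        nlinarith [hU0 ω]
      rw [lintegral_add_right _ measurable_const, lintegral_add_right _ measurable_const, lintegral_const_mul' _ _ ENNReal.ofReal_ne_top, hEU] at h5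
      simp only [mul_one, lintegral_const, measure_univ] at h5
      rw [add_comm] at h5
      exact (ENNReal.add_le_add_iff_right ENNReal.ofReal_ne_top).1 h5
    have l2 : ENNReal.ofReal (32^a) * P {ω | U ω ≤ 1/64} ≤ ∫⁻ ω, ENNReal.ofReal ((1/64 + U ω)⁻¹^a) ∂P := by
      have hmS : MeasurableSet {ω | U ω ≤ 1/64} := measurableSet_le hUm measurable_const
      rw [← setLIntegral_const]
      refine le_trans (setLIntegral_mono' hmS fun ω hω => ?_) (setLIntegral_le_lintegral _ _)
      apply ENNReal.ofReal_le_ofReal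
      apply pow_le_pow_left₀ (by norm_num)
      have hω' : U ω ≤ 1/64 := hω
      rw [le_inv_comm₀ (by norm_num) (hV ω)]
      linarith
    have h6 : ENNReal.ofReal (32^a) * P {ω | U ω ≤ 1/64} ≤ ENNReal.ofReal (32^a) * ENNReal.ofReal (144 * Real.exp (-(2 * (j:ℝ)^2))) := by
      calc _ ≤ 1 * ∫⁻ ω, ENNReal.ofReal ((1/64 + U ω)⁻¹^a) ∂P := by rw [one_mul]; exact l2
        _ ≤ _ := mul_le_mul_left l1 _
        _ ≤ _ := h
        _ ≤ _ := by
          rw [← ENNReal.ofReal_mul (by positivity)]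
          apply ENNReal.ofReal_le_ofReal
          have e3 : 2 * (((2*a:ℕ):ℝ))^2/(m:ℝ) = 4 * (j:ℝ)^2 := by
            rw [hmr, ha]; push_cast; field_simp; norm_num
          rw [e3]
          have e4 : Real.exp (6 * (j:ℝ)^2) ≤ 32^a := by
            rw [ha, pow_mul, show 6 * (j:ℝ)^2 = ((j^2:ℕ):ℝ) * 6 by push_cast; ring, Real.exp_nat_mul]
            apply pow_le_pow_left₀ (Real.exp_pos _).le
            have : Real.exp 6 = (Real.exp 1)^6 := by rw [← Real.exp_nat_mul]; norm_num
            rw [this]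
            calc (Real.exp 1)^6 ≤ 3^6 := pow_le_pow_left₀ (Real.exp_pos _).le (by have := Real.exp_one_lt_d9; linarith) _
              _ ≤ _ := by norm_num
          have e5 : Real.exp (4 * (j:ℝ)^2) = Real.exp (6 * (j:ℝ)^2) * Real.exp (-(2 * (j:ℝ)^2)) := by
            rw [← Real.exp_add]; congr 1; ring
          rw [e5]
          have := Real.exp_pos (-(2 * (j:ℝ)^2))
          nlinarith [mul_le_mul_of_nonneg_right e4 this.le]
    rw [ENNReal.mul_le_mul_iff_right (by simp) ENNReal.ofReal_ne_top] at h6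
    exact h6
  · obtain ⟨M, rfl⟩ : ∃ M, j = M + 1 := ⟨j - 1, by omega⟩
    refine neg_mom P U hUm hU0 M _ (by positivity) ?_
    intro t ht
    have h := neg_lap P X hX hPL (iso_mean P X hX hI) (iso_lsq P X hX hI) A hA (2*(M+2)) (by omega) hn ?_ t ht
    · rw [hU]
      refine h.trans (ENNReal.ofReal_le_ofReal (le_of_eq ?_))
      rw [pow_mul, div_pow, Real.sq_sqrt (by positivity)]
      congr 1
      push_cast
      field_simp
      ring
    · rw [← hΛ]
      refine le_trans ?_ (hBl.trans hBn)
      apply mul_le_mul_of_nonneg_right _ (by positivity)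
      push_cast at hj0 ⊢
      have : (0:ℝ) ≤ M := Nat.cast_nonneg M
      nlinarith


lemma exp_q (x : ℝ) : Real.exp x ≤ 1 + x + x^2 * Real.exp |x| := by
  have h1 : Real.exp x - 1 ≤ x * Real.exp x := by
    have h := Real.add_one_le_exp (-x)
    have h2 : Real.exp (-x) * Real.exp x = 1 := by rw [← Real.exp_add]; simp
    have := Real.exp_pos x
    nlinarith
  rcases le_total 0 x with hx | hx
  · rw [abs_of_nonneg hx]
    nlinarith [mul_le_mul_of_nonneg_left h1 hx]
  · have h2 := Real.add_one_le_exp x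
    have h3 : 1 ≤ Real.exp |x| := Real.one_le_exp (abs_nonneg _)
    have h4 : 0 ≤ (-x) * (Real.exp x - 1 - x) := mul_nonneg (by linarith) (by linarith)
    nlinarith [mul_le_mul_of_nonneg_left h3 (sq_nonneg x)]

lemma bern_neg {x s : ℝ} (hx : 0 < x) (hs : 0 ≤ s) : 1 - s * (x - 1) ≤ x ^ (-s) := by
  rcases le_total s 1 with h | h
  · have h1 := _root_.rpow_one_add_le_one_add_mul_self (s := x - 1) (by linarith) hs h
    rw [add_sub_cancel] at h1
    have h2 : 0 < x ^ s := Real.rpow_pos_of_pos hx _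
    rw [Real.rpow_neg hx.le, ← one_div, le_div_iff₀ h2]
    rcases le_total (1 - s*(x-1)) 0 with h3 | h3
    · nlinarith
    · nlinarith [mul_le_mul_of_nonneg_left h1 h3, sq_nonneg (s*(x-1))]
  · have h1 := one_add_mul_self_le_rpow_one_add (s := x⁻¹ - 1) (by have := inv_pos.2 hx; linarith) h
    rw [add_sub_cancel, Real.inv_rpow hx.le, ← Real.rpow_neg hx.le] at h1
    have h2 : 2 - x ≤ x⁻¹ := by
      rw [← one_div, le_div_iff₀ hx]; nlinarith [sq_nonneg (x-1)]
    nlinarith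

lemma bern_pos {x r : ℝ} (hx : 0 ≤ x) (hr : 1 ≤ r) : 1 + r * (x - 1) ≤ x ^ r := by
  have h1 := one_add_mul_self_le_rpow_one_add (s := x - 1) (by linarith) hr
  rwa [add_sub_cancel] at h1

lemma bern_mid {x r : ℝ} (hx : 0 ≤ x) (hr : 0 ≤ r) (hr1 : r ≤ 1) : x ^ r ≤ 1 + r * (x - 1) := by
  have h1 := _root_.rpow_one_add_le_one_add_mul_self (s := x - 1) (by linarith) hr hr1
  rwa [add_sub_cancel] at h1

lemma ell_exp (j : ℝ) (hj : 0 < j) (l : ℝ) (hl : 0 ≤ l) : l^2 ≤ 8/j^2 * Real.exp (j*l/2) := by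
  have h := Real.quadratic_le_exp_of_nonneg (x := j*l/2) (by positivity)
  have h2 : (j*l/2)^2/2 ≤ Real.exp (j*l/2) := by
    have : 0 ≤ j*l/2 := by positivity
    linarith
  calc l^2 = 8/j^2 * ((j*l/2)^2/2) := by field_simp; ring
    _ ≤ _ := by gcongr

lemma exp_abs_log (v : ℝ) (hv : 0 < v) (j : ℕ) : Real.exp (j * |Real.log v|) ≤ v^j + v⁻¹^j := by
  have h1 : 0 < v^j := by positivity
  have h2 : 0 < v⁻¹^j := by positivity
  rcases le_total 0 (Real.log v) with h | h
  · rw [abs_of_nonneg h, Real.exp_nat_mul, Real.exp_log hv]; linarith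
  · rw [abs_of_nonpos h, Real.exp_nat_mul, Real.exp_neg, Real.exp_log hv]; linarith

lemma log_cmp (u : ℝ) (hu : 1/64 ≤ u) : |Real.log u| ≤ 128 * |Real.log ((1+u)/2)| := by
  have hu0 : 0 < u := by linarith
  rcases le_total 1 u with h | h
  · rw [abs_of_nonneg (Real.log_nonneg h), abs_of_nonneg (Real.log_nonneg (by linarith))]
    have h1 : Real.log u ≤ 2 * Real.log ((1+u)/2) := by
      have : 2 * Real.log ((1+u)/2) = Real.log (((1+u)/2)^2) := by rw [Real.log_pow]; norm_num
      rw [this]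
      exact Real.log_le_log hu0 (by nlinarith [sq_nonneg (u-1)])
    have : 0 ≤ Real.log ((1+u)/2) := Real.log_nonneg (by linarith)
    linarith
  · rw [abs_of_nonpos (Real.log_nonpos hu0.le h), abs_of_nonpos (Real.log_nonpos (by linarith) (by linarith))]
    have h1 := Real.log_le_sub_one_of_pos (x := (1+u)/2) (by linarith)
    have h2 := Real.log_le_sub_one_of_pos (x := u⁻¹) (by positivity)
    rw [Real.log_inv] at h2
    have h3 : u⁻¹ - 1 ≤ 64 * (1-u) := by
      have : u⁻¹ - 1 = u⁻¹ * (1 - u) := by field_simp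
      rw [this]
      apply mul_le_mul_of_nonneg_right _ (by linarith)
      rw [inv_le_comm₀ hu0 (by norm_num)]; linarith
    linarith

lemma pt_main (u r : ℝ) (j : ℕ) (hu : 1/64 ≤ u) (hr : 1/2 ≤ |r|) (hj : 256 * (|r|+1) ≤ j) :
    u ^ r ≤ 1 + r * (u - 1) + 393216 * r^2 / (j:ℝ)^2 * (((1+u)/2)^j + ((1+u)/2)⁻¹^j) := by
  have hu0 : 0 < u := by linarith
  have hj0 : (0:ℝ) < j := by linarith
  set t := Real.log u with ht
  set l := |Real.log ((1+u)/2)| with hl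
  have hl0 : 0 ≤ l := abs_nonneg _
  have htl : |t| ≤ 128 * l := log_cmp u hu
  have hut : u = Real.exp t := (Real.exp_log hu0).symm
  have e1 : u ^ r = Real.exp (r*t) := by rw [Real.rpow_def_of_pos hu0, mul_comm]
  have e2 : u ^ r ≤ 1 + r*t + (r*t)^2 * Real.exp ((|r|+1)*|t|) := by
    rw [e1]
    refine (exp_q _).trans ?_
    have : Real.exp |r*t| ≤ Real.exp ((|r|+1)*|t|) := by
      apply Real.exp_le_exp.2; rw [abs_mul]; nlinarith [abs_nonneg t]
    nlinarith [mul_le_mul_of_nonneg_left this (sq_nonneg (r*t))]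
  have e3 : r * t ≤ r * (u - 1) + 2 * (r*t)^2 * Real.exp ((|r|+1)*|t|) := by
    have hlog : t ≤ u - 1 := Real.log_le_sub_one_of_pos hu0
    have hex : u ≤ 1 + t + t^2 * Real.exp |t| := by
      conv_lhs => rw [hut]
      exact exp_q t
    have hE := Real.exp_pos ((|r|+1)*|t|)
    rcases le_total 0 r with h | h
    · have := mul_le_mul_of_nonneg_left hlog h
      have : 0 ≤ 2 * (r*t)^2 * Real.exp ((|r|+1)*|t|) := by positivity
      linarith
    · have h5 : Real.exp |t| ≤ Real.exp ((|r|+1)*|t|) := by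
        apply Real.exp_le_exp.2; nlinarith [abs_nonneg t, abs_nonneg r]
      rw [abs_of_nonpos h] at hr h5 ⊢
      have h6 : (-r) * (u - 1 - t) ≤ (-r) * (t^2 * Real.exp ((-r+1)*|t|)) := by
        apply mul_le_mul_of_nonneg_left _ (by linarith)
        have := mul_le_mul_of_nonneg_left h5 (sq_nonneg t)
        linarith
      have h7 : (-r) * (t^2 * Real.exp ((-r+1)*|t|)) ≤ (2*(-r)^2) * (t^2 * Real.exp ((-r+1)*|t|)) := by
        apply mul_le_mul_of_nonneg_right _ (by positivity)
        nlinarith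
      nlinarith
  have e4 : t^2 ≤ 16384 * l^2 := by
    rw [← sq_abs t]
    nlinarith [abs_nonneg t]
  have e5 : Real.exp ((|r|+1)*|t|) ≤ Real.exp (j*l/2) := by
    apply Real.exp_le_exp.2
    calc (|r|+1)*|t| ≤ (|r|+1)*(128*l) := mul_le_mul_of_nonneg_left htl (by positivity)
      _ ≤ _ := by nlinarith
  have e6 : t^2 * Real.exp ((|r|+1)*|t|) ≤ 16384 * (8/(j:ℝ)^2) * (((1+u)/2)^j + ((1+u)/2)⁻¹^j) := by
    calc t^2 * Real.exp ((|r|+1)*|t|) ≤ (16384 * (8/(j:ℝ)^2 * Real.exp (j*l/2))) * Real.exp (j*l/2) := by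
          apply mul_le_mul _ e5 (Real.exp_pos _).le (by positivity)
          exact e4.trans (mul_le_mul_of_nonneg_left (ell_exp j hj0 l hl0) (by norm_num))
      _ = 16384 * (8/(j:ℝ)^2) * Real.exp (j*l) := by
          have : Real.exp (j*l) = Real.exp (j*l/2) * Real.exp (j*l/2) := by rw [← Real.exp_add]; congr 1; ring
          rw [this]; ring
      _ ≤ _ := by
          apply mul_le_mul_of_nonneg_left (exp_abs_log _ (by linarith) j) (by positivity)
  have e7 := mul_le_mul_of_nonneg_left e6 (by positivity : 0 ≤ 3 * r^2)
  have e8 : 3 * r^2 * (16384 * (8/(j:ℝ)^2) * (((1+u)/2)^j + ((1+u)/2)⁻¹^j)) = 393216 * r^2 / (j:ℝ)^2 * (((1+u)/2)^j + ((1+u)/2)⁻¹^j) := by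
    ring
  rw [e8] at e7
  have e9 : (r*t)^2 * Real.exp ((|r|+1)*|t|) = r^2 * (t^2 * Real.exp ((|r|+1)*|t|)) := by ring
  nlinarith

lemma pt_pos (u r : ℝ) (j : ℕ) (hu : 0 ≤ u) (hr : 1 ≤ r) (hj : 256 * (r+1) ≤ j) :
    u ^ r ≤ 1 + r * (u - 1) + 393216 * r^2 / (j:ℝ)^2 * (((1+u)/2)^j + ((1+u)/2)⁻¹^j) := by
  have hj0 : (0:ℝ) < j := by linarith
  rcases le_total (1/64) u with h | h
  · exact pt_main u r j h (by rw [abs_of_nonneg] <;> linarith) (by rw [abs_of_nonneg] <;> linarith)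
  · have h1 : u ^ r ≤ 1 := Real.rpow_le_one hu (by linarith) (by linarith)
    set l := |Real.log ((1+u)/2)| with hl
    have hl1 : 63/128 ≤ l := by
      have h1 := Real.log_le_sub_one_of_pos (x := (1+u)/2) (by linarith)
      rw [hl]
      have := neg_abs_le (Real.log ((1+u)/2))
      linarith
    have h2 := ell_exp j hj0 l (by linarith)
    have h3 : Real.exp (j*l/2) ≤ ((1+u)/2)^j + ((1+u)/2)⁻¹^j := by
      refine le_trans ?_ (exp_abs_log _ (by linarith) j)
      apply Real.exp_le_exp.2
      have : 0 ≤ j * l := by positivity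
      rw [← hl]; linarith
    have h4 : 8 * (1/64) ≤ 8 / (j:ℝ)^2 * (((1+u)/2)^j + ((1+u)/2)⁻¹^j) := by
      have := mul_le_mul_of_nonneg_left h3 (by positivity : 0 ≤ 8/(j:ℝ)^2)
      nlinarith
    have h5 := mul_le_mul_of_nonneg_left h4 (by positivity : 0 ≤ 49152 * r^2)
    have h6 : 49152 * r^2 * (8 / (j:ℝ)^2 * (((1+u)/2)^j + ((1+u)/2)⁻¹^j)) = 393216 * r^2 / (j:ℝ)^2 * (((1+u)/2)^j + ((1+u)/2)⁻¹^j) := by ring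
    rw [h6] at h5
    nlinarith

lemma pt_neg (u s : ℝ) (j : ℕ) (hu : 0 < u) (hs : 1/2 ≤ s) (hj : 256 * (s+1) ≤ j) :
    u ^ (-s) ≤ 1 - s * (u - 1) + 393216 * s^2 / (j:ℝ)^2 * (((1+u)/2)^j + ((1+u)/2)⁻¹^j)
      + (1/2) * (Real.exp (-(j:ℝ)^2) * u⁻¹^j + Real.exp ((j:ℝ)^2) * (if u ≤ 1/64 then 1 else 0)) := by
  have hj0 : (0:ℝ) < j := by linarith
  have hE1 := Real.exp_pos (-(j:ℝ)^2)
  have hE2 := Real.exp_pos ((j:ℝ)^2)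
  have hD : 0 ≤ 393216 * s^2 / (j:ℝ)^2 * (((1+u)/2)^j + ((1+u)/2)⁻¹^j) := by positivity
  by_cases h : u ≤ 1/64
  · rw [if_pos h]
    have h1 : u ^ (-s) ≤ √(u⁻¹^j) := by
      rw [Real.sqrt_eq_rpow, ← Real.rpow_natCast, ← Real.rpow_mul (by positivity), Real.inv_rpow hu.le, ← Real.rpow_neg hu.le]
      apply Real.rpow_le_rpow_of_exponent_ge hu (by linarith)
      linarith
    have h2 : √(u⁻¹^j) ≤ (1/2) * (Real.exp (-(j:ℝ)^2) * u⁻¹^j + Real.exp ((j:ℝ)^2) * 1) := by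
      have hy : 0 ≤ u⁻¹^j := by positivity
      have h3 := Real.sq_sqrt hy
      set y := √(u⁻¹^j)
      rw [← h3]
      have h4 : Real.exp ((j:ℝ)^2) * Real.exp (-(j:ℝ)^2) = 1 := by rw [← Real.exp_add]; simp
      have h5 : 0 ≤ Real.exp ((j:ℝ)^2) * (Real.exp (-(j:ℝ)^2) * y - 1)^2 := by positivity
      have h6 : Real.exp ((j:ℝ)^2) * (Real.exp (-(j:ℝ)^2) * y - 1)^2 = (Real.exp ((j:ℝ)^2) * Real.exp (-(j:ℝ)^2)) * (Real.exp (-(j:ℝ)^2) * y^2 - 2*y) + Real.exp ((j:ℝ)^2) := by ring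
      rw [h6, h4] at h5
      linarith
    nlinarith
  · push Not at h
    rw [if_neg (not_le.2 h)]
    have h1 := pt_main u (-s) j h.le (by rw [abs_neg, abs_of_nonneg] <;> linarith) (by rw [abs_neg, abs_of_nonneg] <;> linarith)
    have h2 : 0 ≤ (1/2) * (Real.exp (-(j:ℝ)^2) * u⁻¹^j + Real.exp ((j:ℝ)^2) * 0) := by positivity
    rw [neg_sq] at h1
    linarith

lemma T_small (j : ℕ) (hj : 1000 ≤ j) : (720000000000000000000000000000 * ((j:ℝ)+1)^3)^j * Real.exp (-(j:ℝ)^2) ≤ 2 / (j:ℝ)^2 ∧ Real.exp (-(j:ℝ)^2) ≤ 1/(j:ℝ)^2 := by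
  have hj0 : (1000:ℝ) ≤ j := by exact_mod_cast hj
  have h1 : 720000000000000000000000000000 * ((j:ℝ)+1)^3 ≤ Real.exp ((j:ℝ)/2) := by
    have a1 : (2:ℝ)^250 ≤ Real.exp ((j:ℝ)/4) := by
      calc (2:ℝ)^250 ≤ (Real.exp 1)^250 := pow_le_pow_left₀ (by norm_num) (by have := Real.exp_one_gt_d9; linarith) _
        _ = Real.exp 250 := by rw [← Real.exp_nat_mul]; norm_num
        _ ≤ _ := Real.exp_le_exp.2 (by linarith)
    have a2 : ((j:ℝ)/16)^4 ≤ Real.exp ((j:ℝ)/4) := by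
      have : Real.exp ((j:ℝ)/4) = (Real.exp ((j:ℝ)/16))^4 := by rw [← Real.exp_nat_mul]; congr 1; push_cast; ring
      rw [this]
      exact pow_le_pow_left₀ (by positivity) (by have := Real.add_one_le_exp ((j:ℝ)/16); linarith) _
    have a3 : Real.exp ((j:ℝ)/2) = Real.exp ((j:ℝ)/4) * Real.exp ((j:ℝ)/4) := by rw [← Real.exp_add]; congr 1; ring
    rw [a3]
    have a4 : ((j:ℝ)+1)^3 ≤ 8 * (j:ℝ)^3 := by
      calc ((j:ℝ)+1)^3 ≤ (2*(j:ℝ))^3 := pow_le_pow_left₀ (by positivity) (by linarith) _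
        _ = _ := by ring
    have a5 : (j:ℝ)^3 ≤ 66 * ((j:ℝ)/16)^4 := by
      have : (j:ℝ)^3 * 1000 ≤ (j:ℝ)^3 * j := mul_le_mul_of_nonneg_left hj0 (by positivity)
      have e : 66 * ((j:ℝ)/16)^4 = 66/65536 * ((j:ℝ)^3 * j) := by ring
      rw [e]; have : 0 < (j:ℝ)^3 := by positivity
      linarith
    calc 720000000000000000000000000000 * ((j:ℝ)+1)^3 ≤ 720000000000000000000000000000 * (8 * (66 * ((j:ℝ)/16)^4)) := by gcongr; linarith
      _ = (720000000000000000000000000000*8*66) * ((j:ℝ)/16)^4 := by ring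
      _ ≤ 2^250 * ((j:ℝ)/16)^4 := by gcongr; norm_num
      _ ≤ _ := by gcongr
  have h2 : ∀ x : ℝ, 0 < x → Real.exp (-x) ≤ 1/x := by
    intro x hx
    rw [Real.exp_neg, ← one_div]
    apply one_div_le_one_div_of_le hx
    have := Real.add_one_le_exp x
    linarith
  refine ⟨?_, h2 _ (by positivity)⟩
  calc (720000000000000000000000000000 * ((j:ℝ)+1)^3)^j * Real.exp (-(j:ℝ)^2) ≤ (Real.exp ((j:ℝ)/2))^j * Real.exp (-(j:ℝ)^2) := by gcongr
    _ = Real.exp (-((j:ℝ)^2/2)) := by rw [← Real.exp_nat_mul, ← Real.exp_add]; congr 1; ring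
    _ ≤ 1/((j:ℝ)^2/2) := h2 _ (by positivity)
    _ = _ := by field_simp


lemma int_of_lint {Ω : Type} [MeasurableSpace Ω] (P : Measure Ω) (g : Ω → ℝ) (hg : Measurable g) (hg0 : ∀ ω, 0 ≤ g ω) (K : ℝ) (hK : 0 ≤ K)
    (h : ∫⁻ ω, ENNReal.ofReal (g ω) ∂P ≤ ENNReal.ofReal K) : Integrable g P ∧ ∫ ω, g ω ∂P ≤ K := by
  have hi : Integrable g P := by
    refine ⟨hg.aestronglyMeasurable, ?_⟩
    rw [hasFiniteIntegral_iff_ofReal (Filter.Eventually.of_forall hg0)]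
    exact h.trans_lt ENNReal.ofReal_lt_top
  refine ⟨hi, ?_⟩
  rw [← ofReal_integral_eq_lintegral_ofReal hi (Filter.Eventually.of_forall hg0)] at h
  exact (ENNReal.ofReal_le_ofReal_iff hK).1 h

lemma one_le_left {a b : ℝ≥0∞} {K : ℝ≥0∞} (h : a * b ≤ K) (hb : 1 ≤ b) : a ≤ K :=
  (le_mul_of_one_le_right bot_le hb).trans h

lemma mom_bound {Ω : Type} [MeasurableSpace Ω] (P : Measure Ω) [IsProbabilityMeasure P] (U : Ω → ℝ) (hU : Measurable U)
    (hU0 : ∀ ω, 0 ≤ U ω) (j : ℕ) (hj : 1000 ≤ j) (h1 : ∫⁻ ω, ENNReal.ofReal (U ω) ∂P = 1)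
    (h2 : (∫⁻ ω, ENNReal.ofReal (((1 + U ω)/2)^j) ∂P) * (∫⁻ ω, ENNReal.ofReal (((1 + U ω)/2)⁻¹^j) ∂P) ≤ ENNReal.ofReal (144 * Real.exp 1))
    (h3 : P {ω | U ω ≤ 1/64} ≤ ENNReal.ofReal (144 * Real.exp (-(2 * (j:ℝ)^2))))
    (h4 : ∀ᵐ ω ∂P, 0 < U ω) (h5 : ∫⁻ ω, ENNReal.ofReal ((U ω)⁻¹^j) ∂P ≤ ENNReal.ofReal (2 * (720000000000000000000000000000 * ((j:ℝ)+1)^3)^j)) :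
    (Integrable U P ∧ ∫ ω, U ω ∂P = 1) ∧
    (∀ r : ℝ, 1 ≤ r → 256 * (r+1) ≤ j → Integrable (fun ω => U ω ^ r) P ∧ ∫ ω, U ω ^ r ∂P ≤ 1 + 320000000 * r^2/(j:ℝ)^2) ∧
    (∀ s : ℝ, 1/2 ≤ s → 256 * (s+1) ≤ j → Integrable (fun ω => U ω ^ (-s)) P ∧ ∫ ω, U ω ^ (-s) ∂P ≤ 1 + 320000000 * s^2/(j:ℝ)^2) := by
  have hj0 : (1000:ℝ) ≤ j := by exact_mod_cast hj
  have hV : ∀ ω, 0 < (1 + U ω)/2 := fun ω => by have := hU0 ω; positivity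
  have hUi := (int_of_lint P U hU hU0 1 (by norm_num) (by rw [h1]; simp)).1
  have hU1 : ∫ ω, U ω ∂P = 1 := by
    rw [integral_eq_lintegral_of_nonneg_ae (Filter.Eventually.of_forall hU0) hU.aestronglyMeasurable, h1]; simp
  have hVe : ∫⁻ ω, ENNReal.ofReal ((1 + U ω)/2) ∂P = 1 := by
    rw [← ofReal_integral_eq_lintegral_ofReal (by fun_prop) (Filter.Eventually.of_forall fun ω => (hV ω).le)]
    rw [integral_div, integral_add (by fun_prop) hUi, hU1]
    simp
  have l1 : 1 ≤ ∫⁻ ω, ENNReal.ofReal (((1 + U ω)/2)^j) ∂P := by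
    have h5 : ∫⁻ ω, (ENNReal.ofReal j * ENNReal.ofReal ((1 + U ω)/2) + 1) ∂P ≤ ∫⁻ ω, (ENNReal.ofReal (((1 + U ω)/2)^j) + ENNReal.ofReal j) ∂P := by
      refine lintegral_mono fun ω => ?_
      have hv := hV ω
      simp only
      rw [← ENNReal.ofReal_mul (by positivity), ← ENNReal.ofReal_one, ← ENNReal.ofReal_add (by positivity) (by norm_num), ← ENNReal.ofReal_add (by positivity) (by positivity)]
      apply ENNReal.ofReal_le_ofReal
      have := one_add_mul_le_pow (a := (1 + U ω)/2 - 1) (by linarith) j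
      rw [add_sub_cancel] at this
      linarith
    rw [lintegral_add_right _ measurable_const, lintegral_add_right _ measurable_const, lintegral_const_mul' _ _ ENNReal.ofReal_ne_top, hVe] at h5
    simp only [mul_one, lintegral_const, measure_univ] at h5
    rw [add_comm] at h5
    exact (ENNReal.add_le_add_iff_right ENNReal.ofReal_ne_top).1 h5
  have l2 : 1 ≤ ∫⁻ ω, ENNReal.ofReal (((1 + U ω)/2)⁻¹^j) ∂P := by
    have h5 : ∫⁻ ω, (ENNReal.ofReal j + 1) ∂P ≤ ∫⁻ ω, (ENNReal.ofReal (((1 + U ω)/2)⁻¹^j) + ENNReal.ofReal j * ENNReal.ofReal ((1 + U ω)/2)) ∂P := by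
      refine lintegral_mono fun ω => ?_
      have hv := hV ω
      simp only
      rw [← ENNReal.ofReal_mul (by positivity), ← ENNReal.ofReal_one, ← ENNReal.ofReal_add (by positivity) (by norm_num), ← ENNReal.ofReal_add (by positivity) (by positivity)]
      apply ENNReal.ofReal_le_ofReal
      have := bern_neg (x := (1 + U ω)/2) hv (s := j) (by positivity)
      rw [Real.rpow_neg hv.le, Real.rpow_natCast, ← inv_pow] at this
      linarith
    rw [lintegral_add_right _ measurable_const, lintegral_add_right _ (by fun_prop), lintegral_const_mul' _ _ ENNReal.ofReal_ne_top, hVe] at h5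
    simp only [mul_one, lintegral_const, measure_univ] at h5
    rw [add_comm] at h5
    exact (ENNReal.add_le_add_iff_right ENNReal.ofReal_ne_top).1 h5
  have hK : ENNReal.ofReal (144 * Real.exp 1) ≤ ENNReal.ofReal 400 := by
    apply ENNReal.ofReal_le_ofReal; have := Real.exp_one_lt_d9; linarith
  obtain ⟨i1, b1⟩ := int_of_lint P (fun ω => ((1 + U ω)/2)^j) (by fun_prop) (fun ω => by have := hV ω; positivity) 400 (by norm_num) ((one_le_left h2 l2).trans hK)
  obtain ⟨i2, b2⟩ := int_of_lint P (fun ω => ((1 + U ω)/2)⁻¹^j) (by fun_prop) (fun ω => by have := hV ω; positivity) 400 (by norm_num) ((one_le_left (by rw [mul_comm]; exact h2) l1).trans hK)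
  obtain ⟨i3, b3⟩ := int_of_lint P (fun ω => (U ω)⁻¹^j) (by fun_prop) (fun ω => by have := hU0 ω; positivity) _ (by positivity) h5
  have hmS : MeasurableSet {ω | U ω ≤ 1/64} := measurableSet_le hU measurable_const
  have hmI : Measurable (fun ω => if U ω ≤ 1/64 then (1:ℝ) else 0) := Measurable.ite hmS measurable_const measurable_const
  obtain ⟨i4, b4⟩ := int_of_lint P (fun ω => if U ω ≤ 1/64 then (1:ℝ) else 0) hmI (fun ω => by split_ifs <;> norm_num) (144 * Real.exp (-(2 * (j:ℝ)^2))) (by positivity) (by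
    refine le_trans (le_of_eq ?_) h3
    rw [← lintegral_indicator_one hmS]
    refine lintegral_congr fun ω => ?_
    by_cases h : U ω ≤ 1/64
    · rw [Set.indicator_of_mem (show ω ∈ {ω | U ω ≤ 1/64} from h), if_pos h]; simp
    · rw [Set.indicator_of_notMem (show ω ∉ {ω | U ω ≤ 1/64} from h), if_neg h]; simp)
  refine ⟨⟨hUi, hU1⟩, ?_, ?_⟩
  · intro r hr hjr
    set D := 393216 * r^2 / (j:ℝ)^2 with hD
    have hD0 : 0 ≤ D := by positivity
    have hgi : Integrable (fun ω => 1 + r * (U ω - 1) + D * (((1 + U ω)/2)^j + ((1 + U ω)/2)⁻¹^j)) P := by fun_prop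
    have hpt : ∀ ω, U ω ^ r ≤ 1 + r * (U ω - 1) + D * (((1 + U ω)/2)^j + ((1 + U ω)/2)⁻¹^j) := fun ω => pt_pos (U ω) r j (hU0 ω) hr hjr
    have hri : Integrable (fun ω => U ω ^ r) P := by
      refine hgi.mono' (hU.pow_const _).aestronglyMeasurable (Filter.Eventually.of_forall fun ω => ?_)
      rw [Real.norm_of_nonneg (Real.rpow_nonneg (hU0 ω) _)]; exact hpt ω
    refine ⟨hri, (integral_mono hri hgi hpt).trans ?_⟩
    have j1 : Integrable (fun ω => r * (U ω - 1)) P := by fun_prop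
    have j2 : Integrable (fun ω => 1 + r * (U ω - 1)) P := by fun_prop
    have j3 : Integrable (fun ω => D * (((1 + U ω)/2)^j + ((1 + U ω)/2)⁻¹^j)) P := by fun_prop
    rw [integral_add j2 j3, integral_add (by fun_prop) j1, integral_const_mul, integral_const_mul, integral_add i1 i2, integral_sub hUi (by fun_prop), hU1]
    simp only [integral_const, probReal_univ, smul_eq_mul]
    have := mul_le_mul_of_nonneg_left (add_le_add b1 b2) hD0
    have e : 320000000 * r^2/(j:ℝ)^2 = 320000000/393216 * D := by rw [hD]; ring
    rw [e]; norm_num at this ⊢; linarith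
  · intro r hr hjr
    set D := 393216 * r^2 / (j:ℝ)^2 with hD
    have hD0 : 0 ≤ D := by positivity
    have j0 : Integrable (fun ω => (1/2) * (Real.exp (-(j:ℝ)^2) * (U ω)⁻¹^j + Real.exp ((j:ℝ)^2) * (if U ω ≤ 1/64 then (1:ℝ) else 0))) P := ((i3.const_mul _).add (i4.const_mul _)).const_mul _
    have j1 : Integrable (fun ω => r * (U ω - 1)) P := by fun_prop
    have j2 : Integrable (fun ω => 1 - r * (U ω - 1)) P := by fun_prop
    have j3 : Integrable (fun ω => D * (((1 + U ω)/2)^j + ((1 + U ω)/2)⁻¹^j)) P := by fun_prop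
    have j4 : Integrable (fun ω => 1 - r * (U ω - 1) + D * (((1 + U ω)/2)^j + ((1 + U ω)/2)⁻¹^j)) P := by fun_prop
    have hgi := j4.add j0
    have hpt : ∀ᵐ ω ∂P, U ω ^ (-r) ≤ 1 - r * (U ω - 1) + D * (((1 + U ω)/2)^j + ((1 + U ω)/2)⁻¹^j)
      + (1/2) * (Real.exp (-(j:ℝ)^2) * (U ω)⁻¹^j + Real.exp ((j:ℝ)^2) * (if U ω ≤ 1/64 then (1:ℝ) else 0)) := by
      filter_upwards [h4] with ω hω
      exact pt_neg (U ω) r j hω hr hjr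
    have hri : Integrable (fun ω => U ω ^ (-r)) P := by
      refine hgi.mono' (hU.pow_const _).aestronglyMeasurable ?_
      filter_upwards [hpt] with ω hω
      rw [Real.norm_of_nonneg (Real.rpow_nonneg (hU0 ω) _)]; exact hω
    refine ⟨hri, (integral_mono_ae hri hgi hpt).trans ?_⟩
    simp only [Pi.add_apply]
    rw [integral_add j4 j0, integral_add j2 j3, integral_sub (by fun_prop) j1, integral_const_mul, integral_const_mul, integral_const_mul, integral_add i1 i2, integral_sub hUi (by fun_prop), hU1,
      integral_add (i3.const_mul _) (i4.const_mul _), integral_const_mul, integral_const_mul]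
    simp only [integral_const, probReal_univ, smul_eq_mul]
    have t1 := mul_le_mul_of_nonneg_left (add_le_add b1 b2) hD0
    have t3 := mul_le_mul_of_nonneg_left b3 (Real.exp_pos (-(j:ℝ)^2)).le
    have t4 := mul_le_mul_of_nonneg_left b4 (Real.exp_pos ((j:ℝ)^2)).le
    have t5 : Real.exp ((j:ℝ)^2) * (144 * Real.exp (-(2 * (j:ℝ)^2))) = 144 * Real.exp (-(j:ℝ)^2) := by
      rw [mul_left_comm, ← Real.exp_add]; congr 2; ring
    rw [t5] at t4
    obtain ⟨s1, s2⟩ := T_small j hj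
    have s3 : 74/(j:ℝ)^2 ≤ 296/393216 * D := by
      rw [hD, show 296/393216 * (393216 * r^2 / (j:ℝ)^2) = (296 * r^2)/(j:ℝ)^2 by ring]
      gcongr
      nlinarith
    have s4 : 74/(j:ℝ)^2 = 2/(j:ℝ)^2 + 72 * (1/(j:ℝ)^2) := by ring
    have e : 320000000 * r^2/(j:ℝ)^2 = 320000000/393216 * D := by rw [hD]; ring
    rw [e]
    set E1 := Real.exp (-(j:ℝ)^2)
    set TT := (720000000000000000000000000000 * ((j:ℝ)+1)^3)^j
    have t3' : E1 * ∫ ω, (U ω)⁻¹^j ∂P ≤ 2 * (TT * E1) := by linarith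
    simp only [sub_self, mul_zero, sub_zero, mul_one]
    have z : (320000000:ℝ)/393216 * D = 320000000/393216 * D := by norm_num
    rw [z]
    linarith


lemma rpow_up {I x p : ℝ} (hI : 1 ≤ I) (hIx : I ≤ 1 + x) (hp : 1 ≤ p) : 1 ≤ I^(1/p) ∧ I^(1/p) ≤ 1 + x/p := by
  have h0 : 0 ≤ 1/p := by positivity
  refine ⟨Real.one_le_rpow hI h0, ?_⟩
  have h1 : 1/p ≤ 1 := by rw [div_le_one (by linarith)]; exact hp
  refine (bern_mid (by linarith) h0 h1).trans ?_
  have : 1/p * (I-1) ≤ 1/p * x := mul_le_mul_of_nonneg_left (by linarith) h0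
  have e : x/p = 1/p*x := by ring
  rw [e]; linarith

lemma rpow_dn {I x p : ℝ} (hI : 1 ≤ I) (hIx : I ≤ 1 + x) (hp : p < 0) : I^(1/p) ≤ 1 ∧ 1 - x/(-p) ≤ I^(1/p) := by
  have h0 : 0 ≤ 1/(-p) := by have : 0 < -p := by linarith
                             positivity
  have e : 1/p = -(1/(-p)) := by rw [div_neg, neg_neg]
  rw [e]
  refine ⟨Real.rpow_le_one_of_one_le_of_nonpos hI (by linarith), ?_⟩
  refine le_trans ?_ (bern_neg (by linarith) h0)
  have : 1/(-p) * (I-1) ≤ 1/(-p) * x := mul_le_mul_of_nonneg_left (by linarith) h0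
  have e : x/(-p) = 1/(-p)*x := by ring
  rw [e]; linarith

lemma final_abs {Ω : Type} [MeasurableSpace Ω] (P : Measure Ω) [IsProbabilityMeasure P] (U : Ω → ℝ) (hU : Measurable U)
    (hU0 : ∀ ω, 0 ≤ U ω) (j : ℕ) (hj : 1000 ≤ j) (h4 : ∀ᵐ ω ∂P, 0 < U ω)
    (hUi : Integrable U P) (hU1 : ∫ ω, U ω ∂P = 1)
    (hpos : ∀ r : ℝ, 1 ≤ r → 256 * (r+1) ≤ j → Integrable (fun ω => U ω ^ r) P ∧ ∫ ω, U ω ^ r ∂P ≤ 1 + 320000000 * r^2/(j:ℝ)^2)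
    (hneg : ∀ s : ℝ, 1/2 ≤ s → 256 * (s+1) ≤ j → Integrable (fun ω => U ω ^ (-s)) P ∧ ∫ ω, U ω ^ (-s) ∂P ≤ 1 + 320000000 * s^2/(j:ℝ)^2)
    (p : ℝ) (hp0 : p ≠ 0) (hp2 : 1 ≤ |p - 2|) (hpj : 256 * (|p|/2+1) ≤ j) :
    1 - 320000000 * |p-2|/(j:ℝ)^2 ≤ (∫ ω, U ω ^ (p/2) ∂P)^(1/p) ∧ (∫ ω, U ω ^ (p/2) ∂P)^(1/p) ≤ 1 + 320000000 * |p-2|/(j:ℝ)^2 := by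
  have hj0 : (1000:ℝ) ≤ j := by exact_mod_cast hj
  set c := (320000000:ℝ)/(j:ℝ)^2 with hc
  have hc0 : 0 ≤ c := by positivity
  have eC : 320000000 * |p-2|/(j:ℝ)^2 = c * |p-2| := by rw [hc]; ring
  rw [eC]
  -- lower bound one for negative exponents
  have hn1 : ∀ s : ℝ, 0 ≤ s → Integrable (fun ω => U ω ^ (-s)) P → 1 ≤ ∫ ω, U ω ^ (-s) ∂P := by
    intro s hs hi
    have j2 : Integrable (fun ω => 1 - s * (U ω - 1)) P := by fun_prop
    have j1 : Integrable (fun ω => s * (U ω - 1)) P := by fun_prop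
    have h := integral_mono_ae j2 hi (by filter_upwards [h4] with ω hω using bern_neg hω hs)
    rw [integral_sub (by fun_prop) j1, integral_const_mul, integral_sub hUi (by fun_prop), hU1] at h
    simpa using h
  have habs : 0 ≤ c * |p-2| := by positivity
  rcases lt_or_ge p (-1) with hpm | hpm
  · have ep : |p| = -p := abs_of_neg (by linarith)
    have ep2 : |p-2| = 2 - p := by rw [abs_of_neg (by linarith)]; ring
    rw [ep] at hpj
    obtain ⟨hi, hb⟩ := hneg (-p/2) (by linarith) (by linarith)
    have h1 := hn1 (-p/2) (by linarith) hi
    have e : -(-p/2) = p/2 := by ring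
    rw [e] at h1 hb
    obtain ⟨a1, a2⟩ := rpow_dn h1 hb (by linarith : p < 0)
    have e3 : 320000000 * (-p/2)^2/(j:ℝ)^2/(-p) = c * (-p/4) := by
      have : p ≠ 0 := hp0
      rw [hc]; field_simp; ring
    rw [e3] at a2
    have : c * (-p/4) ≤ c * |p-2| := mul_le_mul_of_nonneg_left (by rw [ep2]; linarith) hc0
    constructor <;> linarith
  rcases le_or_gt p 1 with hp1 | hp1
  · have ep2 : |p-2| = 2 - p := by rw [abs_of_neg (by linarith)]; ring
    obtain ⟨hi, hb⟩ := hneg (1/2) le_rfl (by linarith)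
    have hG1 := hn1 (1/2) (by norm_num) hi
    set G := ∫ ω, U ω ^ (-(1/2:ℝ)) ∂P with hG
    have hG0 : 0 < G := by linarith
    have hGc : 1 - c * |p-2| ≤ G⁻¹ := by
      have h1 : 1 - (G - 1) ≤ G⁻¹ := by
        rw [← one_div, le_div_iff₀ hG0]; nlinarith [sq_nonneg (G-1)]
      have h2 : G - 1 ≤ c * (1/4) := by
        have : 320000000 * (1/2:ℝ)^2/(j:ℝ)^2 = c * (1/4) := by rw [hc]; ring
        linarith
      have : c * (1/4) ≤ c * |p-2| := mul_le_mul_of_nonneg_left (by linarith) hc0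
      linarith
    have jy : Integrable (fun ω => U ω ^ (-(1/2:ℝ)) / G) P := hi.div_const _
    have iy : ∫ ω, U ω ^ (-(1/2:ℝ)) / G ∂P = 1 := by
      rw [integral_div, ← hG, div_self hG0.ne']
    rcases lt_or_gt_of_ne hp0 with hneg0 | hpos0
    · -- -1 ≤ p < 0
      have hpt : ∀ᵐ ω ∂P, U ω ^ (p/2) ≤ G^(-p) * (1 + (-p) * (U ω ^ (-(1/2:ℝ)) / G - 1)) := by
        filter_upwards [h4] with ω hω
        have hy : 0 < U ω ^ (-(1/2:ℝ)) := Real.rpow_pos_of_pos hω _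
        have h := bern_mid (x := U ω ^ (-(1/2:ℝ)) / G) (r := -p) (by positivity) (by linarith) (by linarith)
        have e : U ω ^ (p/2) = G^(-p) * (U ω ^ (-(1/2:ℝ)) / G)^(-p) := by
          rw [← Real.mul_rpow hG0.le (by positivity), mul_div_cancel₀ _ hG0.ne', ← Real.rpow_mul hω.le]
          congr 1; ring
        rw [e]
        exact mul_le_mul_of_nonneg_left h (by positivity)
      have j1 : Integrable (fun ω => (-p) * (U ω ^ (-(1/2:ℝ)) / G - 1)) P := (jy.sub (integrable_const _)).const_mul _
      have j2 : Integrable (fun ω => 1 + (-p) * (U ω ^ (-(1/2:ℝ)) / G - 1)) P := (integrable_const _).add j1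
      have j3 : Integrable (fun ω => G^(-p) * (1 + (-p) * (U ω ^ (-(1/2:ℝ)) / G - 1))) P := j2.const_mul _
      have hri : Integrable (fun ω => U ω ^ (p/2)) P := by
        refine j3.mono' (hU.pow_const _).aestronglyMeasurable ?_
        filter_upwards [hpt] with ω hω
        rw [Real.norm_of_nonneg (Real.rpow_nonneg (hU0 ω) _)]; exact hω
      have hle := integral_mono_ae hri j3 hpt
      rw [integral_const_mul, integral_add (integrable_const _) j1, integral_const_mul, integral_sub jy (integrable_const _), iy] at hle
      simp only [integral_const, probReal_univ, smul_eq_mul, mul_one, sub_self, mul_zero, add_zero] at hle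
      have hge := hn1 (-p/2) (by linarith) (by convert hri using 3; ring)
      rw [show -(-p/2) = p/2 by ring] at hge
      constructor
      · refine hGc.trans ?_
        have e : G⁻¹ = (G^(-p))^(1/p) := by
          rw [← Real.rpow_mul hG0.le, show -p * (1/p) = -1 by field_simp, Real.rpow_neg_one]
        rw [e]
        apply Real.rpow_le_rpow_of_nonpos (by linarith) hle
        exact (one_div_neg.2 hneg0).le
      · have := (rpow_dn hge (x := (∫ ω, U ω ^ (p/2) ∂P) - 1) (by linarith) hneg0).1
        linarith
    · -- 0 < p ≤ 1
      have hpt : ∀ᵐ ω ∂P, G^(-p) * (1 - p * (U ω ^ (-(1/2:ℝ)) / G - 1)) ≤ U ω ^ (p/2) := by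
        filter_upwards [h4] with ω hω
        have hy : 0 < U ω ^ (-(1/2:ℝ)) := Real.rpow_pos_of_pos hω _
        have h := bern_neg (x := U ω ^ (-(1/2:ℝ)) / G) (s := p) (by positivity) hpos0.le
        have e : U ω ^ (p/2) = G^(-p) * (U ω ^ (-(1/2:ℝ)) / G)^(-p) := by
          rw [← Real.mul_rpow hG0.le (by positivity), mul_div_cancel₀ _ hG0.ne', ← Real.rpow_mul hω.le]
          congr 1; ring
        rw [e]
        exact mul_le_mul_of_nonneg_left h (by positivity)
      have j1 : Integrable (fun ω => p * (U ω ^ (-(1/2:ℝ)) / G - 1)) P := (jy.sub (integrable_const _)).const_mul _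
      have j2 : Integrable (fun ω => 1 - p * (U ω ^ (-(1/2:ℝ)) / G - 1)) P := (integrable_const _).sub j1
      have j3 : Integrable (fun ω => G^(-p) * (1 - p * (U ω ^ (-(1/2:ℝ)) / G - 1))) P := j2.const_mul _
      have k1 : Integrable (fun ω => p/2 * (U ω - 1)) P := by fun_prop
      have k2 : Integrable (fun ω => 1 + p/2 * (U ω - 1)) P := by fun_prop
      have hpt2 : ∀ ω, U ω ^ (p/2) ≤ 1 + p/2 * (U ω - 1) := fun ω => bern_mid (hU0 ω) (by linarith) (by linarith)
      have hri : Integrable (fun ω => U ω ^ (p/2)) P := by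
        refine k2.mono' (hU.pow_const _).aestronglyMeasurable (Filter.Eventually.of_forall fun ω => ?_)
        rw [Real.norm_of_nonneg (Real.rpow_nonneg (hU0 ω) _)]; exact hpt2 ω
      have hge := integral_mono_ae j3 hri hpt
      rw [integral_const_mul, integral_sub (integrable_const _) j1, integral_const_mul, integral_sub jy (integrable_const _), iy] at hge
      simp only [integral_const, probReal_univ, smul_eq_mul, mul_one, sub_self, mul_zero, sub_zero] at hge
      have hle := integral_mono hri k2 hpt2
      rw [integral_add (integrable_const _) k1, integral_const_mul, integral_sub hUi (integrable_const _), hU1] at hle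
      simp only [integral_const, probReal_univ, smul_eq_mul, mul_one, sub_self, mul_zero, add_zero] at hle
      have hGp : 0 < G^(-p) := by positivity
      constructor
      · refine hGc.trans ?_
        have e : G⁻¹ = (G^(-p))^(1/p) := by
          rw [← Real.rpow_mul hG0.le, show -p * (1/p) = -1 by field_simp, Real.rpow_neg_one]
        rw [e]
        exact Real.rpow_le_rpow hGp.le hge (by positivity)
      · have := Real.rpow_le_one (by linarith) hle (by positivity : 0 ≤ 1/p)
        linarith
  · have hp3 : 3 ≤ p := by
      by_contra hcon
      push Not at hcon
      have : |p-2| < 1 := abs_lt.2 ⟨by linarith, by linarith⟩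
      linarith
    have ep : |p| = p := abs_of_pos (by linarith)
    have ep2 : |p-2| = p - 2 := abs_of_pos (by linarith)
    rw [ep] at hpj
    obtain ⟨hi, hb⟩ := hpos (p/2) (by linarith) hpj
    have h1 : 1 ≤ ∫ ω, U ω ^ (p/2) ∂P := by
      have k1 : Integrable (fun ω => p/2 * (U ω - 1)) P := by fun_prop
      have k2 : Integrable (fun ω => 1 + p/2 * (U ω - 1)) P := by fun_prop
      have h := integral_mono k2 hi (fun ω => bern_pos (hU0 ω) (by linarith))
      rw [integral_add (integrable_const _) k1, integral_const_mul, integral_sub hUi (integrable_const _), hU1] at h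
      simpa using h
    obtain ⟨a1, a2⟩ := rpow_up h1 hb (by linarith : 1 ≤ p)
    have e3 : 320000000 * (p/2)^2/(j:ℝ)^2/p = c * (p/4) := by
      rw [hc]; field_simp; ring
    rw [e3] at a2
    have : c * (p/4) ≤ c * |p-2| := mul_le_mul_of_nonneg_left (by rw [ep2]; linarith) hc0
    constructor <;> linarith


lemma ratio_eq {n : ℕ} (hn : 1 ≤ n) {Ω : Type} [MeasurableSpace Ω] (P : Measure Ω)
    (Y : Ω → EuclideanSpace ℝ (Fin n)) (U : Ω → ℝ) (hU : U = fun ω => ‖Y ω‖^2 / n) (hU1 : ∫ ω, U ω ∂P = 1) (p : ℝ) (hp : p ≠ 0) :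
    (∫ ω, ‖Y ω‖^p ∂P)^(1/p) / (∫ ω, ‖Y ω‖^(2:ℝ) ∂P)^((1:ℝ)/2) = (∫ ω, U ω ^ (p/2) ∂P)^(1/p) := by
  have hn0 : (0:ℝ) < n := by exact_mod_cast hn
  have hU0 : ∀ ω, 0 ≤ U ω := fun ω => by rw [hU]; positivity
  have e0 : ∀ ω, ‖Y ω‖^2 = n * U ω := fun ω => by rw [hU]; field_simp
  have e1 : ∀ ω, ‖Y ω‖^(2:ℝ) = n * U ω := fun ω => by rw [← e0, ← Real.rpow_natCast]; norm_num
  have e2 : ∀ ω, ‖Y ω‖^p = (n:ℝ)^(p/2) * U ω ^ (p/2) := by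
    intro ω
    rw [← Real.mul_rpow hn0.le (hU0 ω), ← e1, ← Real.rpow_mul (norm_nonneg _)]
    congr 1; ring
  simp_rw [e1, e2]
  rw [integral_const_mul, integral_const_mul, hU1, mul_one]
  have hI : 0 ≤ ∫ ω, U ω ^ (p/2) ∂P := integral_nonneg fun ω => Real.rpow_nonneg (hU0 ω) _
  rw [Real.mul_rpow (by positivity) hI, ← Real.rpow_mul hn0.le, show p/2*(1/p) = 1/2 by field_simp]
  have : (n:ℝ)^((1:ℝ)/2) ≠ 0 := by positivity
  field_simp

lemma param {N q D α : ℝ} {j : ℕ} (hα : 1 ≤ α) (hN : 0 < N) (hD : 1 ≤ D) (hq : q = N^(α/(2*(α+2)))) (hjq : (j:ℝ) ≤ q/D) :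
    D * ((j:ℝ)^2)^(1+2/α) ≤ N := by
  have hq0 : 0 < q := by rw [hq]; positivity
  set e := 1+2/α with he
  have he0 : 1 ≤ e := by rw [he]; have : 0 < 2/α := by positivity
                         linarith
  have h1 : ((j:ℝ)^2)^e ≤ ((q/D)^2)^e := by
    apply Real.rpow_le_rpow (by positivity) _ (by linarith)
    exact pow_le_pow_left₀ (by positivity) hjq 2
  have h2 : (q^2)^e = N := by
    rw [hq, ← Real.rpow_natCast, ← Real.rpow_mul hN.le, ← Real.rpow_mul hN.le]
    have : α/(2*(α+2)) * ((2:ℕ):ℝ) * e = 1 := by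
      rw [he]; push_cast; field_simp
    rw [this, Real.rpow_one]
  have h3 : D ≤ (D^2)^e := by
    calc D ≤ D^2 := by nlinarith
      _ = (D^2)^(1:ℝ) := (Real.rpow_one _).symm
      _ ≤ _ := Real.rpow_le_rpow_of_exponent_le (by nlinarith) he0
  rw [div_pow, Real.div_rpow (by positivity) (by positivity), h2] at h1
  have h4 : 0 < (D^2)^e := by positivity
  calc D * ((j:ℝ)^2)^e ≤ D * (N / (D^2)^e) := by gcongr
    _ ≤ (D^2)^e * (N / (D^2)^e) := by gcongr
    _ = N := by field_simp

def DD : ℝ := Real.exp 130 * 64 * 5184 * 14085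

lemma DD_one : 1 ≤ DD := by
  unfold DD
  have : (1:ℝ) ≤ Real.exp 130 := Real.one_le_exp (by norm_num)
  linarith

lemma hcond_of {n Λ b α : ℝ} {j m : ℕ} (hα : 1 ≤ α) (hpos : 0 < Λ^2*b^2) (hj : 1 ≤ j) (hm : m = 8*j^2)
    (h : DD * ((j:ℝ)^2)^(1+2/α) ≤ n/(Λ^2*b^2)) :
    Real.exp 130 * (b^2 * (8*((m:ℝ)+1))^(2/α) * Λ^2) * (1564*((m:ℝ)+1)+1) ≤ n/64 := by
  have hj0 : (1:ℝ) ≤ j := by exact_mod_cast hj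
  have hmr : (m:ℝ) + 1 ≤ 9 * (j:ℝ)^2 := by rw [hm]; push_cast; nlinarith
  have h1 : (8*((m:ℝ)+1))^(2/α) ≤ 5184 * ((j:ℝ)^2)^(2/α) := by
    calc (8*((m:ℝ)+1))^(2/α) ≤ (72 * (j:ℝ)^2)^(2/α) := Real.rpow_le_rpow (by positivity) (by linarith) (by positivity)
      _ = 72^(2/α) * ((j:ℝ)^2)^(2/α) := Real.mul_rpow (by norm_num) (by positivity)
      _ ≤ _ := by
        gcongr
        calc (72:ℝ)^(2/α) ≤ 72^(2:ℝ) := Real.rpow_le_rpow_of_exponent_le (by norm_num) (by rw [div_le_iff₀ (by linarith)]; linarith)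
          _ = 5184 := by rw [show (2:ℝ) = ((2:ℕ):ℝ) by norm_num, Real.rpow_natCast]; norm_num
  have h2 : 1564*((m:ℝ)+1)+1 ≤ 14085 * (j:ℝ)^2 := by
    have : (0:ℝ) ≤ m := Nat.cast_nonneg m
    linarith
  rw [le_div_iff₀ hpos, Real.rpow_add (by positivity), Real.rpow_one] at h
  rw [le_div_iff₀ (by norm_num : (0:ℝ) < 64)]
  refine le_trans ?_ h
  unfold DD
  have hE := Real.exp_pos 130
  calc Real.exp 130 * (b^2 * (8*((m:ℝ)+1))^(2/α) * Λ^2) * (1564*((m:ℝ)+1)+1) * 64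
      ≤ Real.exp 130 * (b^2 * (5184 * ((j:ℝ)^2)^(2/α)) * Λ^2) * (14085 * (j:ℝ)^2) * 64 := by gcongr
    _ = _ := by ring

theorem statement6_aux (n : ℕ) (hn : 1 ≤ n) (Ω : Type) (mΩ : MeasurableSpace Ω) (P : Measure Ω) (hP : IsProbabilityMeasure P)
    (X : Ω → EuclideanSpace ℝ (Fin n)) (f : EuclideanSpace ℝ (Fin n) → ℝ) (α b : ℝ) (A : Matrix (Fin n) (Fin n) ℝ)
    (hd : HasDensityFn P X f) (hlc : IsLogConcaveFn f) (hI : Isotropic P X) (hα : 1 ≤ α) (hα2 : α ≤ 2) (hψ : IsPsiAlpha P X α b)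
    (hA : hsNorm A ^ 2 = n) (p : ℝ) (hp : p ≠ 0) (hp1 : 1 ≤ |p - 2|)
    (hp2 : |p - 2| ≤ 1/(2000*DD) * ((n:ℝ)/(opNorm A^2*b^2))^(α/(2*(α+2)))) :
    (1 - (1280000000*DD^2)*|p-2|/((n:ℝ)/(opNorm A^2*b^2))^(α/(α+2)) ≤ (∫ ω, ‖mApp A (X ω)‖^p ∂P)^(1/p)/(∫ ω, ‖mApp A (X ω)‖^(2:ℝ) ∂P)^((1:ℝ)/2)) ∧
    ((∫ ω, ‖mApp A (X ω)‖^p ∂P)^(1/p)/(∫ ω, ‖mApp A (X ω)‖^(2:ℝ) ∂P)^((1:ℝ)/2) ≤ 1 + (1280000000*DD^2)*|p-2|/((n:ℝ)/(opNorm A^2*b^2))^(α/(α+2))) := by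
  have hn0 : (0:ℝ) < n := by exact_mod_cast hn
  set N := (n:ℝ)/(opNorm A^2*b^2) with hN
  set q := N^(α/(2*(α+2))) with hq
  have hD1 := DD_one
  have hD0 : 0 < DD := by linarith
  have hN0 : 0 < N := by
    rcases (by positivity : 0 ≤ N).eq_or_lt with h | h
    · rw [hq, ← h, Real.zero_rpow (by positivity)] at hp2
      linarith
    · exact h
  have hpos : 0 < opNorm A^2*b^2 := by
    rcases (by positivity : 0 ≤ opNorm A^2*b^2).eq_or_lt with h | h
    · rw [hN, ← h] at hN0; simp at hN0
    · exact h
  have hq0 : 0 < q := by positivity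
  have hqD : |p-2| ≤ (q/DD)/2000 := by
    refine hp2.trans (le_of_eq ?_); field_simp
  set j := ⌊q/DD⌋₊ with hj
  have hj1 : (j:ℝ) ≤ q/DD := Nat.floor_le (by positivity)
  have hj2 : q/DD < j + 1 := Nat.lt_floor_add_one _
  have hj3 : 1000 ≤ j := by
    have : (999:ℝ) < j := by linarith
    have : 999 < j := by exact_mod_cast this
    omega
  have hj4 : q/DD ≤ 2 * j := by linarith
  have hcond := hcond_of (m := 8*j^2) hα hpos (by omega : 1 ≤ j) rfl (param hα hN0 hD1 hq hj1)
  have hX := hd.1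
  obtain ⟨a1, a2, a3, a4, a5⟩ := setting hn P X hX (law_PL P X f hd hlc) hI α b hα hα2 hψ A hA j (8*j^2) (by omega) rfl hcond _ rfl
  have hUm : Measurable (fun ω => ‖mApp A (X ω)‖^2 / (n:ℝ)) := by
    have : Continuous (fun x : EuclideanSpace ℝ (Fin n) => mApp A x) := (LinearMap.toContinuousLinearMap (Matrix.toEuclideanLin A)).continuous
    have := this.measurable
    fun_prop
  have hU0 : ∀ ω, 0 ≤ ‖mApp A (X ω)‖^2 / (n:ℝ) := fun ω => by positivity
  obtain ⟨⟨b1, b2⟩, b3, b4⟩ := mom_bound P _ hUm hU0 j hj3 a1 a2 a3 a4 a5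
  have hpp : |p| ≤ 3 * |p-2| := by
    have : |p| ≤ |p-2| + |(2:ℝ)| := by
      calc |p| = |(p-2)+2| := by ring_nf
        _ ≤ _ := abs_add_le _ _
    rw [abs_of_pos (by norm_num : (0:ℝ) < 2)] at this
    linarith
  have hfin := final_abs P _ hUm hU0 j hj3 a4 b1 b2 b3 b4 p hp hp1 (by linarith)
  rw [ratio_eq hn P (fun ω => mApp A (X ω)) _ rfl b2 p hp]
  have hk : N^(α/(α+2)) = q^2 := by
    rw [hq, ← Real.rpow_natCast, ← Real.rpow_mul hN0.le]
    congr 1; push_cast; field_simp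
  have hle : 320000000 * |p-2|/(j:ℝ)^2 ≤ (1280000000*DD^2)*|p-2|/N^(α/(α+2)) := by
    rw [hk]
    have hj0 : (0:ℝ) < j := by have : (1000:ℝ) ≤ j := by exact_mod_cast hj3
                               linarith
    have hqj : q^2 ≤ 4 * DD^2 * (j:ℝ)^2 := by
      rw [div_le_iff₀ hD0] at hj4
      calc q^2 ≤ (2 * j * DD)^2 := pow_le_pow_left₀ hq0.le hj4 2
        _ = _ := by ring
    rw [div_le_div_iff₀ (by positivity) (by positivity)]
    calc 320000000 * |p-2| * q^2 ≤ 320000000 * |p-2| * (4 * DD^2 * (j:ℝ)^2) := by gcongr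
      _ = _ := by ring
  constructor
  · exact le_trans (by linarith) hfin.1
  · exact hfin.2.trans (by linarith)

/-- small-range moment estimates for `|AX|`. -/
theorem statement6 :
    ∃ c₁ C : ℝ, 0 < c₁ ∧ 0 < C ∧
      ∀ (n : ℕ), 1 ≤ n →
      ∀ (Ω : Type) (_mΩ : MeasurableSpace Ω) (P : Measure Ω),
        IsProbabilityMeasure P →
        ∀ (X : Ω → EuclideanSpace ℝ (Fin n)) (f : EuclideanSpace ℝ (Fin n) → ℝ)
          (α b : ℝ) (A : Matrix (Fin n) (Fin n) ℝ),
          HasDensityFn P X f → IsLogConcaveFn f → Isotropic P X →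
          1 ≤ α → α ≤ 2 → IsPsiAlpha P X α b →
          hsNorm A ^ 2 = n →
          ∀ p : ℝ, p ≠ 0 → 1 ≤ |p - 2| →
            |p - 2| ≤ c₁ * ((n : ℝ) / (opNorm A ^ 2 * b ^ 2)) ^ (α / (2 * (α + 2))) →
            1 - C * |p - 2| / ((n : ℝ) / (opNorm A ^ 2 * b ^ 2)) ^ (α / (α + 2)) ≤
                (∫ ω, ‖mApp A (X ω)‖ ^ p ∂P) ^ (1/p) /
                  (∫ ω, ‖mApp A (X ω)‖ ^ (2:ℝ) ∂P) ^ ((1:ℝ)/2) ∧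
              (∫ ω, ‖mApp A (X ω)‖ ^ p ∂P) ^ (1/p) /
                  (∫ ω, ‖mApp A (X ω)‖ ^ (2:ℝ) ∂P) ^ ((1:ℝ)/2) ≤
                1 + C * |p - 2| / ((n : ℝ) / (opNorm A ^ 2 * b ^ 2)) ^ (α / (α + 2)) := by
  refine ⟨1/(2000*DD), 1280000000*DD^2, ?_, ?_, ?_⟩
  · have := DD_one
    positivity
  · have := DD_one
    positivity
  intro n hn Ω mΩ P hP X f α b A hd hlc hI hα hα2 hψ hA p hp hp1 hp2
  exact statement6_aux n hn Ω mΩ P hP X f α b A hd hlc hI hα hα2 hψ hA p hp hp1 hp2
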